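/- There exist two critical values 0 < ε_c^p < ε_c^w < ∞, namely ε_c^a := sup{ε > 0 : F^a(ε) = 0} for a ∈ {p,w}, such that for each a ∈ {p,w}: F^a(ε) = 0 for every ε ∈ [0, ε_c^a]; 0 < F^a(ε) < ∞ for every ε > ε_c^a; F^a(ε)/log ε → 1 as ε → ∞; and F^a is real analytic on the interval (ε_c^a, ∞). -/

import Mathlib

open MeasureTheory Filter Topology Set
open scoped ENNReal NNReal BigOperators

noncomputable section

/-- The field `(φ_1, …, φ_{N-1})` extended to `ℤ` with zero boundary conditions
`φ_{-1} = φ_0 = φ_N = φ_{N+1} = 0`. -/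
def fieldExt (N : ℕ) (φ : Fin (N - 1) → ℝ) (i : ℤ) : ℝ :=
  if h : 0 < i ∧ i < (N : ℤ) then φ ⟨i.toNat - 1, by omega⟩ else 0

/-- `exp(−H_{[−1,N+1]}(φ))` with zero boundary conditions, where `E = exp(−V)` and
`H_{[a,b]}(φ) = ∑_{n=a+1}^{b-1} V(φ_{n+1} + φ_{n-1} - 2 φ_n)`. -/
def hamWeight (E : ℝ → ℝ) (N : ℕ) (φ : Fin (N - 1) → ℝ) : ℝ :=
  ∏ n ∈ Finset.Icc (0 : ℤ) (N : ℤ),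
    E (fieldExt N φ (n + 1) + fieldExt N φ (n - 1) - 2 * fieldExt N φ n)

/-- the single-site reference measure `ε δ_0(dx) + dx` of the pinning model -/
def pinFactor (ε : ℝ) : Measure ℝ :=
  ENNReal.ofReal ε • Measure.dirac 0 + volume

/-- the single-site reference measure `ε δ_0(dx) + dx 1_{(x ≥ 0)}` of the wetting model -/
def wetFactor (ε : ℝ) : Measure ℝ :=
  ENNReal.ofReal ε • Measure.dirac 0 + volume.restrict (Ici 0)

/-- the pinning partition function `Z^p_{ε,N}` -/
def Zpin (E : ℝ → ℝ) (ε : ℝ) (N : ℕ) : ℝ :=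
  ∫ φ : Fin (N - 1) → ℝ, hamWeight E N φ ∂(Measure.pi fun _ => pinFactor ε)

/-- the wetting partition function `Z^w_{ε,N}` -/
def Zwet (E : ℝ → ℝ) (ε : ℝ) (N : ℕ) : ℝ :=
  ∫ φ : Fin (N - 1) → ℝ, hamWeight E N φ ∂(Measure.pi fun _ => wetFactor ε)

/-- Monotone, countably additive and homogeneous operators on nonnegative functions. -/
structure IsPosOp {α β : Type*} [MeasurableSpace α] [MeasurableSpace β]
    (A : (α → ℝ≥0∞) → β → ℝ≥0∞) : Prop where
  measurable : ∀ {f : α → ℝ≥0∞}, Measurable f → Measurable (A f)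
  mono : ∀ {f g : α → ℝ≥0∞}, f ≤ g → A f ≤ A g
  smul : ∀ (c : ℝ≥0∞) {f : α → ℝ≥0∞}, Measurable f → A (c • f) = c • A f
  tsum : ∀ {f : ℕ → α → ℝ≥0∞}, (∀ n, Measurable (f n)) →
    A (fun x => ∑' n, f n x) = fun y => ∑' n, A (f n) y

namespace IsPosOp

variable {α β γ : Type*} [MeasurableSpace α] [MeasurableSpace β] [MeasurableSpace γ]

theorem zero {A : (α → ℝ≥0∞) → β → ℝ≥0∞} (hA : IsPosOp A) : A 0 = 0 := by
  have := hA.smul 0 (f := 0) measurable_zero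
  simpa using this

theorem add {A : (α → ℝ≥0∞) → β → ℝ≥0∞} (hA : IsPosOp A) {f g : α → ℝ≥0∞}
    (hf : Measurable f) (hg : Measurable g) : A (f + g) = A f + A g := by
  have key : ∀ p q : ℕ → ℝ≥0∞, (∀ n, 2 ≤ n → q n = 0) → ∑' n, q n = q 0 + q 1 := by
    intro p q hq
    rw [tsum_eq_sum (s := Finset.range 2)]
    · simp [Finset.sum_range_succ]
    · intro b hb
      exact hq b (by simpa [Nat.lt_iff_add_one_le] using hb)
  let F : ℕ → α → ℝ≥0∞ := fun n => if n = 0 then f else if n = 1 then g else 0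
  have hF : ∀ n, Measurable (F n) := by
    intro n
    by_cases h0 : n = 0
    · simpa [F, h0] using hf
    · by_cases h1 : n = 1
      · simpa [F, h1] using hg
      · simpa [F, h0, h1] using measurable_zero
  have h := hA.tsum hF
  have h2 : (fun x => ∑' n, F n x) = f + g := by
    funext x
    rw [key (fun n => 0) (fun n => F n x) (fun n hn => by
      simp [F, show n ≠ 0 by omega, show n ≠ 1 by omega])]
    simp [F]
  rw [h2] at h
  rw [h]
  funext y
  rw [key (fun n => 0) (fun n => A (F n) y) (fun n hn => by
      simp [F, show n ≠ 0 by omega, show n ≠ 1 by omega, hA.zero])]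
  simp [F]

theorem comp {A : (α → ℝ≥0∞) → β → ℝ≥0∞} {B : (β → ℝ≥0∞) → γ → ℝ≥0∞}
    (hB : IsPosOp B) (hA : IsPosOp A) : IsPosOp (fun f => B (A f)) where
  measurable hf := hB.measurable (hA.measurable hf)
  mono h := hB.mono (hA.mono h)
  smul c f hf := by rw [hA.smul c hf, hB.smul c (hA.measurable hf)]
  tsum {f} hf := by
    rw [hA.tsum hf, hB.tsum (fun n => hA.measurable (hf n))]

theorem id : IsPosOp (fun f : α → ℝ≥0∞ => f) where
  measurable hf := hf
  mono h := h
  smul _ _ _ := rfl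
  tsum _ := rfl

theorem iterate {A : (α → ℝ≥0∞) → α → ℝ≥0∞} (hA : IsPosOp A) (n : ℕ) :
    IsPosOp (fun f => A^[n] f) := by
  induction n with
  | zero => exact IsPosOp.id
  | succ n ih =>
    simp only [Function.iterate_succ_apply']
    exact hA.comp ih

theorem mulComp {k : β → ℝ≥0∞} (hk : Measurable k) {g : β → α} (hg : Measurable g) :
    IsPosOp (fun (f : α → ℝ≥0∞) y => k y * f (g y)) where
  measurable hf := hk.mul (hf.comp hg)
  mono h y := mul_le_mul_right (h _) _
  smul c f hf := by
    funext y
    simp only [Pi.smul_apply, smul_eq_mul]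
    ring
  tsum hf := by
    funext y
    rw [ENNReal.tsum_mul_left]

theorem pullback {g : β → α} (hg : Measurable g) :
    IsPosOp (fun (f : α → ℝ≥0∞) y => f (g y)) := by
  simpa using mulComp (k := fun _ => 1) measurable_const hg

theorem lintegralMul {ν : Measure γ} [SFinite ν] {k : β × γ → ℝ≥0∞} (hk : Measurable k)
    {g : β × γ → α} (hg : Measurable g) :
    IsPosOp (fun (f : α → ℝ≥0∞) y => ∫⁻ c, k (y, c) * f (g (y, c)) ∂ν) where
  measurable hf := (hk.mul (hf.comp hg)).lintegral_prod_right'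
  mono h y := lintegral_mono fun c => mul_le_mul_right (h _) _
  smul c f hf := by
    funext y
    simp only [Pi.smul_apply, smul_eq_mul]
    rw [← lintegral_const_mul]
    · congr 1; funext z; ring
    · exact (hk.mul (hf.comp hg)).comp measurable_prodMk_left
  tsum {f} hf := by
    funext y
    rw [← lintegral_tsum]
    · simp only [ENNReal.tsum_mul_left]
    · intro n
      exact ((hk.mul ((hf n).comp hg)).comp measurable_prodMk_left).aemeasurable

theorem tsumOp {A : ℕ → (α → ℝ≥0∞) → β → ℝ≥0∞} (hA : ∀ n, IsPosOp (A n)) :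
    IsPosOp (fun f y => ∑' n, A n f y) where
  measurable hf := Measurable.tsum fun n => (hA n).measurable hf
  mono h y := ENNReal.tsum_le_tsum fun n => (hA n).mono h y
  smul c f hf := by
    funext y
    simp only [Pi.smul_apply, smul_eq_mul, (hA _).smul c hf, ENNReal.tsum_mul_left]
  tsum {f} hf := by
    funext y
    simp only [(hA _).tsum hf]
    rw [ENNReal.tsum_comm]

theorem constSMul {A : (α → ℝ≥0∞) → β → ℝ≥0∞} (hA : IsPosOp A) (c : ℝ≥0∞) :
    IsPosOp (fun f => c • A f) where
  measurable hf := (hA.measurable hf).const_smul c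
  mono h y := mul_le_mul_right (hA.mono h y) c
  smul d f hf := by rw [hA.smul d hf, smul_comm]
  tsum {f} hf := by
    funext y
    simp only [hA.tsum hf, Pi.smul_apply, smul_eq_mul, ENNReal.tsum_mul_left]

theorem addOp {A B : (α → ℝ≥0∞) → β → ℝ≥0∞} (hA : IsPosOp A) (hB : IsPosOp B) :
    IsPosOp (fun f => A f + B f) where
  measurable hf := (hA.measurable hf).add (hB.measurable hf)
  mono h y := add_le_add (hA.mono h y) (hB.mono h y)
  smul d f hf := by rw [hA.smul d hf, hB.smul d hf, smul_add]
  tsum {f} hf := by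
    funext y
    simp only [hA.tsum hf, hB.tsum hf, Pi.add_apply, ENNReal.tsum_add]

end IsPosOp

/-- The Neumann series `∑ₖ Aᵏ f`. -/
def neumann {α : Type*} (A : (α → ℝ≥0∞) → α → ℝ≥0∞) (f : α → ℝ≥0∞) : α → ℝ≥0∞ :=
  fun x => ∑' k, (A^[k] f) x

section neumann

variable {α : Type*} [MeasurableSpace α] {A : (α → ℝ≥0∞) → α → ℝ≥0∞}

theorem measurable_neumann (hA : IsPosOp A) {f : α → ℝ≥0∞} (hf : Measurable f) :
    Measurable (neumann A f) :=
  Measurable.tsum fun k => (hA.iterate k).measurable hf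

theorem neumann_eq (hA : IsPosOp A) {f : α → ℝ≥0∞} (hf : Measurable f) :
    neumann A f = f + A (neumann A f) := by
  unfold neumann
  rw [hA.tsum fun k => (hA.iterate k).measurable hf]
  funext x
  rw [tsum_eq_zero_add' ENNReal.summable]
  simp [Function.iterate_succ_apply']

theorem neumann_le_of_bound (hA : IsPosOp A) {f : α → ℝ≥0∞} (hf : Measurable f)
    (P : (α → ℝ≥0∞) → Prop) {h : α → ℝ≥0∞}
    (hP0 : P 0) (hPs : ∀ g, Measurable g → g ≤ neumann A f → P g → P (f + A g))
    (hPh : ∀ g, P g → g ≤ h) : neumann A f ≤ h := by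
  have hs : ∀ n : ℕ, let s := fun x => ∑ k ∈ Finset.range n, (A^[k] f) x
      Measurable s ∧ s ≤ neumann A f ∧ P s := by
    intro n
    have hm : ∀ n : ℕ, Measurable (fun x => ∑ k ∈ Finset.range n, (A^[k] f) x) := fun n =>
      Finset.measurable_sum _ fun k _ => (hA.iterate k).measurable hf
    have hl : ∀ n : ℕ, (fun x => ∑ k ∈ Finset.range n, (A^[k] f) x) ≤ neumann A f := fun n x =>
      ENNReal.sum_le_tsum _
    have hrec : ∀ n : ℕ, (fun x => ∑ k ∈ Finset.range (n + 1), (A^[k] f) x) =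
        f + A (fun x => ∑ k ∈ Finset.range n, (A^[k] f) x) := by
      intro n
      induction n with
      | zero =>
        have : (fun x : α => ∑ k ∈ Finset.range 0, (A^[k] f) x) = 0 := by funext x; simp
        rw [this, hA.zero]
        funext x; simp
      | succ n ih =>
        have h1 : (fun x => ∑ k ∈ Finset.range (n + 1), (A^[k] f) x) =
            (fun x => ∑ k ∈ Finset.range n, (A^[k] f) x) + A^[n] f := by
          funext x; simp [Finset.sum_range_succ]
        have h2 : (fun x => ∑ k ∈ Finset.range (n + 1 + 1), (A^[k] f) x) =
            (fun x => ∑ k ∈ Finset.range (n + 1), (A^[k] f) x) + A^[n + 1] f := by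
          funext x; simp [Finset.sum_range_succ]
        conv_rhs => rw [h1, hA.add (hm n) ((hA.iterate n).measurable hf), ← add_assoc]
        rw [h2, ih, Function.iterate_succ_apply']
    refine ⟨hm n, hl n, ?_⟩
    induction n with
    | zero =>
      simp only [Finset.range_zero, Finset.sum_empty]
      exact hP0
    | succ n ih =>
      rw [hrec n]
      exact hPs _ (hm n) (hl n) ih
  intro x
  exact ENNReal.tsum_le_of_sum_range_le fun n => hPh _ (hs n).2.2 x

theorem neumann_le (hA : IsPosOp A) {f h : α → ℝ≥0∞} (hf : Measurable f)
    (hh : f + A h ≤ h) : neumann A f ≤ h :=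
  neumann_le_of_bound hA hf (fun g => g ≤ h) (fun _ => zero_le)
    (fun _ _ _ hg => (add_le_add_right (hA.mono hg) f).trans hh) fun _ hg => hg

theorem neumann_smul (hA : IsPosOp A) {f : α → ℝ≥0∞} (hf : Measurable f) (c : ℝ≥0∞) :
    neumann A (c • f) = c • neumann A f := by
  funext x
  simp only [neumann, (hA.iterate _).smul c hf, Pi.smul_apply, smul_eq_mul, ENNReal.tsum_mul_left]

end neumann

/-- One step of the second-order chain with kernel `e`, run over sites weighted by `ν`. -/
def stepOp (e : ℝ → ℝ≥0∞) (ν : Measure ℝ) (f : ℝ × ℝ → ℝ≥0∞) : ℝ × ℝ → ℝ≥0∞ :=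
  fun p => ∫⁻ c, e (c + p.1 - 2 * p.2) * f (p.2, c) ∂ν

/-- The step of the chain to a pinned site. -/
def pinOp (e : ℝ → ℝ≥0∞) (h : ℝ → ℝ≥0∞) : ℝ × ℝ → ℝ≥0∞ :=
  fun p => e (p.1 - 2 * p.2) * h p.2

/-- Excursion with `m + 1` unpinned sites, as a function of its first unpinned height. -/
def exc (e : ℝ → ℝ≥0∞) (ν : Measure ℝ) (m : ℕ) (h : ℝ → ℝ≥0∞) : ℝ → ℝ≥0∞ :=
  fun z => (stepOp e ν)^[m] (pinOp e h) (0, z)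

/-- Transfer operator between consecutive pinned sites separated by `m + 1` unpinned ones. -/
def ret (e : ℝ → ℝ≥0∞) (ν : Measure ℝ) (m : ℕ) (h : ℝ → ℝ≥0∞) : ℝ → ℝ≥0∞ :=
  fun a => (stepOp e ν)^[m + 1] (pinOp e h) (a, 0)

/-- Generating function of the excursions. -/
def excSum (e : ℝ → ℝ≥0∞) (ν : Measure ℝ) (x : ℝ≥0∞) (h : ℝ → ℝ≥0∞) : ℝ → ℝ≥0∞ :=
  fun z => ∑' m, x ^ (m + 2) * exc e ν m h z

/-- Generating function of the transfer operators `ret`. -/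
def retSum (e : ℝ → ℝ≥0∞) (ν : Measure ℝ) (x : ℝ≥0∞) (h : ℝ → ℝ≥0∞) : ℝ → ℝ≥0∞ :=
  fun a => ∑' m, x ^ (m + 2) * ret e ν m h a

/-- Generating function of the pinned sites up to the first pair of adjacent pinned sites. -/
def contactFun (e : ℝ → ℝ≥0∞) (ν : Measure ℝ) (ε x : ℝ≥0∞) : ℝ → ℝ≥0∞ :=
  neumann (fun h => ε • retSum e ν x h) e

/-- Generating function of the renewal process of adjacent pinned pairs. -/
def genFun (e : ℝ → ℝ≥0∞) (ν : Measure ℝ) (ε x : ℝ≥0∞) : ℝ≥0∞ :=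
  ε * x * contactFun e ν ε x 0

/-- Coefficients of `contactFun` in the number of excursions and their total length. -/
def contactCoeff (e : ℝ → ℝ≥0∞) (ν : Measure ℝ) : ℕ → ℕ → ℝ → ℝ≥0∞
  | 0, n => if n = 0 then e else 0
  | k + 1, n => fun a =>
      ∑ p ∈ Finset.HasAntidiagonal.antidiagonal n, ret e ν p.1 (contactCoeff e ν k p.2) a

/-- The weight `e (a - 2 b) e b` of the last two steps towards the boundary condition. -/
def endWeight (e : ℝ → ℝ≥0∞) : ℝ × ℝ → ℝ≥0∞ := fun p => e (p.1 - 2 * p.2) * e p.2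

section operators

variable {e : ℝ → ℝ≥0∞} (he : Measurable e) (ν : Measure ℝ) [SFinite ν]
include he

theorem isPosOp_stepOp : IsPosOp (stepOp e ν) :=
  IsPosOp.lintegralMul (k := fun q : (ℝ × ℝ) × ℝ => e (q.2 + q.1.1 - 2 * q.1.2))
    (g := fun q : (ℝ × ℝ) × ℝ => (q.1.2, q.2)) (he.comp (by fun_prop)) (by fun_prop)

theorem isPosOp_pinOp : IsPosOp (pinOp e) :=
  IsPosOp.mulComp (k := fun q : ℝ × ℝ => e (q.1 - 2 * q.2)) (he.comp (by fun_prop)) measurable_snd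

theorem isPosOp_exc (m : ℕ) : IsPosOp (exc e ν m) :=
  (IsPosOp.pullback (g := fun z : ℝ => ((0 : ℝ), z)) (by fun_prop)).comp
    (((isPosOp_stepOp he ν).iterate m).comp (isPosOp_pinOp he))

theorem isPosOp_ret (m : ℕ) : IsPosOp (ret e ν m) :=
  (IsPosOp.pullback (g := fun z : ℝ => (z, (0 : ℝ))) (by fun_prop)).comp
    (((isPosOp_stepOp he ν).iterate (m + 1)).comp (isPosOp_pinOp he))

theorem isPosOp_excSum (x : ℝ≥0∞) : IsPosOp (excSum e ν x) :=
  IsPosOp.tsumOp fun m => (isPosOp_exc he ν m).constSMul (x ^ (m + 2))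

theorem isPosOp_retSum (x : ℝ≥0∞) : IsPosOp (retSum e ν x) :=
  IsPosOp.tsumOp fun m => (isPosOp_ret he ν m).constSMul (x ^ (m + 2))

theorem isPosOp_smul_retSum (ε x : ℝ≥0∞) : IsPosOp (fun h => ε • retSum e ν x h) :=
  (isPosOp_retSum he ν x).constSMul ε

theorem measurable_contactFun (ε x : ℝ≥0∞) : Measurable (contactFun e ν ε x) :=
  measurable_neumann (isPosOp_smul_retSum he ν ε x) he

theorem contactFun_eq (ε x : ℝ≥0∞) :
    contactFun e ν ε x = e + ε • retSum e ν x (contactFun e ν ε x) :=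
  neumann_eq (isPosOp_smul_retSum he ν ε x) he

omit he [SFinite ν] in
theorem ret_eq_lintegral (m : ℕ) (h : ℝ → ℝ≥0∞) (a : ℝ) :
    ret e ν m h a = ∫⁻ z, e (a + z) * exc e ν m h z ∂ν := by
  simp only [ret, exc, Function.iterate_succ_apply', stepOp]
  congr 1
  funext z
  rw [show z + a - 2 * 0 = a + z by ring]

theorem retSum_eq_lintegral (x : ℝ≥0∞) {h : ℝ → ℝ≥0∞} (hh : Measurable h) (a : ℝ) :
    retSum e ν x h a = ∫⁻ z, e (a + z) * excSum e ν x h z ∂ν := by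
  simp only [retSum, excSum, ret_eq_lintegral, ← ENNReal.tsum_mul_left]
  rw [lintegral_tsum]
  · congr 1
    funext m
    rw [← lintegral_const_mul]
    · congr 1
      funext z
      ring
    · exact (he.comp (by fun_prop)).mul ((isPosOp_exc he ν m).measurable hh)
  · intro m
    exact ((he.comp (by fun_prop)).mul
      (((isPosOp_exc he ν m).measurable hh).const_mul _)).aemeasurable

theorem measurable_contactCoeff (k n : ℕ) : Measurable (contactCoeff e ν k n) := by
  induction k generalizing n with
  | zero =>
    by_cases h : n = 0
    · simpa [contactCoeff, h] using he
    · simpa [contactCoeff, h] using measurable_zero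
  | succ k ih =>
    exact Finset.measurable_sum _ fun p _ => (isPosOp_ret he ν p.1).measurable (ih p.2)

theorem iterate_retSum (ε x : ℝ≥0∞) (k : ℕ) (a : ℝ) :
    (fun h => ε • retSum e ν x h)^[k] e a =
      ∑' n, ε ^ k * x ^ (2 * k + n) * contactCoeff e ν k n a := by
  induction k generalizing a with
  | zero =>
    rw [tsum_eq_single 0]
    · simp [contactCoeff]
    · intro n hn
      simp [contactCoeff, hn]
  | succ k ih =>
    rw [Function.iterate_succ_apply', funext ih]
    have hm := fun n => (measurable_contactCoeff he ν k n).const_smul (ε ^ k * x ^ (2 * k + n))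
    have h1 := (isPosOp_smul_retSum he ν ε x).tsum hm
    simp only [Pi.smul_apply, smul_eq_mul] at h1
    simp only [Pi.smul_apply, smul_eq_mul]
    refine (congrFun h1 a).trans ?_
    have h2 : ∀ n, ε * retSum e ν x ((ε ^ k * x ^ (2 * k + n)) • contactCoeff e ν k n) a =
        ∑' m, ε ^ (k + 1) * x ^ (2 * (k + 1) + (m + n)) * ret e ν m (contactCoeff e ν k n) a := by
      intro n
      rw [(isPosOp_retSum he ν x).smul _ (measurable_contactCoeff he ν k n)]
      simp only [Pi.smul_apply, smul_eq_mul, retSum, ← ENNReal.tsum_mul_left]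
      congr 1
      funext m
      ring
    simp only [h2]
    rw [ENNReal.tsum_comm, ← ENNReal.tsum_prod,
      ← (Finset.HasAntidiagonal.sigmaAntidiagonalEquivProd (A := ℕ)).tsum_eq, ENNReal.tsum_sigma']
    congr 1
    funext n
    rw [tsum_fintype]
    simp only [contactCoeff, Finset.mul_sum]
    rw [← Finset.sum_coe_sort (Finset.HasAntidiagonal.antidiagonal n) (fun p =>
      ε ^ (k + 1) * x ^ (2 * (k + 1) + n) * ret e ν p.1 (contactCoeff e ν k p.2) a)]
    refine Finset.sum_congr rfl fun p _ => ?_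
    have hp := Finset.HasAntidiagonal.mem_antidiagonal.1 p.2
    simp only [Finset.HasAntidiagonal.sigmaAntidiagonalEquivProd_apply]
    rw [hp]

theorem contactFun_eq_tsum (ε x : ℝ≥0∞) (a : ℝ) :
    contactFun e ν ε x a = ∑' k, ∑' n, ε ^ k * x ^ (2 * k + n) * contactCoeff e ν k n a := by
  simp only [contactFun, neumann, iterate_retSum he]

end operators

section renewal

variable {e : ℝ → ℝ≥0∞} (he : Measurable e) (ν : Measure ℝ) [SFinite ν] [NullSingletonClass ν]
include he

omit he [SFinite ν] [NullSingletonClass ν] in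
theorem stepOp_pinned (ε : ℝ≥0∞) {f : ℝ × ℝ → ℝ≥0∞} :
    stepOp e (ε • Measure.dirac 0 + ν) f = ε • pinOp e (fun a => f (a, 0)) + stepOp e ν f := by
  funext p
  simp only [stepOp, pinOp, lintegral_add_measure, lintegral_smul_measure, Pi.add_apply,
    Pi.smul_apply, smul_eq_mul, lintegral_dirac]
  simp

/-- The weight `ε 1_{b = 0} e a`. -/
def startWeight (e : ℝ → ℝ≥0∞) (ε : ℝ≥0∞) : ℝ × ℝ → ℝ≥0∞ :=
  fun p => ε * (e p.1 * ({0} : Set ℝ).indicator 1 p.2)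

omit [SFinite ν] [NullSingletonClass ν] in
theorem measurable_startWeight (ε : ℝ≥0∞) : Measurable (startWeight e ε) := by
  refine Measurable.const_mul ((he.comp measurable_fst).mul ?_) _
  exact (measurable_one.indicator (measurableSet_singleton 0)).comp measurable_snd

omit he [SFinite ν] in
theorem stepOp_startWeight (ε : ℝ≥0∞) : stepOp e ν (startWeight e ε) = 0 := by
  funext p
  simp only [stepOp, startWeight]
  have : ∀ᵐ c ∂ν, e (c + p.1 - 2 * p.2) *
      (ε * (e p.2 * ({0} : Set ℝ).indicator 1 c)) = 0 := by
    have h0 : ∀ᵐ c ∂ν, c ≠ 0 := by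
      rw [ae_iff]; simp
    filter_upwards [h0] with c hc
    simp [hc]
  rw [lintegral_congr_ae this]
  simp

theorem iterate_stepOp_startWeight (ε : ℝ≥0∞) (m : ℕ) :
    (stepOp e ν)^[m + 1] (startWeight e ε) = 0 := by
  rw [Function.iterate_succ_apply, stepOp_startWeight]
  exact ((isPosOp_stepOp he ν).iterate m).zero

theorem neumann_stepOp_apply (ε x : ℝ≥0∞) {h : ℝ → ℝ≥0∞} (hh : Measurable h) (a : ℝ) :
    neumann (fun f => x • stepOp e ν f) (startWeight e ε + (x * ε) • pinOp e h) (a, 0) =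
      ε * (1 + x * h 0) * e a + ε * retSum e ν x h a := by
  have hit : ∀ (m : ℕ) (f : ℝ × ℝ → ℝ≥0∞), Measurable f →
      (fun f => x • stepOp e ν f)^[m] f = x ^ m • (stepOp e ν)^[m] f := by
    intro m f hf
    induction m with
    | zero => simp
    | succ m ih =>
      rw [Function.iterate_succ_apply', ih, Function.iterate_succ_apply',
        (isPosOp_stepOp he ν).smul _ (((isPosOp_stepOp he ν).iterate m).measurable hf), smul_smul,
        pow_succ']
  have hJ := (isPosOp_pinOp he).measurable hh
  have hm := (measurable_startWeight he ε).add (hJ.const_smul (x * ε))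
  simp only [neumann]
  rw [tsum_eq_zero_add' ENNReal.summable]
  congr 1
  · simp [startWeight, pinOp]
    ring
  · rw [retSum, ← ENNReal.tsum_mul_left]
    congr 1
    funext m
    rw [hit _ _ hm, ((isPosOp_stepOp he ν).iterate (m + 1)).add (measurable_startWeight he ε)
      (hJ.const_smul (x * ε)), iterate_stepOp_startWeight he,
      ((isPosOp_stepOp he ν).iterate (m + 1)).smul _ hJ]
    simp only [Pi.smul_apply, smul_eq_mul, zero_add, ret]
    ring

omit he [SFinite ν] in
theorem stepOp_pinned_startWeight (ε : ℝ≥0∞) :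
    stepOp e (ε • Measure.dirac 0 + ν) (startWeight e ε) = (ε ^ 2) • endWeight e := by
  rw [stepOp_pinned, stepOp_startWeight]
  funext p
  simp [pinOp, startWeight, endWeight]
  ring

/-- The pinned chain started from `startWeight`. -/
theorem neumann_pinned_eq (ε x : ℝ≥0∞) :
    neumann (fun f => x • stepOp e (ε • Measure.dirac 0 + ν) f) (startWeight e ε) (0, 0) =
      ε * e 0 + ε ^ 2 * ∑' N, x ^ (N + 1) *
        (stepOp e (ε • Measure.dirac 0 + ν))^[N] (endWeight e) (0, 0) := by
  have hT := isPosOp_stepOp he (ε • Measure.dirac 0 + ν)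
  have hend : Measurable (endWeight e) := (isPosOp_pinOp he).measurable he
  have hit : ∀ m : ℕ, (fun f => x • stepOp e (ε • Measure.dirac 0 + ν) f)^[m + 1]
      (startWeight e ε) =
      (ε ^ 2 * x ^ (m + 1)) • (stepOp e (ε • Measure.dirac 0 + ν))^[m] (endWeight e) := by
    intro m
    induction m with
    | zero =>
      simp [stepOp_pinned_startWeight, smul_smul, mul_comm]
    | succ m ih =>
      rw [Function.iterate_succ_apply', ih, Function.iterate_succ_apply',
        hT.smul _ ((hT.iterate m).measurable hend), smul_smul]
      congr 1
      ring
  simp only [neumann]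
  rw [tsum_eq_zero_add' ENNReal.summable, ← ENNReal.tsum_mul_left]
  congr 1
  · simp [startWeight]
  · congr 1
    funext m
    rw [hit]
    simp [mul_assoc]

theorem genFun_lt_one_of_tsum {ε x : ℝ≥0∞} (hε : ε ≠ ∞) (hx : x ≠ ∞) (he0 : e 0 ≠ ∞)
    (h : ∑' N, x ^ (N + 1) *
      (stepOp e (ε • Measure.dirac 0 + ν))^[N] (endWeight e) (0, 0) ≠ ∞) :
    genFun e ν ε x < 1 := by
  have hT := (isPosOp_stepOp he (ε • Measure.dirac 0 + ν)).constSMul x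
  have h1 := isPosOp_stepOp he ν
  set w := neumann (fun f => x • stepOp e (ε • Measure.dirac 0 + ν) f) (startWeight e ε) with hw
  have hwm : Measurable w := measurable_neumann hT (measurable_startWeight he ε)
  have hw0 : w (0, 0) ≠ ∞ := by
    rw [hw, neumann_pinned_eq he]
    exact ENNReal.add_ne_top.2 ⟨ENNReal.mul_ne_top hε he0,
      ENNReal.mul_ne_top (ENNReal.pow_ne_top hε) h⟩
  set k : ℝ → ℝ≥0∞ := fun a => w (a, 0) with hk
  have hkm : Measurable k := hwm.comp (by fun_prop)
  have hwe : w = startWeight e ε + (x * ε) • pinOp e k + x • stepOp e ν w := by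
    conv_lhs => rw [hw, neumann_eq hT (measurable_startWeight he ε), ← hw]
    rw [stepOp_pinned, smul_add, smul_smul, add_assoc]
  have hle : neumann (fun f => x • stepOp e ν f) (startWeight e ε + (x * ε) • pinOp e k) ≤ w :=
    neumann_le (h1.constSMul x) ((measurable_startWeight he ε).add
      (((isPosOp_pinOp he).measurable hkm).const_smul _)) hwe.ge
  have hk2 : neumann (fun h => ε • retSum e ν x h) ((ε * (1 + x * k 0)) • e) ≤ k := by
    refine neumann_le (isPosOp_smul_retSum he ν ε x) (he.const_smul _) fun a => ?_
    have := hle (a, 0)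
    rw [neumann_stepOp_apply he ν ε x hkm] at this
    simpa using this
  have hk3 := hk2 0
  rw [neumann_smul (isPosOp_smul_retSum he ν ε x) he] at hk3
  have hk4 : x * k 0 ≥ (1 + x * k 0) * genFun e ν ε x := by
    calc (1 + x * k 0) * genFun e ν ε x
        = x * ((ε * (1 + x * k 0)) * contactFun e ν ε x 0) := by
          rw [genFun]; ring
      _ ≤ x * k 0 := by gcongr; exact hk3
  by_contra hG
  have hlt : x * k 0 < 1 + x * k 0 := by
    rw [add_comm]
    exact ENNReal.lt_add_right (ENNReal.mul_ne_top hx hw0) one_ne_zero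
  refine absurd (hlt.trans_le ?_) (lt_irrefl (x * k 0))
  calc 1 + x * k 0 = (1 + x * k 0) * 1 := (mul_one _).symm
    _ ≤ (1 + x * k 0) * genFun e ν ε x := by gcongr; exact not_lt.1 hG
    _ ≤ _ := hk4

theorem tsum_ne_top_of_genFun_lt_one {ε x : ℝ≥0∞} (hε : ε ≠ 0) (hε' : ε ≠ ∞)
    (hx : x ≠ 0) (h : genFun e ν ε x < 1) :
    ∑' N, x ^ (N + 1) *
      (stepOp e (ε • Measure.dirac 0 + ν))^[N] (endWeight e) (0, 0) ≠ ∞ := by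
  have hT := (isPosOp_stepOp he (ε • Measure.dirac 0 + ν)).constSMul x
  have h1 := (isPosOp_stepOp he ν).constSMul x
  set G := genFun e ν ε x with hG
  set u := contactFun e ν ε x with hu
  have hum : Measurable u := measurable_contactFun he ν ε x
  have h1G : 1 - G ≠ 0 := (tsub_pos_of_lt h).ne'
  have h1G' : 1 - G ≠ ∞ := ENNReal.sub_ne_top ENNReal.one_ne_top
  set s := ε * (1 - G)⁻¹ with hs
  have hs' : s ≠ ∞ := ENNReal.mul_ne_top hε' (ENNReal.inv_ne_top.2 h1G)
  have hu0 : u 0 ≠ ∞ := by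
    intro hh
    rw [hG, genFun, ← hu, hh, ENNReal.mul_top (mul_ne_zero hε hx)] at h
    simp at h
  set k : ℝ → ℝ≥0∞ := s • u with hk
  have hkm : Measurable k := hum.const_smul s
  have hxk : 1 + x * k 0 = (1 - G)⁻¹ := by
    have e1 : x * k 0 = G * (1 - G)⁻¹ := by
      simp only [hk, hs, hG, genFun, ← hu, Pi.smul_apply, smul_eq_mul]; ring
    rw [e1]
    nth_rewrite 1 [← ENNReal.mul_inv_cancel h1G h1G']
    rw [← add_mul, tsub_add_cancel_of_le h.le, one_mul]
  set W := neumann (fun f => x • stepOp e ν f) (startWeight e ε + (x * ε) • pinOp e k) with hW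
  have hfm := (measurable_startWeight he ε).add
      (((isPosOp_pinOp he).measurable hkm).const_smul (x * ε))
  have hW0 : ∀ a, W (a, 0) = k a := by
    intro a
    rw [hW, neumann_stepOp_apply he ν ε x hkm, hxk, hk, (isPosOp_retSum he ν x).smul s hum]
    have := congrFun (contactFun_eq he ν ε x) a
    simp only [← hu, Pi.add_apply, Pi.smul_apply, smul_eq_mul] at this ⊢
    rw [← hs, mul_left_comm, ← mul_add, ← this]
  have hWe : W = startWeight e ε + x • stepOp e (ε • Measure.dirac 0 + ν) W := by
    conv_lhs => rw [hW, neumann_eq h1 hfm, ← hW]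
    rw [stepOp_pinned, smul_add, smul_smul, add_assoc]
    simp only [hW0]
  have hle := neumann_le hT (measurable_startWeight he ε) hWe.ge (0, 0)
  rw [neumann_pinned_eq he, hW0] at hle
  have hk0 : k 0 ≠ ∞ := ENNReal.mul_ne_top hs' hu0
  intro htop
  rw [htop, ENNReal.mul_top (pow_ne_zero 2 hε)] at hle
  simp only [add_top, top_le_iff] at hle
  exact hk0 hle

end renewal

/-- The heights `a, b, φ₀, φ₁, …` continued by zero. -/
def pathSeq {k : ℕ} (a b : ℝ) (φ : Fin k → ℝ) : ℕ → ℝ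
  | 0 => a
  | 1 => b
  | i + 2 => if h : i < k then φ ⟨i, h⟩ else 0

/-- Weight of a path started from the heights `a, b` and ended by two zeros. -/
def pathWeight (e : ℝ → ℝ≥0∞) {k : ℕ} (a b : ℝ) (φ : Fin k → ℝ) : ℝ≥0∞ :=
  ∏ n ∈ Finset.range (k + 2),
    e (pathSeq a b φ (n + 2) + pathSeq a b φ n - 2 * pathSeq a b φ (n + 1))

theorem pathSeq_succ {k : ℕ} (a b : ℝ) (φ : Fin (k + 1) → ℝ) (n : ℕ) :
    pathSeq a b φ (n + 1) = pathSeq b (φ 0) (fun i => φ i.succ) n := by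
  match n with
  | 0 => rfl
  | 1 => simp [pathSeq]
  | i + 2 =>
    simp only [pathSeq, Nat.add_lt_add_iff_right]
    rfl

theorem pathWeight_succ (e : ℝ → ℝ≥0∞) {k : ℕ} (a b : ℝ) (φ : Fin (k + 1) → ℝ) :
    pathWeight e a b φ =
      e (φ 0 + a - 2 * b) * pathWeight e b (φ 0) (fun i => φ i.succ) := by
  rw [pathWeight, Finset.prod_range_succ', mul_comm]
  congr 1
  refine Finset.prod_congr rfl fun n _ => ?_
  rw [pathSeq_succ, pathSeq_succ, pathSeq_succ]

theorem measurable_pathWeight {e : ℝ → ℝ≥0∞} (he : Measurable e) {k : ℕ} :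
    Measurable fun q : (ℝ × ℝ) × (Fin k → ℝ) => pathWeight e q.1.1 q.1.2 q.2 := by
  have hs : ∀ n, Measurable fun q : (ℝ × ℝ) × (Fin k → ℝ) => pathSeq q.1.1 q.1.2 q.2 n := by
    intro n
    match n with
    | 0 => exact measurable_fst.fst
    | 1 => exact measurable_fst.snd
    | i + 2 =>
      by_cases h : i < k
      · simp only [pathSeq, h, dif_pos]
        exact (measurable_pi_apply _).comp measurable_snd
      · simp only [pathSeq, h, dif_neg, not_false_eq_true]
        exact measurable_const
  exact Finset.measurable_prod _ fun n _ =>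
    he.comp (((hs _).add (hs _)).sub ((hs _).const_mul 2))

theorem lintegral_pathWeight {e : ℝ → ℝ≥0∞} (he : Measurable e) (μ : Measure ℝ) [SigmaFinite μ]
    (k : ℕ) (a b : ℝ) :
    ∫⁻ φ : Fin k → ℝ, pathWeight e a b φ ∂(Measure.pi fun _ => μ) =
      (stepOp e μ)^[k] (endWeight e) (a, b) := by
  induction k generalizing a b with
  | zero =>
    have : ∀ φ : Fin 0 → ℝ, pathWeight e a b φ = endWeight e (a, b) := by
      intro φ
      simp [pathWeight, pathSeq, endWeight, Finset.prod_range_succ]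
    simp [this]
  | succ k ih =>
    have hmp := measurePreserving_piFinSuccAbove (fun _ : Fin (k + 1) => μ) 0
    rw [Function.iterate_succ_apply']
    have h1 : ∀ φ : Fin (k + 1) → ℝ, pathWeight e a b φ =
        (fun q : ℝ × (Fin k → ℝ) => e (q.1 + a - 2 * b) * pathWeight e b q.1 q.2)
          (MeasurableEquiv.piFinSuccAbove (fun _ => ℝ) 0 φ) := by
      intro φ
      rw [pathWeight_succ]
      rfl
    simp only [h1]
    have hw : Measurable fun q : ℝ × (Fin k → ℝ) => pathWeight e b q.1 q.2 :=
      (measurable_pathWeight he).comp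
        (f := fun q : ℝ × (Fin k → ℝ) => ((b, q.1), q.2)) (by fun_prop)
    have hm : Measurable fun q : ℝ × (Fin k → ℝ) =>
        e (q.1 + a - 2 * b) * pathWeight e b q.1 q.2 := (he.comp (by fun_prop)).mul hw
    rw [hmp.lintegral_comp hm, lintegral_prod _ hm.aemeasurable]
    simp only [stepOp]
    congr 1
    funext c
    rw [lintegral_const_mul, ih]
    exact hw.comp measurable_prodMk_left

theorem ofReal_hamWeight {E : ℝ → ℝ} (hE : ∀ x, 0 ≤ E x) (k : ℕ) (φ : Fin k → ℝ) :
    ENNReal.ofReal (hamWeight E (k + 1) φ) =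
      pathWeight (fun y => ENNReal.ofReal (E y)) 0 0 φ := by
  have hs : ∀ n : ℕ, fieldExt (k + 1) φ ((n : ℤ) - 1) = pathSeq 0 0 φ n := by
    intro n
    match n with
    | 0 => simp [fieldExt, pathSeq]
    | 1 => simp [fieldExt, pathSeq]
    | i + 2 =>
      simp only [fieldExt, pathSeq]
      by_cases h : i < k
      · rw [dif_pos h, dif_pos (by push_cast; omega)]
        congr 1
        simp
        omega
      · rw [dif_neg h, dif_neg (by push_cast; omega)]
  rw [hamWeight, ENNReal.ofReal_prod_of_nonneg fun _ _ => hE _, pathWeight]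
  symm
  refine Finset.prod_bij (fun (n : ℕ) _ => (n : ℤ)) ?_ ?_ ?_ ?_
  · intro n hn
    simp only [Finset.mem_range, Finset.mem_Icc] at hn ⊢
    push_cast
    omega
  · intro a _ b _ h
    exact_mod_cast h
  · intro n hn
    simp only [Finset.mem_Icc] at hn
    push_cast at hn
    refine ⟨n.toNat, ?_, ?_⟩
    · simp only [Finset.mem_range]; omega
    · omega
  · intro n _
    rw [← hs, ← hs, ← hs]
    push_cast
    congr 3 <;> ring_nf

theorem measurable_fieldExt (N : ℕ) (i : ℤ) : Measurable fun φ => fieldExt N φ i := by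
  unfold fieldExt
  split_ifs
  · exact measurable_pi_apply _
  · exact measurable_const

theorem integral_hamWeight {E : ℝ → ℝ} (hE : ∀ x, 0 ≤ E x) (hEm : Measurable E)
    (μ : Measure ℝ) [SigmaFinite μ] (k : ℕ) :
    ∫ φ : Fin (k + 1 - 1) → ℝ, hamWeight E (k + 1) φ ∂(Measure.pi fun _ => μ) =
      ((stepOp (fun y => ENNReal.ofReal (E y)) μ)^[k]
        (endWeight fun y => ENNReal.ofReal (E y)) (0, 0)).toReal := by
  rw [integral_eq_lintegral_of_nonneg_ae]
  · congr 1
    rw [← lintegral_pathWeight hEm.ennreal_ofReal]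
    exact lintegral_congr fun φ => ofReal_hamWeight hE k φ
  · exact ae_of_all _ fun φ => Finset.prod_nonneg fun _ _ => hE _
  · refine Measurable.aestronglyMeasurable (Finset.measurable_prod _ fun n _ => hEm.comp ?_)
    exact ((measurable_fieldExt _ _).add (measurable_fieldExt _ _)).sub
      ((measurable_fieldExt _ _).const_mul 2)

theorem stepOp_one_le {e : ℝ → ℝ≥0∞} {ν : Measure ℝ} (he1 : ∫⁻ y, e y = 1)
    (hν : ν ≤ volume) (a b : ℝ) : ∫⁻ c, e (c + a - 2 * b) ∂ν ≤ 1 := by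
  calc ∫⁻ c, e (c + a - 2 * b) ∂ν ≤ ∫⁻ c, e (c + a - 2 * b) := lintegral_mono' hν le_rfl
    _ = ∫⁻ c, e (c + (a - 2 * b)) := by simp only [add_sub_assoc]
    _ = 1 := by rw [lintegral_add_right_eq_self (fun c => e c), he1]

theorem iterate_stepOp_le {e : ℝ → ℝ≥0∞} {μ : Measure ℝ} {K L : ℝ≥0∞} [SFinite μ]
    (he : Measurable e) (h : ∀ a b : ℝ, ∫⁻ c, e (c + a - 2 * b) ∂μ ≤ L)
    {f : ℝ × ℝ → ℝ≥0∞} (hf : ∀ p, f p ≤ K) (n : ℕ) (p : ℝ × ℝ) :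
    (stepOp e μ)^[n] f p ≤ K * L ^ n := by
  induction n generalizing p with
  | zero => simpa using hf p
  | succ n ih =>
    rw [Function.iterate_succ_apply']
    calc stepOp e μ ((stepOp e μ)^[n] f) p
        ≤ ∫⁻ c, e (c + p.1 - 2 * p.2) * (K * L ^ n) ∂μ := by
          exact lintegral_mono fun c => mul_le_mul_right (ih _) _
      _ = (∫⁻ c, e (c + p.1 - 2 * p.2) ∂μ) * (K * L ^ n) :=
          lintegral_mul_const _ (he.comp (by fun_prop))
      _ ≤ L * (K * L ^ n) := by gcongr; exact h _ _
      _ = _ := by ring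

/-- Growth bound on a sequence turned into a bound on its exponential rate. -/
theorem rate_le_log {Z : ℕ → ℝ} {F : EReal}
    (hF : Tendsto (fun N : ℕ => (((N : ℝ)⁻¹ * Real.log (Z N) : ℝ) : EReal)) atTop (𝓝 F))
    (hZ : ∀ N, 0 ≤ Z (N + 1)) {K r : ℝ} (hK : 1 ≤ K) (hr : 1 ≤ r)
    (h : ∀ N : ℕ, Z (N + 1) ≤ K * r ^ (N + 1)) : F ≤ (Real.log r : ℝ) := by
  have hlim : Tendsto (fun N : ℕ => (((N : ℝ)⁻¹ * Real.log K + Real.log r : ℝ) : EReal)) atTop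
      (𝓝 ((Real.log r : ℝ) : EReal)) := by
    refine (continuous_coe_real_ereal.tendsto _).comp ?_
    have := (tendsto_inv_atTop_nhds_zero_nat (𝕜 := ℝ)).mul_const (Real.log K)
    simpa using this.add_const (Real.log r)
  refine le_of_tendsto_of_tendsto hF hlim ?_
  filter_upwards [eventually_ge_atTop 1] with N hN
  obtain ⟨n, rfl⟩ : ∃ n, N = n + 1 := ⟨N - 1, by omega⟩
  rw [EReal.coe_le_coe_iff]
  have hN0 : (0 : ℝ) < ((n + 1 : ℕ) : ℝ) := by positivity
  have hlK := Real.log_nonneg hK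
  have hlr := Real.log_nonneg hr
  rcases (hZ n).eq_or_lt with h0 | h0
  · rw [← h0, Real.log_zero, mul_zero]
    positivity
  · have h1 : Real.log (Z (n + 1)) ≤ Real.log K + (n + 1 : ℕ) * Real.log r := by
      refine (Real.log_le_log h0 (h n)).trans ?_
      rw [Real.log_mul (by positivity) (by positivity), Real.log_pow]
    calc ((n + 1 : ℕ) : ℝ)⁻¹ * Real.log (Z (n + 1))
        ≤ ((n + 1 : ℕ) : ℝ)⁻¹ * (Real.log K + (n + 1 : ℕ) * Real.log r) := by gcongr
      _ = _ := by field_simp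

section freeEnergy

variable {E : ℝ → ℝ} {M : ℝ} (hE0 : ∀ x, 0 ≤ E x) (hEm : Measurable E) (hEM : ∀ x, E x ≤ M)
  (hE1 : ∫⁻ y, ENNReal.ofReal (E y) = 1) {ν : Measure ℝ} [SigmaFinite ν] (hν : ν ≤ volume)
  {Z : ℕ → ℝ} {ε : ℝ}
  (hZ : ∀ N, Z N = ∫ φ : Fin (N - 1) → ℝ, hamWeight E N φ
    ∂(Measure.pi fun _ => ENNReal.ofReal ε • Measure.dirac 0 + ν))

include hE0 hEm hZ in
theorem partition_eq (k : ℕ) : Z (k + 1) =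
    ((stepOp (fun y => ENNReal.ofReal (E y)) (ENNReal.ofReal ε • Measure.dirac 0 + ν))^[k]
        (endWeight fun y => ENNReal.ofReal (E y)) (0, 0)).toReal := by
  have := Measure.smul_finite (Measure.dirac (0 : ℝ)) (ENNReal.ofReal_ne_top (r := ε))
  rw [hZ, integral_hamWeight hE0 hEm]

include hE0 hEm hEM hE1 hν in
theorem partition_le (hε : 0 ≤ ε) (k : ℕ) :
    (stepOp (fun y => ENNReal.ofReal (E y)) (ENNReal.ofReal ε • Measure.dirac 0 + ν))^[k]
        (endWeight fun y => ENNReal.ofReal (E y)) (0, 0) ≤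
      ENNReal.ofReal (M ^ 2 * (1 + ε * M) ^ k) := by
  have hM : 0 ≤ M := (hE0 0).trans (hEM 0)
  have h1 : ∀ a b : ℝ, ∫⁻ c, ENNReal.ofReal (E (c + a - 2 * b))
      ∂(ENNReal.ofReal ε • Measure.dirac 0 + ν) ≤ ENNReal.ofReal (1 + ε * M) := by
    intro a b
    rw [lintegral_add_measure, lintegral_smul_measure, lintegral_dirac, add_comm,
      ENNReal.ofReal_add zero_le_one (by positivity), ENNReal.ofReal_one,
      ENNReal.ofReal_mul hε, smul_eq_mul]
    gcongr
    · exact stepOp_one_le (e := fun y => ENNReal.ofReal (E y)) hE1 hν a b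
    · exact hEM _
  rw [ENNReal.ofReal_mul (by positivity), ENNReal.ofReal_pow (p := 1 + ε * M) (by positivity)]
  refine iterate_stepOp_le hEm.ennreal_ofReal h1 (fun p => ?_) k (0, 0)
  rw [endWeight, pow_two, ENNReal.ofReal_mul hM]
  gcongr <;> exact hEM _

include hE0 hEm hEM hE1 hν hZ in
theorem rate_le_log_one_add {F : EReal} (hε : 0 ≤ ε)
    (hF : Tendsto (fun N : ℕ => (((N : ℝ)⁻¹ * Real.log (Z N) : ℝ) : EReal)) atTop (𝓝 F)) :
    F ≤ (Real.log (1 + ε * M) : ℝ) := by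
  have hM : 0 ≤ M := (hE0 0).trans (hEM 0)
  have hεM : 0 ≤ ε * M := by positivity
  refine rate_le_log hF (fun N => ?_) (le_max_left 1 (M ^ 2)) (by linarith) fun N => ?_
  · rw [partition_eq hE0 hEm hZ]; exact ENNReal.toReal_nonneg
  · rw [partition_eq hE0 hEm hZ]
    refine (ENNReal.toReal_le_of_le_ofReal (by positivity)
      (partition_le hE0 hEm hEM hE1 hν hε N)).trans ?_
    gcongr
    · exact le_max_right _ _
    · linarith
    · omega

include hE0 hEm hZ in
theorem rate_le_of_genFun_lt_one [NullSingletonClass ν] {F : EReal} (hε : 0 < ε)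
    (hF : Tendsto (fun N : ℕ => (((N : ℝ)⁻¹ * Real.log (Z N) : ℝ) : EReal)) atTop (𝓝 F))
    {x : ℝ} (hx : 0 < x) (hx1 : x ≤ 1)
    (hG : genFun (fun y => ENNReal.ofReal (E y)) ν (ENNReal.ofReal ε) (ENNReal.ofReal x) < 1) :
    F ≤ (-Real.log x : ℝ) := by
  have hsum := tsum_ne_top_of_genFun_lt_one hEm.ennreal_ofReal ν (by simpa using hε)
    ENNReal.ofReal_ne_top (by simpa using hx) hG
  set B := ∑' N, ENNReal.ofReal x ^ (N + 1) *
    (stepOp (fun y => ENNReal.ofReal (E y)) (ENNReal.ofReal ε • Measure.dirac 0 + ν))^[N]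
      (endWeight fun y => ENNReal.ofReal (E y)) (0, 0)
  rw [← Real.log_inv]
  refine rate_le_log hF (fun N => ?_) (le_max_left 1 B.toReal)
    ((one_le_inv₀ hx).2 hx1) fun N => ?_
  · rw [partition_eq hE0 hEm hZ]; exact ENNReal.toReal_nonneg
  · rw [partition_eq hE0 hEm hZ]
    have h1 := ENNReal.toReal_mono hsum (ENNReal.le_tsum (f := fun N => ENNReal.ofReal x ^ (N + 1) *
      (stepOp (fun y => ENNReal.ofReal (E y)) (ENNReal.ofReal ε • Measure.dirac 0 + ν))^[N]
      (endWeight fun y => ENNReal.ofReal (E y)) (0, 0)) N)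
    rw [ENNReal.toReal_mul, ENNReal.toReal_pow, ENNReal.toReal_ofReal hx.le] at h1
    rw [inv_pow, ← div_eq_mul_inv, le_div_iff₀ (by positivity), mul_comm]
    exact h1.trans (le_max_right _ _)

include hE0 hEm hEM hE1 hν hZ in
theorem genFun_lt_one_of_lt [NullSingletonClass ν] {F : ℝ} (hε : 0 < ε)
    (hF : Tendsto (fun N : ℕ => (((N : ℝ)⁻¹ * Real.log (Z N) : ℝ) : EReal)) atTop (𝓝 (F : EReal)))
    {x : ℝ} (hx : 0 < x) (hxF : x < Real.exp (-F)) :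
    genFun (fun y => ENNReal.ofReal (E y)) ν (ENNReal.ofReal ε) (ENNReal.ofReal x) < 1 := by
  refine genFun_lt_one_of_tsum hEm.ennreal_ofReal ν ENNReal.ofReal_ne_top ENNReal.ofReal_ne_top
    ENNReal.ofReal_ne_top ?_
  set T := fun N => (stepOp (fun y => ENNReal.ofReal (E y))
    (ENNReal.ofReal ε • Measure.dirac 0 + ν))^[N] (endWeight fun y => ENNReal.ofReal (E y)) (0, 0)
    with hT
  have hZT : ∀ N, Z (N + 1) = (T N).toReal := partition_eq hE0 hEm hZ
  have hTtop : ∀ N, T N ≠ ∞ := fun N =>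
    ne_top_of_le_ne_top ENNReal.ofReal_ne_top (partition_le hE0 hEm hEM hE1 hν hε.le N)
  obtain ⟨y, hxy, hyF⟩ := exists_between hxF
  have hy : 0 < y := hx.trans hxy
  have hFy : F < -Real.log y := by
    have := (Real.log_lt_iff_lt_exp hy).2 hyF
    linarith
  have hF' : Tendsto (fun N : ℕ => (N : ℝ)⁻¹ * Real.log (Z N)) atTop (𝓝 F) :=
    EReal.tendsto_coe.1 hF
  have hev := (hF'.comp (tendsto_add_atTop_nat 1)).eventually (gt_mem_nhds hFy)
  have hbd : ∀ᶠ N : ℕ in atTop, x ^ (N + 1) * Z (N + 1) ≤ (x / y) ^ (N + 1) := by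
    filter_upwards [hev] with N hN
    have hN0 : (0 : ℝ) < ((N + 1 : ℕ) : ℝ) := by positivity
    simp only [Function.comp] at hN
    rw [div_pow, div_eq_mul_inv, ← inv_pow]
    gcongr
    have hZ0 : 0 ≤ Z (N + 1) := by rw [hZT]; exact ENNReal.toReal_nonneg
    rcases hZ0.eq_or_lt with h0 | h0
    · rw [← h0]; positivity
    · rw [← Real.log_le_log_iff h0 (by positivity), Real.log_pow, Real.log_inv]
      rw [inv_mul_lt_iff₀ hN0] at hN
      exact hN.le
  have hgeo : Summable fun N : ℕ => (x / y) ^ (N + 1) :=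
    (summable_nat_add_iff 1).2
      (summable_geometric_of_lt_one (by positivity) ((div_lt_one hy).2 hxy))
  have hsum : Summable fun N : ℕ => x ^ (N + 1) * Z (N + 1) := by
    refine Summable.of_norm_bounded_eventually_nat hgeo ?_
    filter_upwards [hbd] with N hN
    rwa [Real.norm_of_nonneg]
    rw [hZT]
    positivity
  have : ∀ N, ENNReal.ofReal x ^ (N + 1) * T N = ENNReal.ofReal (x ^ (N + 1) * Z (N + 1)) := by
    intro N
    rw [hZT, ENNReal.ofReal_mul (by positivity), ENNReal.ofReal_pow hx.le,
      ENNReal.ofReal_toReal (hTtop N)]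
  simp only [hT] at this
  simp only [this]
  exact hsum.tsum_ofReal_ne_top

end freeEnergy

theorem abs_sin_le_of_le_one {v : ℝ} (h0 : 0 ≤ v) (h1 : v ≤ 1) :
    |Real.sin v| ≤ v - v ^ 3 / 10 := by
  have h := Real.sin_bound (x := v) (by rwa [abs_of_nonneg h0])
  rw [abs_of_nonneg h0] at h
  have hs : 0 ≤ Real.sin v := Real.sin_nonneg_of_nonneg_of_le_pi h0 (by linarith [Real.pi_gt_three])
  rw [abs_of_nonneg hs]
  have h5 : v ^ 5 ≤ v ^ 3 := pow_le_pow_of_le_one h0 h1 (by norm_num)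
  have h3 : 0 ≤ v ^ 3 := by positivity
  have := (abs_le.1 h).2
  linarith

theorem abs_sin_le (v : ℝ) : |Real.sin v| ≤ |v| * (1 - min 1 (v ^ 2) / 40) := by
  wlog h0 : 0 ≤ v generalizing v
  · have := this (-v) (by linarith)
    simpa using this
  rw [abs_of_nonneg h0]
  rcases le_total v 1 with h1 | h1
  · refine (abs_sin_le_of_le_one h0 h1).trans ?_
    rw [min_eq_right (by nlinarith)]
    have : 0 ≤ v ^ 3 := by positivity
    nlinarith
  · rw [min_eq_left (by nlinarith)]
    rcases le_total v 2 with h2 | h2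
    · have h := abs_sin_le_of_le_one (v := v / 2) (by linarith) (by linarith)
      have hs : |Real.sin v| ≤ 2 * |Real.sin (v / 2)| := by
        have e1 : Real.sin v = 2 * Real.sin (v / 2) * Real.cos (v / 2) := by
          rw [← Real.sin_two_mul]; congr 1; ring
        rw [e1, abs_mul, abs_mul, abs_two]
        have := Real.abs_cos_le_one (v / 2)
        have h' := abs_nonneg (Real.sin (v / 2))
        nlinarith
      have hv : v ≤ v ^ 3 := by nlinarith [sq_nonneg v, sq_nonneg (v - 1)]
      nlinarith
    · have := Real.abs_sin_le_one v
      linarith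

theorem norm_integral_exp_le {s δ : ℝ} (hδ : 0 < δ) :
    ‖∫ y in (-δ)..δ, Complex.exp (s * y * Complex.I)‖ ≤ 2 * δ * (1 - min 1 ((s * δ) ^ 2) / 40) := by
  rcases eq_or_ne s 0 with rfl | hs
  · simp only [Complex.ofReal_zero, zero_mul, Complex.exp_zero, intervalIntegral.integral_const]
    rw [norm_smul, Real.norm_of_nonneg (by linarith)]
    norm_num
    linarith
  · have hc : (s : ℂ) * Complex.I ≠ 0 := mul_ne_zero (by exact_mod_cast hs) Complex.I_ne_zero
    have h1 : ∫ y in (-δ)..δ, Complex.exp (s * y * Complex.I) =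
        2 * (Real.sin (s * δ) : ℂ) / s := by
      have : ∀ y : ℝ, Complex.exp (s * y * Complex.I) = Complex.exp (s * Complex.I * y) := by
        intro y; congr 1; ring
      simp only [this]
      rw [integral_exp_mul_complex hc]
      rw [Complex.ofReal_sin, Complex.sin]
      push_cast
      have hs' : (s : ℂ) ≠ 0 := by exact_mod_cast hs
      field_simp
      simp only [Complex.I_sq]
      ring_nf
    rw [h1, norm_div, norm_mul, Complex.norm_real, Complex.norm_real, Real.norm_eq_abs,
      Real.norm_eq_abs, div_le_iff₀ (abs_pos.2 hs)]
    have h2 := abs_sin_le (s * δ)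
    rw [abs_mul s δ, abs_of_pos hδ] at h2
    simp only [Complex.norm_ofNat]
    linarith

/-- Decay of the characteristic function of a probability density that is bounded below near `0`. -/
theorem exists_norm_charFun_le {E : ℝ → ℝ} (hE0 : ∀ x, 0 ≤ E x) (hEc : Continuous E)
    (hEpos : 0 < E 0) (hEi : Integrable E) (hE1 : ∫ x, E x = 1) :
    ∃ κ : ℝ, 0 < κ ∧ ∀ s : ℝ,
      ‖charFun (volume.withDensity fun y => ENNReal.ofReal (E y)) s‖ ≤
        Real.exp (-κ * min 1 (s ^ 2)) := by
  obtain ⟨δ, hδ, hδE⟩ : ∃ δ > 0, ∀ y, |y| ≤ δ → E 0 / 2 ≤ E y := by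
    have := hEc.continuousAt.eventually (lt_mem_nhds (half_lt_self hEpos))
    obtain ⟨δ, hδ, h⟩ := Metric.eventually_nhds_iff.1 this
    refine ⟨δ / 2, by positivity, fun y hy => (h ?_).le⟩
    rw [Real.dist_eq, sub_zero]
    linarith
  set c := E 0 / 2 with hc
  have hcpos : 0 < c := by positivity
  refine ⟨2 * c * δ / 40 * min 1 (δ ^ 2), by positivity, fun s => ?_⟩
  have hphi : charFun (volume.withDensity fun y => ENNReal.ofReal (E y)) s =
      ∫ y, (E y : ℂ) * Complex.exp (s * y * Complex.I) := by
    rw [charFun_apply_real, integral_withDensity_eq_integral_toReal_smul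
      hEc.measurable.ennreal_ofReal (by simp)]
    simp only [ENNReal.toReal_ofReal (hE0 _), Complex.real_smul]
  set I : Set ℝ := Ioc (-δ) δ with hI
  have hvol : volume.real I = 2 * δ := by
    rw [hI, Real.volume_real_Ioc_of_le (by linarith)]; ring
  have hind : Integrable (I.indicator fun _ => c) :=
    (integrable_indicator_iff measurableSet_Ioc).2 (integrableOn_const (by simp))
  have hEind : ∀ y, I.indicator (fun _ => c) y ≤ E y := by
    intro y
    by_cases hy : y ∈ I
    · rw [indicator_of_mem hy]
      exact hδE y (abs_le.2 ⟨hy.1.le, hy.2⟩)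
    · rw [indicator_of_notMem hy]; exact hE0 y
  have hnorm : ∀ y : ℝ, ‖Complex.exp (s * y * Complex.I)‖ = 1 := by
    intro y
    have := Complex.norm_exp_ofReal_mul_I (s * y)
    simpa using this
  have hcexp : Continuous fun y : ℝ => Complex.exp (s * y * Complex.I) := by fun_prop
  have hbdd : ∀ f : ℝ → ℝ, Integrable f →
      Integrable fun y => (f y : ℂ) * Complex.exp (s * y * Complex.I) := by
    intro f hf
    exact hf.ofReal.mul_bdd (c := 1) hcexp.aestronglyMeasurable (ae_of_all _ fun y => (hnorm y).le)
  have hsplit : ∫ y, (E y : ℂ) * Complex.exp (s * y * Complex.I) =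
      (∫ y, ((E y - I.indicator (fun _ => c) y : ℝ) : ℂ) * Complex.exp (s * y * Complex.I)) +
      ∫ y, ((I.indicator (fun _ => c) y : ℝ) : ℂ) * Complex.exp (s * y * Complex.I) := by
    rw [← integral_add (hbdd (fun y => E y - I.indicator (fun _ => c) y) (hEi.sub hind))
      (hbdd _ hind)]
    congr 1
    funext y
    push_cast
    ring
  have h1 : ‖∫ y, ((E y - I.indicator (fun _ => c) y : ℝ) : ℂ) *
      Complex.exp (s * y * Complex.I)‖ ≤ 1 - 2 * c * δ := by
    refine (norm_integral_le_integral_norm _).trans (le_of_eq ?_)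
    have : ∀ y, ‖((E y - I.indicator (fun _ => c) y : ℝ) : ℂ) * Complex.exp (s * y * Complex.I)‖ =
        E y - I.indicator (fun _ => c) y := by
      intro y
      rw [norm_mul, hnorm, mul_one, Complex.norm_real, Real.norm_of_nonneg]
      linarith [hEind y]
    simp only [this]
    rw [integral_sub hEi hind, hE1, integral_indicator measurableSet_Ioc, setIntegral_const, hvol,
      smul_eq_mul]
    ring
  have h2 : ‖∫ y, ((I.indicator (fun _ => c) y : ℝ) : ℂ) * Complex.exp (s * y * Complex.I)‖ ≤
      c * (2 * δ * (1 - min 1 ((s * δ) ^ 2) / 40)) := by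
    have : ∀ y, ((I.indicator (fun _ => c) y : ℝ) : ℂ) * Complex.exp (s * y * Complex.I) =
        I.indicator (fun y : ℝ => (c : ℂ) * Complex.exp (s * y * Complex.I)) y := by
      intro y
      by_cases hy : y ∈ I <;> simp [hy]
    simp only [this]
    rw [integral_indicator measurableSet_Ioc, integral_const_mul, norm_mul, Complex.norm_real,
      Real.norm_of_nonneg hcpos.le, ← intervalIntegral.integral_of_le (by linarith)]
    gcongr
    exact norm_integral_exp_le hδ
  rw [hphi, hsplit]
  refine (norm_add_le _ _).trans ((add_le_add h1 h2).trans ?_)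
  have h3 : min 1 (δ ^ 2) * min 1 (s ^ 2) ≤ min 1 ((s * δ) ^ 2) := by
    refine le_min ?_ ?_
    · exact mul_le_one₀ (min_le_left _ _) (by positivity) (min_le_left _ _)
    · rw [mul_pow, mul_comm (s ^ 2)]
      exact mul_le_mul (min_le_right _ _) (min_le_right _ _) (by positivity) (by positivity)
  have h4 := Real.add_one_le_exp (-(2 * c * δ / 40 * min 1 (δ ^ 2)) * min 1 (s ^ 2))
  refine le_trans ?_ h4
  have : 2 * c * δ / 40 * (min 1 (δ ^ 2) * min 1 (s ^ 2)) ≤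
    2 * c * δ / 40 * min 1 ((s * δ) ^ 2) := by gcongr
  linarith

/-- Density of the linear combination `-∑_{j ≤ m + 1} j Δ_j` of independent variables with
density `e`. -/
def pathDensity (e : ℝ → ℝ≥0∞) : ℕ → ℝ → ℝ≥0∞
  | 0 => fun u => e (-u)
  | m + 1 => fun u => ∫⁻ y, e y * pathDensity e m (u + (m + 2) * y)

theorem measurable_pathDensity {e : ℝ → ℝ≥0∞} (he : Measurable e) (m : ℕ) :
    Measurable (pathDensity e m) := by
  induction m with
  | zero => exact he.comp measurable_neg
  | succ m ih =>
    exact Measurable.lintegral_prod_right'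
      (f := fun q : ℝ × ℝ => e q.2 * pathDensity e m (q.1 + (m + 2) * q.2))
      ((he.comp measurable_snd).mul (ih.comp (by fun_prop)))

/-- Iterates of the unconstrained chain in terms of `pathDensity`. -/
theorem iterate_stepOp_volume {e : ℝ → ℝ≥0∞} (he : Measurable e) (ρ : Measure ℝ) [SFinite ρ]
    (m : ℕ) (a b : ℝ) :
    (stepOp e volume)^[m] (fun p => ∫⁻ y, e (y + p.1 - 2 * p.2) ∂ρ) (a, b) =
      ∫⁻ y, pathDensity e m (b + (m + 1) * (b - a) - y) ∂ρ := by
  induction m generalizing a b with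
  | zero =>
    simp only [Function.iterate_zero, id, pathDensity]
    congr 1
    funext y
    congr 1
    push_cast
    ring
  | succ m ih =>
    rw [Function.iterate_succ_apply']
    simp only [stepOp, pathDensity]
    simp only [ih]
    have hd := measurable_pathDensity he m
    rw [← lintegral_sub_right_eq_self _ (a - 2 * b)]
    rw [lintegral_lintegral_swap]
    · congr 1
      funext y
      rw [← lintegral_const_mul]
      · congr 1
        funext z
        have h1 : y - (a - 2 * b) + a - 2 * b = y := by ring
        rw [h1]
        congr 2
        push_cast
        ring
      · exact hd.comp (by fun_prop)
    · exact ((he.comp measurable_snd).mul (hd.comp (by fun_prop))).aemeasurable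

theorem stepOp_mono_measure {e : ℝ → ℝ≥0∞} {ν μ : Measure ℝ} (h : ν ≤ μ)
    {f g : ℝ × ℝ → ℝ≥0∞} (hfg : f ≤ g) (m : ℕ) :
    (stepOp e ν)^[m] f ≤ (stepOp e μ)^[m] g := by
  induction m with
  | zero => exact hfg
  | succ m ih =>
    rw [Function.iterate_succ_apply', Function.iterate_succ_apply']
    exact fun p => lintegral_mono' h fun c => mul_le_mul_right (ih _) _

theorem lintegral_comp_mul_add {f : ℝ → ℝ≥0∞} (hf : Measurable f) {a : ℝ} (ha : a ≠ 0) (b : ℝ) :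
    ENNReal.ofReal |a| * ∫⁻ x, f (a * x + b) = ∫⁻ x, f x := by
  rw [← lintegral_add_right_eq_self f b]
  have hm : Measurable fun x => f (x + b) := hf.comp (by fun_prop)
  conv_rhs => rw [← Real.smul_map_volume_mul_left ha]
  rw [lintegral_smul_measure, lintegral_map hm (by fun_prop), smul_eq_mul]

theorem withDensity_pathDensity_succ {e : ℝ → ℝ≥0∞} (he : Measurable e) (m : ℕ) :
    volume.withDensity (pathDensity e (m + 1)) =
      ((volume.withDensity (pathDensity e m)).prod (volume.withDensity e)).map
        (fun q : ℝ × ℝ => q.1 - ((m : ℝ) + 2) * q.2) := by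
  have hd := measurable_pathDensity he m
  refine Measure.ext_of_lintegral _ fun f hf => ?_
  rw [lintegral_withDensity_eq_lintegral_mul _ (measurable_pathDensity he (m + 1)) hf,
    lintegral_map hf (by fun_prop), lintegral_prod_symm
      (fun q : ℝ × ℝ => f (q.1 - ((m : ℝ) + 2) * q.2))
      (hf.comp (by fun_prop : Measurable fun q : ℝ × ℝ => q.1 - ((m : ℝ) + 2) * q.2)).aemeasurable,
    lintegral_withDensity_eq_lintegral_mul _ he]
  · simp only [Pi.mul_apply, pathDensity]
    calc ∫⁻ u, (∫⁻ y, e y * pathDensity e m (u + (m + 2) * y)) * f u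
        = ∫⁻ u, ∫⁻ y, e y * pathDensity e m (u + (m + 2) * y) * f u := by
          congr 1
          funext u
          rw [lintegral_mul_const]
          exact he.mul (hd.comp (by fun_prop))
      _ = ∫⁻ y, ∫⁻ u, e y * pathDensity e m (u + (m + 2) * y) * f u := by
          rw [lintegral_lintegral_swap]
          exact (((he.comp measurable_snd).mul (hd.comp (by fun_prop))).mul
            (hf.comp measurable_fst)).aemeasurable
      _ = _ := by
          congr 1
          funext y
          have hg : Measurable fun u => f (u - ((m : ℝ) + 2) * y) := hf.comp (by fun_prop)
          rw [lintegral_withDensity_eq_lintegral_mul _ hd hg,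
            ← lintegral_const_mul _ (hd.mul hg),
            ← lintegral_sub_right_eq_self _ ((m + 2) * y)]
          congr 1
          funext u
          simp only [Pi.mul_apply, sub_add_cancel, mul_assoc]
  · exact Measurable.lintegral_prod_left' (f := fun q : ℝ × ℝ => f (q.1 - (m + 2) * q.2))
      (hf.comp (by fun_prop))

theorem isProbabilityMeasure_withDensity {e : ℝ → ℝ≥0∞} (he1 : ∫⁻ y, e y = 1) :
    IsProbabilityMeasure (volume.withDensity e) :=
  ⟨by rw [withDensity_apply _ MeasurableSet.univ, setLIntegral_univ, he1]⟩

theorem isProbabilityMeasure_pathDensity {e : ℝ → ℝ≥0∞} (he : Measurable e)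
    (he1 : ∫⁻ y, e y = 1) (m : ℕ) :
    IsProbabilityMeasure (volume.withDensity (pathDensity e m)) := by
  have := isProbabilityMeasure_withDensity he1
  induction m with
  | zero =>
    refine isProbabilityMeasure_withDensity ?_
    simp only [pathDensity]
    rw [lintegral_neg_eq_self (μ := volume) e, he1]
  | succ m ih =>
    rw [withDensity_pathDensity_succ he]
    exact Measure.isProbabilityMeasure_map (by fun_prop)

theorem norm_charFun_pathDensity {e : ℝ → ℝ≥0∞} (he : Measurable e)
    (he1 : ∫⁻ y, e y = 1) (m : ℕ) (t : ℝ) :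
    ‖charFun (volume.withDensity (pathDensity e m)) t‖ =
      ∏ j ∈ Finset.range (m + 1), ‖charFun (volume.withDensity e) ((j + 1) * t)‖ := by
  have hneg : ∀ s : ℝ, ‖charFun (volume.withDensity e) (-s)‖ =
      ‖charFun (volume.withDensity e) s‖ := by
    intro s; rw [charFun_neg]; exact RCLike.norm_conj _
  have := isProbabilityMeasure_withDensity he1
  induction m with
  | zero =>
    simp only [zero_add, Finset.range_one, Finset.prod_singleton, Nat.cast_zero, one_mul]
    rw [← hneg]
    congr 1
    have hmap : volume.withDensity (pathDensity e 0) =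
        (volume.withDensity e).map (fun y => -y) := by
      refine Measure.ext_of_lintegral _ fun f hf => ?_
      rw [lintegral_withDensity_eq_lintegral_mul _ (measurable_pathDensity he 0) hf,
        lintegral_map hf measurable_neg,
        lintegral_withDensity_eq_lintegral_mul _ he (g := fun y => f (-y))
          (hf.comp measurable_neg),
        ← lintegral_neg_eq_self (μ := volume)]
      simp [pathDensity]
    rw [hmap, charFun_apply_real, charFun_apply_real, integral_map (by fun_prop)
      (by fun_prop)]
    congr 1
    funext y
    congr 1
    push_cast
    ring
  | succ m ih =>
    have := isProbabilityMeasure_pathDensity he he1 m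
    rw [Finset.prod_range_succ, ← ih, ← hneg, ← norm_mul]
    congr 1
    rw [withDensity_pathDensity_succ he, charFun_apply_real, integral_map (by fun_prop)
      (by fun_prop), charFun_apply_real, charFun_apply_real, ← integral_prod_mul]
    congr 1
    funext q
    rw [← Complex.exp_add]
    congr 1
    push_cast
    ring

/-- Smoothing by a Cauchy kernel is controlled by the characteristic function. -/
theorem integral_cauchy_le (D : Measure ℝ) [IsProbabilityMeasure D] {n : ℝ} (u : ℝ) :
    ∫ t, (1 + ((t - u) / n) ^ 2)⁻¹ ∂D ≤
      ∫ ξ in Ioi (0 : ℝ), Real.exp (-ξ) * ‖charFun D (ξ / n)‖ := by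
  have hk : ∀ v : ℝ, (((1 + v ^ 2)⁻¹ : ℝ)) =
      (∫ ξ in Ioi (0 : ℝ), Complex.exp ((-1 + v * Complex.I) * ξ)).re := by
    intro v
    rw [integral_exp_mul_complex_Ioi (by simp)]
    simp [Complex.div_re, Complex.normSq_apply]
    field_simp
  set f : ℝ → ℝ → ℂ := fun t ξ => Complex.exp ((-1 + ((t - u) / n : ℝ) * Complex.I) * ξ) with hf
  have hnorm : ∀ t ξ, ‖f t ξ‖ = Real.exp (-ξ) := by
    intro t ξ
    rw [hf, Complex.norm_exp]
    simp
  have hprod : Integrable (Function.uncurry f) (D.prod (volume.restrict (Ioi 0))) := by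
    have h1 : Integrable (fun q : ℝ × ℝ => (1 : ℝ) * Real.exp (-q.2))
        (D.prod (volume.restrict (Ioi 0))) :=
      (integrable_const (1 : ℝ)).mul_prod (integrableOn_exp_neg_Ioi 0)
    refine h1.mono' ?_ (ae_of_all _ fun q => ?_)
    · exact Continuous.aestronglyMeasurable (by simp only [hf, Function.uncurry_def]; fun_prop)
    · simp [Function.uncurry, hnorm]
  have hprod1 : Integrable (fun t => ∫ ξ in Ioi (0 : ℝ), f t ξ) D := hprod.integral_prod_left
  calc ∫ t, (1 + ((t - u) / n) ^ 2)⁻¹ ∂D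
      = ∫ t, (∫ ξ in Ioi (0 : ℝ), f t ξ).re ∂D := by simp only [hk, hf]
    _ = (∫ t, (∫ ξ in Ioi (0 : ℝ), f t ξ) ∂D).re := integral_re (𝕜 := ℂ) hprod1
    _ = (∫ ξ in Ioi (0 : ℝ), (∫ t, f t ξ ∂D)).re := by rw [integral_integral_swap hprod]
    _ ≤ ‖∫ ξ in Ioi (0 : ℝ), ∫ t, f t ξ ∂D‖ := Complex.re_le_norm _
    _ ≤ ∫ ξ in Ioi (0 : ℝ), ‖∫ t, f t ξ ∂D‖ := norm_integral_le_integral_norm _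
    _ = _ := by
      congr 1
      funext ξ
      have : ∀ t : ℝ, f t ξ = Complex.exp (((-ξ : ℝ) : ℂ) + ((-(u * ξ / n) : ℝ) : ℂ) * Complex.I) *
          Complex.exp ((ξ / n : ℝ) * t * Complex.I) := by
        intro t
        simp only [hf]
        rw [← Complex.exp_add]
        congr 1
        push_cast
        ring
      simp only [this]
      rw [integral_const_mul, ← charFun_apply_real, norm_mul, Complex.norm_exp]
      simp

theorem lintegral_mul_shift_le {e : ℝ → ℝ≥0∞} (he : Measurable e) {M : ℝ≥0∞}
    (heM : ∀ y, e y ≤ M) (he1 : ∫⁻ y, e y = 1) {r : ℝ} (hr1 : 1 ≤ r) (hr2 : r ≤ 2) (v : ℝ) :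
    ∫⁻ y, e y * e (v - r * y) ≤
      M * (1 + 10 * ∫⁻ y, ENNReal.ofReal (y ^ 2) * e y) * ENNReal.ofReal ((1 + v ^ 2)⁻¹) := by
  set S := ∫⁻ y, ENNReal.ofReal (y ^ 2) * e y with hS
  set g : ℝ → ℝ≥0∞ := fun y => ENNReal.ofReal (y ^ 2) * e y with hg
  have hgm : Measurable g := (ENNReal.measurable_ofReal.comp (by fun_prop)).mul he
  have hgr : ∫⁻ y, g (v - r * y) ≤ S := by
    have h := lintegral_comp_mul_add hgm (a := -r) (by linarith) v
    rw [abs_neg, abs_of_pos (by linarith)] at h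
    have h2 : ∀ y, -r * y + v = v - r * y := fun y => by ring
    simp only [h2] at h
    calc ∫⁻ y, g (v - r * y) = 1 * ∫⁻ y, g (v - r * y) := (one_mul _).symm
      _ ≤ ENNReal.ofReal r * ∫⁻ y, g (v - r * y) := by
          gcongr
          rw [← ENNReal.ofReal_one]
          exact ENNReal.ofReal_le_ofReal hr1
      _ = S := h
  have hpos : 0 < 1 + v ^ 2 := by positivity
  have key : ENNReal.ofReal (1 + v ^ 2) * ∫⁻ y, e y * e (v - r * y) ≤ M * (1 + 10 * S) := by
    have hem : Measurable fun y => e y * e (v - r * y) := he.mul (he.comp (by fun_prop))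
    rw [← lintegral_const_mul _ hem]
    calc ∫⁻ y, ENNReal.ofReal (1 + v ^ 2) * (e y * e (v - r * y))
        ≤ ∫⁻ y, (M * e y + M * (8 * g y) + M * (2 * g (v - r * y))) := by
          refine lintegral_mono fun y => ?_
          have h1 : ENNReal.ofReal (1 + v ^ 2) ≤ 1 + 8 * ENNReal.ofReal (y ^ 2) +
              2 * ENNReal.ofReal ((v - r * y) ^ 2) := by
            have : 1 + 8 * ENNReal.ofReal (y ^ 2) + 2 * ENNReal.ofReal ((v - r * y) ^ 2) =
                ENNReal.ofReal (1 + 8 * y ^ 2 + 2 * (v - r * y) ^ 2) := by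
              rw [ENNReal.ofReal_add (by positivity) (by positivity),
                ENNReal.ofReal_add (by positivity) (by positivity),
                ENNReal.ofReal_mul (by norm_num), ENNReal.ofReal_mul (by norm_num)]
              simp
            rw [this]
            refine ENNReal.ofReal_le_ofReal ?_
            have h3 : r ^ 2 * y ^ 2 ≤ 4 * y ^ 2 :=
              mul_le_mul_of_nonneg_right (by nlinarith) (sq_nonneg y)
            nlinarith [sq_nonneg (v - 2 * r * y)]
          calc ENNReal.ofReal (1 + v ^ 2) * (e y * e (v - r * y))
              ≤ (1 + 8 * ENNReal.ofReal (y ^ 2) + 2 * ENNReal.ofReal ((v - r * y) ^ 2)) *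
                (e y * e (v - r * y)) := by gcongr
            _ = e (v - r * y) * e y + e (v - r * y) * (8 * g y) + e y * (2 * g (v - r * y)) := by
                simp only [hg]; ring
            _ ≤ _ := by gcongr <;> exact heM _
      _ = M + M * (8 * S) + M * (2 * ∫⁻ y, g (v - r * y)) := by
          have hgm' : Measurable fun y => g (v - r * y) := hgm.comp (by fun_prop)
          rw [lintegral_add_right _ (by fun_prop), lintegral_add_right _ (by fun_prop),
            lintegral_const_mul _ he, lintegral_const_mul _ (by fun_prop),
            lintegral_const_mul _ hgm, lintegral_const_mul _ (by fun_prop),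
            lintegral_const_mul _ hgm', he1, mul_one]
      _ ≤ M + M * (8 * S) + M * (2 * S) := by gcongr
      _ = _ := by ring
  rw [ENNReal.ofReal_inv_of_pos hpos, ← div_eq_mul_inv, ENNReal.le_div_iff_mul_le
    (Or.inl (by simpa using hpos)) (Or.inl ENNReal.ofReal_ne_top), mul_comm]
  exact key

theorem pathDensity_add_two_le {e : ℝ → ℝ≥0∞} (he : Measurable e) {M : ℝ≥0∞}
    (heM : ∀ y, e y ≤ M) (he1 : ∫⁻ y, e y = 1) (m : ℕ) (u : ℝ) :
    ENNReal.ofReal (m + 2) * pathDensity e (m + 2) u ≤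
      M * (1 + 10 * ∫⁻ y, ENNReal.ofReal (y ^ 2) * e y) *
        ∫⁻ t, ENNReal.ofReal ((1 + ((t - u) / (m + 2)) ^ 2)⁻¹)
          ∂(volume.withDensity (pathDensity e m)) := by
  have hd := measurable_pathDensity he m
  set n : ℝ := m + 2 with hn
  have hn2 : 2 ≤ n := by rw [hn]; linarith [Nat.cast_nonneg (α := ℝ) m]
  have hn0 : n ≠ 0 := by linarith
  have hin : ∀ y, ENNReal.ofReal n * ∫⁻ y', e y' * pathDensity e m (u + (n + 1) * y + n * y') =
      ∫⁻ t, e ((t - u) / n - (n + 1) / n * y) * pathDensity e m t := by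
    intro y
    have hf : Measurable fun t => e ((t - u) / n - (n + 1) / n * y) * pathDensity e m t :=
      (he.comp (by fun_prop)).mul hd
    have h := lintegral_comp_mul_add hf hn0 (u + (n + 1) * y)
    rw [abs_of_pos (by linarith)] at h
    rw [← h]
    congr 2
    funext y'
    congr 2
    · field_simp; ring_nf
    · ring
  have hex : pathDensity e (m + 2) u =
      ∫⁻ y, e y * ∫⁻ y', e y' * pathDensity e m (u + (n + 1) * y + n * y') := by
    simp only [pathDensity]
    congr 1
    funext y
    congr 2
    funext y'
    congr 2
    rw [hn]
    push_cast
    ring_nf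
  have hmq : Measurable fun q : ℝ × ℝ =>
      e q.1 * e ((q.2 - u) / n - (n + 1) / n * q.1) * pathDensity e m q.2 :=
    ((he.comp (by fun_prop)).mul (he.comp (by fun_prop))).mul (hd.comp (by fun_prop))
  have hmy : Measurable fun y => e y *
      ∫⁻ y', e y' * pathDensity e m (u + (n + 1) * y + n * y') :=
    he.mul (Measurable.lintegral_prod_right' (f := fun q : ℝ × ℝ =>
      e q.2 * pathDensity e m (u + (n + 1) * q.1 + n * q.2))
      ((he.comp (by fun_prop)).mul (hd.comp (by fun_prop))))
  have hc : Measurable fun t => ENNReal.ofReal ((1 + ((t - u) / n) ^ 2)⁻¹) := by fun_prop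
  rw [hex, ← lintegral_const_mul _ hmy]
  calc ∫⁻ y, ENNReal.ofReal n * (e y *
        ∫⁻ y', e y' * pathDensity e m (u + (n + 1) * y + n * y'))
      = ∫⁻ y, ∫⁻ t, e y * e ((t - u) / n - (n + 1) / n * y) * pathDensity e m t := by
        congr 1
        funext y
        rw [mul_left_comm, hin, ← lintegral_const_mul]
        · simp only [mul_assoc]
        · exact (he.comp (by fun_prop)).mul hd
    _ = ∫⁻ t, ∫⁻ y, e y * e ((t - u) / n - (n + 1) / n * y) * pathDensity e m t :=
        lintegral_lintegral_swap hmq.aemeasurable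
    _ = ∫⁻ t, (∫⁻ y, e y * e ((t - u) / n - (n + 1) / n * y)) * pathDensity e m t := by
        congr 1
        funext t
        rw [lintegral_mul_const]
        exact he.mul (he.comp (by fun_prop))
    _ ≤ ∫⁻ t, M * (1 + 10 * ∫⁻ y, ENNReal.ofReal (y ^ 2) * e y) *
          (pathDensity e m t * ENNReal.ofReal ((1 + ((t - u) / n) ^ 2)⁻¹)) := by
        refine lintegral_mono fun t => ?_
        rw [mul_comm (pathDensity e m t), ← mul_assoc]
        gcongr
        refine lintegral_mul_shift_le he heM he1 ?_ ?_ _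
        · rw [le_div_iff₀ (by linarith)]; linarith
        · rw [div_le_iff₀ (by linarith)]; linarith
    _ = _ := by
        rw [lintegral_withDensity_eq_lintegral_mul _ hd hc, ← lintegral_const_mul _ (hd.mul hc)]
        rfl

theorem cube_le_sum_sq (m : ℕ) :
    ((m : ℝ) + 2) ^ 3 / 8 ≤ ∑ j ∈ Finset.range (m + 1), ((j : ℝ) + 1) ^ 2 := by
  induction m with
  | zero => norm_num
  | succ m ih =>
    rw [Finset.sum_range_succ]
    push_cast
    nlinarith [Nat.cast_nonneg (α := ℝ) m]

theorem mul_min_le_min {θ ξ : ℝ} (h0 : 0 ≤ θ) (h1 : θ ≤ 1) :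
    θ ^ 2 * min 1 (ξ ^ 2) ≤ min 1 ((θ * ξ) ^ 2) := by
  have hθ : θ ^ 2 ≤ 1 := pow_le_one₀ h0 h1
  refine le_min ?_ ?_
  · calc θ ^ 2 * min 1 (ξ ^ 2) ≤ 1 * 1 :=
        mul_le_mul hθ (min_le_left _ _) (by positivity) zero_le_one
      _ = 1 := one_mul 1
  · rw [mul_pow]
    exact mul_le_mul_of_nonneg_left (min_le_right _ _) (sq_nonneg _)

theorem integral_exp_min_le {A : ℝ} (hA : 0 < A) {f : ℝ → ℝ} 
    (hf : ∀ ξ, f ξ ≤ Real.exp (-A * min 1 (ξ ^ 2))) (hf0 : ∀ ξ, 0 ≤ f ξ) :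
    ∫ ξ in Ioi (0 : ℝ), Real.exp (-ξ) * f ξ ≤ 2 / √A := by
  have hg : Integrable (fun ξ : ℝ => Real.exp (-A * ξ ^ 2)) (volume.restrict (Ioi 0)) :=
    (integrable_exp_neg_mul_sq hA).integrableOn
  have he : Integrable (fun ξ : ℝ => Real.exp (-ξ) * Real.exp (-A)) (volume.restrict (Ioi 0)) :=
    (integrableOn_exp_neg_Ioi 0).mul_const _
  have hle : ∫ ξ in Ioi (0 : ℝ), Real.exp (-ξ) * f ξ ≤
      ∫ ξ in Ioi (0 : ℝ), (Real.exp (-ξ) * Real.exp (-A) + Real.exp (-A * ξ ^ 2)) := by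
    refine integral_mono_of_nonneg (ae_of_all _ fun ξ => mul_nonneg (Real.exp_pos _).le (hf0 ξ))
      (he.add hg) ?_
    filter_upwards [ae_restrict_mem measurableSet_Ioi] with ξ hξ
    have h1 : Real.exp (-ξ) ≤ 1 := by
      rw [Real.exp_le_one_iff]; exact neg_nonpos.2 (le_of_lt hξ)
    rcases le_total 1 (ξ ^ 2) with h | h
    · have h2 := hf ξ
      rw [min_eq_left h, mul_one] at h2
      nlinarith [Real.exp_pos (-ξ), Real.exp_pos (-A * ξ ^ 2),
        mul_le_mul_of_nonneg_left h2 (Real.exp_pos (-ξ)).le]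
    · have h2 := hf ξ
      rw [min_eq_right h] at h2
      have h3 : Real.exp (-ξ) * f ξ ≤ 1 * Real.exp (-A * ξ ^ 2) :=
        mul_le_mul h1 h2 (hf0 ξ) zero_le_one
      have : 0 < Real.exp (-ξ) * Real.exp (-A) := by positivity
      linarith
  rw [integral_add he hg, integral_mul_const, integral_exp_neg_Ioi_zero, one_mul,
    integral_gaussian_Ioi] at hle
  have hsA : 0 < √A := Real.sqrt_pos.2 hA
  have h1 : Real.exp (-A) ≤ 1 / √A := by
    rw [Real.exp_neg, inv_eq_one_div]
    refine one_div_le_one_div_of_le hsA ?_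
    have := Real.add_one_le_exp A
    nlinarith [Real.sq_sqrt hA.le, sq_nonneg (√A - 1)]
  have h2 : √(Real.pi / A) / 2 ≤ 1 / √A := by
    rw [Real.sqrt_div Real.pi_pos.le, div_div, mul_comm, ← div_div]
    refine div_le_div_of_nonneg_right ?_ hsA.le
    have : √Real.pi ≤ 2 := by
      rw [Real.sqrt_le_left (by norm_num)]; linarith [Real.pi_le_four]
    linarith
  calc _ ≤ _ := hle
    _ ≤ 1 / √A + 1 / √A := add_le_add h1 h2
    _ = 2 / √A := by ring

theorem pathDensity_le {e : ℝ → ℝ≥0∞} {M : ℝ≥0∞}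
    (heM : ∀ y, e y ≤ M) (he : Measurable e) (he1 : ∫⁻ y, e y = 1) (m : ℕ) (u : ℝ) :
    pathDensity e m u ≤ M := by
  induction m generalizing u with
  | zero => exact heM _
  | succ m ih =>
    calc pathDensity e (m + 1) u ≤ ∫⁻ y, e y * M := lintegral_mono fun y => by gcongr; exact ih _
      _ = M := by rw [lintegral_mul_const _ he, he1, one_mul]

/-- The densities are uniformly summable. -/
theorem tsum_iSup_pathDensity_ne_top {e : ℝ → ℝ≥0∞} (he : Measurable e) {M : ℝ≥0∞} (hM : M ≠ ∞)
    (heM : ∀ y, e y ≤ M) (he1 : ∫⁻ y, e y = 1)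
    (he2 : ∫⁻ y, ENNReal.ofReal (y ^ 2) * e y ≠ ∞) {κ : ℝ} (hκ : 0 < κ)
    (hchar : ∀ s, ‖charFun (volume.withDensity e) s‖ ≤ Real.exp (-κ * min 1 (s ^ 2))) :
    ∑' m, ⨆ u, pathDensity e m u ≠ ∞ := by
  set K := M * (1 + 10 * ∫⁻ y, ENNReal.ofReal (y ^ 2) * e y) with hK
  have hKt : K ≠ ∞ := by
    refine ENNReal.mul_ne_top hM (ENNReal.add_ne_top.2 ⟨ENNReal.one_ne_top, ?_⟩)
    exact ENNReal.mul_ne_top (by norm_num) he2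
  have hb : ∀ m : ℕ, ⨆ u, pathDensity e (m + 2) u ≤
      K * ENNReal.ofReal (2 / √(κ / 8) * (1 / ((m + 2 : ℕ) : ℝ) ^ (3 / 2 : ℝ))) := by
    intro m
    refine iSup_le fun u => ?_
    have hprob := isProbabilityMeasure_pathDensity he he1 m
    set n : ℝ := m + 2 with hn
    have hn2 : 2 ≤ n := by rw [hn]; linarith [Nat.cast_nonneg (α := ℝ) m]
    have hn0 : 0 < n := by linarith
    have h1 := pathDensity_add_two_le he heM he1 m u
    rw [← hn, ← hK] at h1
    have hcf : ∀ ξ : ℝ, ‖charFun (volume.withDensity (pathDensity e m)) (ξ / n)‖ ≤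
        Real.exp (-(κ * n / 8) * min 1 (ξ ^ 2)) := by
      intro ξ
      rw [norm_charFun_pathDensity he he1]
      calc ∏ j ∈ Finset.range (m + 1), ‖charFun (volume.withDensity e) ((j + 1) * (ξ / n))‖
          ≤ ∏ j ∈ Finset.range (m + 1),
            Real.exp (-κ * (((j : ℝ) + 1) ^ 2 * (min 1 (ξ ^ 2) / n ^ 2))) := by
            refine Finset.prod_le_prod (fun _ _ => norm_nonneg _) fun j hj => ?_
            refine (hchar _).trans (Real.exp_le_exp.2 ?_)
            have hjn : ((j : ℝ) + 1) / n ≤ 1 := by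
              rw [div_le_one hn0, hn]
              have : (j : ℝ) ≤ m := by
                exact_mod_cast Nat.lt_succ_iff.1 (Finset.mem_range.1 hj)
              linarith
            have h2 := mul_min_le_min (ξ := ξ) (by positivity) hjn
            have h3 : ((j : ℝ) + 1) / n * ξ = ((j : ℝ) + 1) * (ξ / n) := by ring
            rw [h3] at h2
            have h4 : ((j : ℝ) + 1) ^ 2 * (min 1 (ξ ^ 2) / n ^ 2) =
              (((j : ℝ) + 1) / n) ^ 2 * min 1 (ξ ^ 2) := by ring
            rw [h4]
            nlinarith
        _ = Real.exp (-κ * ((∑ j ∈ Finset.range (m + 1), ((j : ℝ) + 1) ^ 2) *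
              (min 1 (ξ ^ 2) / n ^ 2))) := by
            rw [← Real.exp_sum, ← Finset.mul_sum, ← Finset.sum_mul]
        _ ≤ _ := by
            refine Real.exp_le_exp.2 ?_
            have h5 := cube_le_sum_sq m
            rw [← hn] at h5
            have h6 : 0 ≤ min 1 (ξ ^ 2) / n ^ 2 := by positivity
            have h7 := mul_le_mul_of_nonneg_right h5 h6
            have h8 : n ^ 3 / 8 * (min 1 (ξ ^ 2) / n ^ 2) = n / 8 * min 1 (ξ ^ 2) := by
              field_simp
            rw [h8] at h7
            nlinarith
    have h2 : ∫⁻ t, ENNReal.ofReal ((1 + ((t - u) / n) ^ 2)⁻¹)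
          ∂(volume.withDensity (pathDensity e m)) ≤ ENNReal.ofReal (2 / √(κ * n / 8)) := by
      rw [← ofReal_integral_eq_lintegral_ofReal]
      · refine ENNReal.ofReal_le_ofReal ((integral_cauchy_le _ u).trans ?_)
        exact integral_exp_min_le (by positivity) hcf fun _ => norm_nonneg _
      · refine (integrable_const (1 : ℝ)).mono' ?_ (ae_of_all _ fun t => ?_)
        · exact Measurable.aestronglyMeasurable (by fun_prop)
        · rw [Real.norm_of_nonneg (by positivity)]
          refine inv_le_one_of_one_le₀ ?_
          nlinarith [sq_nonneg ((t - u) / n)]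
      · exact ae_of_all _ fun t => by positivity
    have hnE : ENNReal.ofReal n ≠ 0 := by simpa using hn0
    rw [mul_comm, ← ENNReal.le_div_iff_mul_le (Or.inl hnE) (Or.inl ENNReal.ofReal_ne_top)] at h1
    refine h1.trans ?_
    rw [mul_div_assoc]
    gcongr
    refine (ENNReal.div_le_div_right h2 _).trans ?_
    rw [← ENNReal.ofReal_div_of_pos hn0]
    refine ENNReal.ofReal_le_ofReal (le_of_eq ?_)
    have h9 : ((m + 2 : ℕ) : ℝ) = n := by rw [hn]; push_cast; ring
    rw [h9, show κ * n / 8 = κ / 8 * n by ring, Real.sqrt_mul (by positivity),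
      show (3 / 2 : ℝ) = 1 / 2 + 1 by norm_num, Real.rpow_add hn0, Real.rpow_one,
      ← Real.sqrt_eq_rpow]
    field_simp
  have hM' : ∀ m, ⨆ u, pathDensity e m u ≤ M := fun m => iSup_le (pathDensity_le heM he he1 m)
  rw [← ENNReal.summable.sum_add_tsum_nat_add' (k := 2)]
  refine ENNReal.add_ne_top.2 ⟨?_, ne_top_of_le_ne_top ?_ (ENNReal.tsum_le_tsum hb)⟩
  · exact ENNReal.sum_ne_top.2 fun m _ => ne_top_of_le_ne_top hM (hM' m)
  · rw [ENNReal.tsum_mul_left]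
    refine ENNReal.mul_ne_top hKt ?_
    have hs : Summable fun m : ℕ => 2 / √(κ / 8) * (1 / ((m + 2 : ℕ) : ℝ) ^ (3 / 2 : ℝ)) :=
      ((summable_nat_add_iff (f := fun m : ℕ => 1 / (m : ℝ) ^ (3 / 2 : ℝ)) 2).2
        (Real.summable_one_div_nat_rpow.2 (by norm_num))).mul_left _
    exact hs.tsum_ofReal_ne_top

theorem lintegral_stepOp_pairing {e : ℝ → ℝ≥0∞} (he : Measurable e) (ν : Measure ℝ) [SFinite ν]
    {F G : ℝ × ℝ → ℝ≥0∞} (hF : Measurable F) (hG : Measurable G) :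
    ∫⁻ z, ∫⁻ c, F (c, z) * stepOp e ν G (z, c) ∂ν ∂ν =
      ∫⁻ z, ∫⁻ c, stepOp e ν F (c, z) * G (z, c) ∂ν ∂ν := by
  have hT := isPosOp_stepOp he ν
  rw [lintegral_lintegral_swap (((hF.comp (by fun_prop)).mul
    ((hT.measurable hG).comp (by fun_prop))).aemeasurable)]
  congr 1
  funext c
  calc ∫⁻ z, F (c, z) * stepOp e ν G (z, c) ∂ν
      = ∫⁻ z, ∫⁻ d, F (c, z) * (e (d + z - 2 * c) * G (c, d)) ∂ν ∂ν := by
        congr 1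
        funext z
        rw [lintegral_const_mul _ (by fun_prop)]
        rfl
    _ = ∫⁻ d, ∫⁻ z, F (c, z) * (e (d + z - 2 * c) * G (c, d)) ∂ν ∂ν :=
        lintegral_lintegral_swap (((hF.comp (by fun_prop)).mul
          ((he.comp (by fun_prop)).mul (hG.comp (by fun_prop)))).aemeasurable)
    _ = _ := by
        congr 1
        funext d
        simp only [stepOp]
        rw [← lintegral_mul_const _ (by fun_prop)]
        congr 1
        funext z
        rw [add_comm d z]
        ring

/-- Time reversal of excursions. -/
theorem lintegral_mul_exc_comm {e : ℝ → ℝ≥0∞} (he : Measurable e) (ν : Measure ℝ) [SFinite ν]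
    {f h : ℝ → ℝ≥0∞} (hf : Measurable f) (hh : Measurable h) (m : ℕ) :
    ∫⁻ z, f z * exc e ν m h z ∂ν = ∫⁻ z, h z * exc e ν m f z ∂ν := by
  have hT := isPosOp_stepOp he ν
  have hP := isPosOp_pinOp he
  have hit : ∀ (m : ℕ) {F G : ℝ × ℝ → ℝ≥0∞}, Measurable F → Measurable G →
      ∫⁻ z, ∫⁻ c, F (c, z) * (stepOp e ν)^[m] G (z, c) ∂ν ∂ν =
        ∫⁻ z, ∫⁻ c, (stepOp e ν)^[m] F (c, z) * G (z, c) ∂ν ∂ν := by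
    intro m
    induction m with
    | zero => intro F G _ _; rfl
    | succ m ih =>
      intro F G hF hG
      rw [Function.iterate_succ_apply',
        lintegral_stepOp_pairing he ν hF ((hT.iterate m).measurable hG),
        ih (hT.measurable hF) hG, Function.iterate_succ_apply]
  cases m with
  | zero =>
    congr 1
    funext z
    simp only [exc, pinOp, Function.iterate_zero, id]
    ring
  | succ m =>
    have hex : ∀ {f h : ℝ → ℝ≥0∞}, Measurable f → Measurable h →
        ∫⁻ z, f z * exc e ν (m + 1) h z ∂ν =
        ∫⁻ z, ∫⁻ c, pinOp e f (c, z) * (stepOp e ν)^[m] (pinOp e h) (z, c) ∂ν ∂ν := by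
      intro f h hf hh
      congr 1
      funext z
      have hm := (hT.iterate m).measurable (hP.measurable hh)
      simp only [exc, Function.iterate_succ_apply', stepOp]
      rw [← lintegral_const_mul _ (by fun_prop)]
      congr 1
      funext c
      simp only [pinOp, add_zero]
      ring
    rw [hex hf hh, hex hh hf, hit m (hP.measurable hf) (hP.measurable hh),
      lintegral_lintegral_swap]
    · congr 1
      funext z
      congr 1
      funext c
      rw [mul_comm]
    · exact (((((hT.iterate m).measurable (hP.measurable hf))).comp (by fun_prop)).mul
        ((hP.measurable hh).comp (by fun_prop))).aemeasurable

theorem lintegral_mul_excSum_comm {e : ℝ → ℝ≥0∞} (he : Measurable e) (ν : Measure ℝ) [SFinite ν]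
    {f h : ℝ → ℝ≥0∞} (hf : Measurable f) (hh : Measurable h) (x : ℝ≥0∞) :
    ∫⁻ z, f z * excSum e ν x h z ∂ν = ∫⁻ z, h z * excSum e ν x f z ∂ν := by
  have hex : ∀ {f h : ℝ → ℝ≥0∞}, Measurable f → Measurable h →
      ∫⁻ z, f z * excSum e ν x h z ∂ν = ∑' m, x ^ (m + 2) * ∫⁻ z, f z * exc e ν m h z ∂ν := by
    intro f h hf hh
    simp only [excSum, ← ENNReal.tsum_mul_left]
    have hm' := fun m => (isPosOp_exc he ν m).measurable hh
    rw [lintegral_tsum fun m => by fun_prop]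
    congr 1
    funext m
    rw [← lintegral_const_mul _ (by fun_prop)]
    congr 1
    funext z
    ring
  rw [hex hf hh, hex hh hf]
  simp only [lintegral_mul_exc_comm he ν hf hh]

/-- A bounded probability density whose path densities are uniformly summable. -/
structure IsKernel (e : ℝ → ℝ≥0∞) (M : ℝ≥0∞) : Prop where
  measurable : Measurable e
  ne_top : M ≠ ∞
  le : ∀ y, e y ≤ M
  lintegral_eq_one : ∫⁻ y, e y = 1
  tsum_ne_top : ∑' m, ⨆ u, pathDensity e m u ≠ ∞

/-- The sum of the suprema of the path densities. -/
def densBound (e : ℝ → ℝ≥0∞) : ℝ≥0∞ := ∑' m, ⨆ u, pathDensity e m u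

/-- Bound for the mass of excursions leaving `[-L, L]` at one of their ends. -/
def excTail (e : ℝ → ℝ≥0∞) (M : ℝ≥0∞) (L : ℝ) : ℝ≥0∞ :=
  ∑' m : ℕ, min (⨆ u, pathDensity e m u)
    (M * ∫⁻ y in (Icc (-L) L)ᶜ, pathDensity e m ((m + 2) * y))

namespace IsKernel

variable {e : ℝ → ℝ≥0∞} {M : ℝ≥0∞} (hK : IsKernel e M) {ν : Measure ℝ} [SFinite ν]
  (hν : ν ≤ volume)
include hK

omit [SFinite ν] in
theorem lintegral_shift_le (hν : ν ≤ volume) (a : ℝ) : ∫⁻ z, e (a + z) ∂ν ≤ 1 := by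
  calc ∫⁻ z, e (a + z) ∂ν ≤ ∫⁻ z, e (a + z) := lintegral_mono' hν le_rfl
    _ = ∫⁻ z, e z := lintegral_add_left_eq_self e a
    _ = 1 := hK.lintegral_eq_one

omit [SFinite ν] in
theorem exc_one_le (hν : ν ≤ volume) (m : ℕ) (z : ℝ) :
    exc e ν m 1 z ≤ pathDensity e m ((m + 2) * z) := by
  have h := iterate_stepOp_volume hK.measurable (Measure.dirac 0) m 0 z
  simp only [lintegral_dirac] at h
  calc exc e ν m 1 z ≤ (stepOp e volume)^[m] (fun p => e (0 + p.1 - 2 * p.2)) (0, z) :=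
        stepOp_mono_measure hν (fun p => by simp [pinOp]) m _
    _ = _ := by rw [h]; congr 1; ring

omit [SFinite ν] in
theorem exc_one_le_iSup (hν : ν ≤ volume) (m : ℕ) (z : ℝ) :
    exc e ν m 1 z ≤ ⨆ u, pathDensity e m u :=
  (hK.exc_one_le hν m z).trans (le_iSup (pathDensity e m) _)

theorem exc_le_mul (m : ℕ) {h : ℝ → ℝ≥0∞} {s : ℝ≥0∞} (hh : ∀ y, h y ≤ s) (z : ℝ) :
    exc e ν m h z ≤ s * exc e ν m 1 z := by
  have h1 := (isPosOp_exc hK.measurable ν m).mono (show h ≤ s • 1 from fun y => by simpa using hh y)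
  rw [(isPosOp_exc hK.measurable ν m).smul s measurable_one] at h1
  exact h1 z

theorem excSum_le_mul (x : ℝ≥0∞) {h : ℝ → ℝ≥0∞} {s : ℝ≥0∞} (hh : ∀ y, h y ≤ s) (z : ℝ) :
    excSum e ν x h z ≤ s * excSum e ν x 1 z := by
  have h1 := (isPosOp_excSum hK.measurable ν x).mono
    (show h ≤ s • 1 from fun y => by simpa using hh y)
  rw [(isPosOp_excSum hK.measurable ν x).smul s measurable_one] at h1
  exact h1 z

omit hK [SFinite ν] in
theorem excSum_le_tsum {x : ℝ≥0∞} (hx : x ≤ 1) (h : ℝ → ℝ≥0∞) (z : ℝ) :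
    excSum e ν x h z ≤ ∑' m, exc e ν m h z :=
  ENNReal.tsum_le_tsum fun _ => mul_le_of_le_one_left' (pow_le_one₀ zero_le hx)

omit hK [SFinite ν] in
theorem retSum_le_tsum {x : ℝ≥0∞} (hx : x ≤ 1) (h : ℝ → ℝ≥0∞) (z : ℝ) :
    retSum e ν x h z ≤ ∑' m, ret e ν m h z :=
  ENNReal.tsum_le_tsum fun _ => mul_le_of_le_one_left' (pow_le_one₀ zero_le hx)

include hν

theorem excSum_le {x : ℝ≥0∞} (hx : x ≤ 1) {h : ℝ → ℝ≥0∞} {s : ℝ≥0∞} (hh : ∀ y, h y ≤ s)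
    (z : ℝ) : excSum e ν x h z ≤ densBound e * s := by
  refine (excSum_le_tsum hx h z).trans ?_
  rw [densBound, ← ENNReal.tsum_mul_right]
  refine ENNReal.tsum_le_tsum fun m => (hK.exc_le_mul m hh z).trans ?_
  rw [mul_comm]
  gcongr
  exact hK.exc_one_le_iSup hν m z

theorem ret_le (m : ℕ) {h : ℝ → ℝ≥0∞} {s : ℝ≥0∞} (hh : ∀ y, h y ≤ s) (a : ℝ) :
    ret e ν m h a ≤ (⨆ u, pathDensity e m u) * s := by
  rw [ret_eq_lintegral]
  calc ∫⁻ z, e (a + z) * exc e ν m h z ∂ν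
      ≤ ∫⁻ z, e (a + z) * ((⨆ u, pathDensity e m u) * s) ∂ν := by
        refine lintegral_mono fun z => ?_
        gcongr
        refine (hK.exc_le_mul m hh z).trans ?_
        rw [mul_comm]
        gcongr
        exact hK.exc_one_le_iSup hν m z
    _ = (∫⁻ z, e (a + z) ∂ν) * ((⨆ u, pathDensity e m u) * s) :=
        lintegral_mul_const _ (hK.measurable.comp (by fun_prop))
    _ ≤ 1 * _ := by gcongr; exact hK.lintegral_shift_le hν a
    _ = _ := one_mul _

theorem retSum_le {x : ℝ≥0∞} (hx : x ≤ 1) {h : ℝ → ℝ≥0∞} {s : ℝ≥0∞} (hh : ∀ y, h y ≤ s)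
    (a : ℝ) : retSum e ν x h a ≤ densBound e * s := by
  refine (retSum_le_tsum hx h a).trans ?_
  rw [densBound, ← ENNReal.tsum_mul_right]
  exact ENNReal.tsum_le_tsum fun m => hK.ret_le hν m hh a

theorem ret_le_lintegral (m : ℕ) {g : ℝ → ℝ≥0∞} (hg : Measurable g) (a : ℝ) :
    ret e ν m g a ≤ (⨆ u, pathDensity e m u) * (M * ∫⁻ y, g y ∂ν) := by
  have he := hK.measurable
  set ρ := ν.withDensity g
  have hmeas : ∀ p : ℝ × ℝ, Measurable fun y => e (y + p.1 - 2 * p.2) := fun p =>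
    he.comp (by fun_prop)
  have h := iterate_stepOp_volume he ρ m a 0
  have hfm : Measurable fun p : ℝ × ℝ => ∫⁻ y, e (y + p.1 - 2 * p.2) ∂ρ :=
    Measurable.lintegral_prod_right' (f := fun q : (ℝ × ℝ) × ℝ => e (q.2 + q.1.1 - 2 * q.1.2))
      (he.comp (by fun_prop))
  calc ret e ν m g a = (stepOp e ν)^[m] (stepOp e ν (pinOp e g)) (a, 0) := by
        rw [ret, Function.iterate_succ_apply]
    _ ≤ (stepOp e volume)^[m] (M • fun p => ∫⁻ y, e (y + p.1 - 2 * p.2) ∂ρ) (a, 0) := by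
        refine stepOp_mono_measure hν (fun p => ?_) m _
        simp only [stepOp, pinOp, Pi.smul_apply, smul_eq_mul]
        rw [lintegral_withDensity_eq_lintegral_mul _ hg (hmeas p),
          ← lintegral_const_mul _ (hg.mul (hmeas p))]
        refine lintegral_mono fun c => ?_
        simp only [Pi.mul_apply]
        calc _ = e (p.2 - 2 * c) * (g c * e (c + p.1 - 2 * p.2)) := by ring
          _ ≤ _ := by gcongr; exact hK.le _
    _ = M * ∫⁻ y, pathDensity e m (0 + (m + 1) * (0 - a) - y) ∂ρ := by
        rw [((isPosOp_stepOp he volume).iterate m).smul M hfm, Pi.smul_apply, h, smul_eq_mul]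
    _ ≤ M * ∫⁻ y, (⨆ u, pathDensity e m u) ∂ρ := by
        gcongr
        exact le_iSup (pathDensity e m) _
    _ = _ := by
        rw [lintegral_const, withDensity_apply _ MeasurableSet.univ, setLIntegral_univ]
        ring

theorem retSum_le_lintegral {x : ℝ≥0∞} (hx : x ≤ 1) {g : ℝ → ℝ≥0∞} (hg : Measurable g) (a : ℝ) :
    retSum e ν x g a ≤ densBound e * (M * ∫⁻ y, g y ∂ν) := by
  refine (retSum_le_tsum hx g a).trans ?_
  rw [densBound, ← ENNReal.tsum_mul_right]
  exact ENNReal.tsum_le_tsum fun m => hK.ret_le_lintegral hν m hg a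

theorem setLIntegral_exc_le (m : ℕ) (a L : ℝ) :
    ∫⁻ z in (Icc (-L) L)ᶜ, e (a + z) * exc e ν m 1 z ∂ν ≤
      min (⨆ u, pathDensity e m u)
        (M * ∫⁻ y in (Icc (-L) L)ᶜ, pathDensity e m ((m + 2) * y)) := by
  refine le_min ?_ ?_
  · calc _ ≤ ∫⁻ z, e (a + z) * exc e ν m 1 z ∂ν := setLIntegral_le_lintegral _ _
      _ = ret e ν m 1 a := (ret_eq_lintegral ν m 1 a).symm
      _ ≤ _ := hK.ret_le hν m (s := 1) (fun _ => le_rfl) a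
      _ = _ := mul_one _
  · have hd := measurable_pathDensity hK.measurable m
    rw [← lintegral_const_mul _ (by fun_prop)]
    refine lintegral_mono' (Measure.restrict_mono le_rfl hν) fun z => ?_
    exact mul_le_mul' (hK.le _) (hK.exc_one_le hν m z)

theorem setLIntegral_excSum_le {x : ℝ≥0∞} (hx : x ≤ 1) (a L : ℝ) :
    ∫⁻ z in (Icc (-L) L)ᶜ, e (a + z) * excSum e ν x 1 z ∂ν ≤ excTail e M L := by
  have he := hK.measurable
  calc _ ≤ ∫⁻ z in (Icc (-L) L)ᶜ, ∑' m, e (a + z) * exc e ν m 1 z ∂ν := by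
        refine lintegral_mono fun z => ?_
        simp only [ENNReal.tsum_mul_left]
        gcongr
        exact excSum_le_tsum hx 1 z
    _ = ∑' m, ∫⁻ z in (Icc (-L) L)ᶜ, e (a + z) * exc e ν m 1 z ∂ν :=
        lintegral_tsum fun m => ((he.comp (by fun_prop)).mul
          ((isPosOp_exc he ν m).measurable measurable_one)).aemeasurable
    _ ≤ _ := ENNReal.tsum_le_tsum fun m => hK.setLIntegral_exc_le hν m a L

theorem retSum_indicator_le {x : ℝ≥0∞} (hx : x ≤ 1) (a L : ℝ) :
    retSum e ν x ((Icc (-L) L)ᶜ.indicator 1) a ≤ excTail e M L := by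
  have he := hK.measurable
  have hS : MeasurableSet (Icc (-L) L)ᶜ := measurableSet_Icc.compl
  refine (retSum_le_tsum hx _ a).trans (ENNReal.tsum_le_tsum fun m => ?_)
  refine le_min ?_ ?_
  · calc _ ≤ _ := hK.ret_le hν m (s := 1) (fun y => indicator_le_self _ _ y) a
      _ = _ := mul_one _
  · rw [ret_eq_lintegral, lintegral_mul_exc_comm he ν (f := fun z => e (a + z)) (by fun_prop)
      (measurable_one.indicator hS)]
    have hd := measurable_pathDensity he m
    have hi : ∀ z, (Icc (-L) L)ᶜ.indicator 1 z * exc e ν m (fun z => e (a + z)) z =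
        (Icc (-L) L)ᶜ.indicator (exc e ν m (fun z => e (a + z))) z := by
      intro z
      by_cases hz : z ∈ (Icc (-L) L)ᶜ <;> simp [hz]
    simp only [hi]
    rw [lintegral_indicator hS, ← lintegral_const_mul _ (by fun_prop)]
    refine lintegral_mono' (Measure.restrict_mono le_rfl hν) fun z => ?_
    refine (hK.exc_le_mul m (fun y => hK.le (a + y)) z).trans ?_
    gcongr
    exact hK.exc_one_le hν m z

omit hν ν [SFinite ν] in
theorem exists_excTail_le {η : ℝ≥0∞} (hη : 0 < η) : ∃ L : ℝ, 1 ≤ L ∧ excTail e M L ≤ η := by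
  have he := hK.measurable
  have hmass : ∀ m : ℕ, ∫⁻ y, pathDensity e m ((m + 2) * y) ≠ ∞ := by
    intro m
    have hd := measurable_pathDensity he m
    have hprob := isProbabilityMeasure_pathDensity he hK.lintegral_eq_one m
    have h := lintegral_comp_mul_add hd (a := (m : ℝ) + 2) (by positivity) 0
    have h1 : ∫⁻ y, pathDensity e m y = 1 := by
      have := hprob.measure_univ
      rwa [withDensity_apply _ MeasurableSet.univ, setLIntegral_univ] at this
    rw [h1] at h
    simp only [add_zero] at h
    intro hc
    rw [hc, ENNReal.mul_top] at h
    · simp at h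
    · simp only [ne_eq, ENNReal.ofReal_eq_zero, not_le]; positivity
  have htail : ∀ m : ℕ, Tendsto (fun n : ℕ => min (⨆ u, pathDensity e m u)
      (M * ∫⁻ y in (Icc (-(n : ℝ)) n)ᶜ, pathDensity e m ((m + 2) * y))) atTop (𝓝 0) := by
    intro m
    have hd := measurable_pathDensity he m
    have hd' : Measurable fun y => pathDensity e m ((m + 2) * y) := hd.comp (by fun_prop)
    have h1 : Tendsto (fun n : ℕ => ∫⁻ y in (Icc (-(n : ℝ)) n)ᶜ, pathDensity e m ((m + 2) * y))
        atTop (𝓝 0) := by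
      have hS : ∀ n : ℕ, MeasurableSet (Icc (-(n : ℝ)) n)ᶜ := fun n => measurableSet_Icc.compl
      have h2 := tendsto_lintegral_of_dominated_convergence
        (μ := volume) (F := fun (n : ℕ) => (Icc (-(n : ℝ)) n)ᶜ.indicator
          fun y => pathDensity e m ((m + 2) * y)) (f := fun _ => 0)
        (fun y => pathDensity e m ((m + 2) * y)) (fun n => hd'.indicator (hS n))
        (fun n => ae_of_all _ fun y => indicator_le_self _ _ y) (hmass m)
        (ae_of_all _ fun y => by
          obtain ⟨N, hN⟩ := exists_nat_ge |y|
          refine tendsto_const_nhds.congr' ?_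
          filter_upwards [eventually_ge_atTop N] with n hn
          have : y ∈ Icc (-(n : ℝ)) n := abs_le.1 (hN.trans (by exact_mod_cast hn))
          simp [this])
      simp only [lintegral_zero] at h2
      simpa only [lintegral_indicator (hS _)] using h2
    have h3 := ENNReal.Tendsto.const_mul h1 (Or.inr hK.ne_top)
    rw [mul_zero] at h3
    exact tendsto_of_tendsto_of_tendsto_of_le_of_le tendsto_const_nhds h3
      (fun n => zero_le) fun n => min_le_right _ _
  have hlim : Tendsto (fun n : ℕ => excTail e M n) atTop (𝓝 0) := by
    have := tendsto_lintegral_of_dominated_convergence (μ := (Measure.count : Measure ℕ))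
      (F := fun (n : ℕ) (m : ℕ) => min (⨆ u, pathDensity e m u)
        (M * ∫⁻ y in (Icc (-(n : ℝ)) n)ᶜ, pathDensity e m ((m + 2) * y))) (f := fun _ => 0)
      (fun m => ⨆ u, pathDensity e m u) (fun n => measurable_from_nat)
      (fun n => ae_of_all _ fun m => min_le_left _ _)
      (by rw [lintegral_count]; exact hK.tsum_ne_top) (ae_of_all _ htail)
    simpa only [lintegral_count, tsum_zero, excTail] using this
  obtain ⟨n, hn, hn1⟩ := ((hlim.eventually_lt_const hη).and (eventually_ge_atTop 1)).exists
  exact ⟨n, by exact_mod_cast hn1, hn.le⟩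

/-- Approximation of the squared transfer operator by an operator of rank one. -/
theorem retSum_retSum_le {x : ℝ≥0∞} (hx : x ≤ 1) {g : ℝ → ℝ≥0∞} (hg : Measurable g) {s : ℝ≥0∞}
    (hgs : ∀ y, g y ≤ s) (L a : ℝ) :
    retSum e ν x (retSum e ν x g) a ≤
      densBound e ^ 2 * M * (∫⁻ y in Icc (-L) L, g y ∂ν) * (∫⁻ z in Icc (-L) L, e (a + z) ∂ν) +
        2 * excTail e M L * densBound e * s := by
  have he := hK.measurable
  set B := Icc (-L) L with hB
  have hBm : MeasurableSet B := measurableSet_Icc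
  have hR := isPosOp_retSum he ν x
  set h := retSum e ν x (B.indicator g) with hh
  have hgB : Measurable (B.indicator g) := hg.indicator hBm
  have hhm : Measurable h := hR.measurable hgB
  have hsplit : retSum e ν x g ≤ h + (s * excTail e M L) • 1 := by
    have h1 : g ≤ B.indicator g + s • Bᶜ.indicator 1 := by
      intro y
      by_cases hy : y ∈ B
      · simp [hy]
      · simpa [hy] using hgs y
    have h2 := hR.mono h1
    have hm1 : Measurable (Bᶜ.indicator (1 : ℝ → ℝ≥0∞)) := measurable_one.indicator hBm.compl
    rw [hR.add hgB (hm1.const_smul s), hR.smul s hm1] at h2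
    intro y
    refine (h2 y).trans ?_
    simp only [Pi.add_apply, Pi.smul_apply, smul_eq_mul, Pi.one_apply, mul_one]
    gcongr
    exact hK.retSum_indicator_le hν hx y L
  have h3 := hR.mono hsplit a
  rw [hR.add hhm (measurable_one.const_smul _), hR.smul _ measurable_one] at h3
  simp only [Pi.add_apply, Pi.smul_apply, smul_eq_mul] at h3
  have h4 : retSum e ν x 1 a ≤ densBound e := by
    simpa using hK.retSum_le hν hx (s := 1) (h := 1) (fun _ => le_rfl) a
  have hhb : ∀ y, h y ≤ densBound e * (M * ∫⁻ y in B, g y ∂ν) := by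
    intro y
    have := hK.retSum_le_lintegral hν hx hgB y
    rwa [lintegral_indicator hBm] at this
  have hhs : ∀ y, h y ≤ densBound e * s :=
    hK.retSum_le hν hx fun y => (indicator_le_self _ _ y).trans (hgs y)
  have h5 : retSum e ν x h a ≤
      densBound e ^ 2 * M * (∫⁻ y in B, g y ∂ν) * (∫⁻ z in B, e (a + z) ∂ν) +
        excTail e M L * densBound e * s := by
    rw [retSum_eq_lintegral he ν x hhm, ← lintegral_add_compl _ hBm]
    gcongr
    · calc ∫⁻ z in B, e (a + z) * excSum e ν x h z ∂ν
          ≤ ∫⁻ z in B, (densBound e * (densBound e * (M * ∫⁻ y in B, g y ∂ν))) * e (a + z) ∂ν := by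
            refine lintegral_mono fun z => ?_
            rw [mul_comm]
            gcongr
            exact hK.excSum_le hν hx hhb z
        _ = _ := by
            rw [lintegral_const_mul _ (by fun_prop)]
            ring
    · calc ∫⁻ z in Bᶜ, e (a + z) * excSum e ν x h z ∂ν
          ≤ ∫⁻ z in Bᶜ, (densBound e * s) * (e (a + z) * excSum e ν x 1 z) ∂ν := by
            refine lintegral_mono fun z => ?_
            rw [mul_left_comm]
            gcongr
            exact hK.excSum_le_mul x hhs z
        _ = (densBound e * s) * ∫⁻ z in Bᶜ, e (a + z) * excSum e ν x 1 z ∂ν :=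
            lintegral_const_mul _ ((he.comp (by fun_prop)).mul
              ((isPosOp_excSum he ν x).measurable measurable_one))
        _ ≤ (densBound e * s) * excTail e M L := by
            gcongr
            exact hK.setLIntegral_excSum_le hν hx a L
        _ = _ := by ring
  calc _ ≤ _ := h3
    _ ≤ densBound e ^ 2 * M * (∫⁻ y in B, g y ∂ν) * (∫⁻ z in B, e (a + z) ∂ν) +
        excTail e M L * densBound e * s + s * excTail e M L * densBound e := by gcongr
    _ = _ := by ring

end IsKernel

/-- The `i`-th cell of width `η` on the half-line of sign `s`. -/
def cell (η s : ℝ) (i : ℕ) : Set ℝ := {y | i * η ≤ s * y ∧ s * y ≤ (i + 1) * η}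

/-- Uniform positivity of some iterate of the chain on a pair of cells. -/
def IsGoodPair (e : ℝ → ℝ≥0∞) (ν : Measure ℝ) (η s : ℝ) (i j : ℕ) : Prop :=
  ∃ c : ℝ≥0∞, 0 < c ∧ ∃ m : ℕ, ∀ a ∈ cell η s i, ∀ b ∈ cell η s j,
    c ≤ (stepOp e ν)^[m] (pinOp e e) (a, b)

theorem abs_le_of_sign {s y r : ℝ} (hs : s = 1 ∨ s = -1) (h1 : -r ≤ s * y) (h2 : s * y ≤ r) :
    |y| ≤ r := by
  rw [abs_le]
  rcases hs with rfl | rfl <;> constructor <;> linarith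

section goodPair

variable {e : ℝ → ℝ≥0∞} {ν : Measure ℝ} {η s : ℝ} {q : ℝ≥0∞}

theorem IsGoodPair.step (hs : s = 1 ∨ s = -1) (hη : 0 < η) (hq : 0 < q)
    (he : ∀ y, |y| ≤ 4 * η → q ≤ e y) (hν : ∀ i, 0 < ν (cell η s i)) {i j k : ℕ}
    (h1 : -1 ≤ (k : ℝ) + i - 2 * j) (h2 : (k : ℝ) + i - 2 * j ≤ 1)
    (h : IsGoodPair e ν η s j k) : IsGoodPair e ν η s i j := by
  obtain ⟨c, hc, m, hm⟩ := h
  refine ⟨q * c * ν (cell η s k),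
    ENNReal.mul_pos (ENNReal.mul_pos hq.ne' hc.ne').ne' (hν k).ne', m + 1, ?_⟩
  intro a ha b hb
  rw [Function.iterate_succ_apply']
  have hcm : MeasurableSet (cell η s k) :=
    (measurableSet_le measurable_const (measurable_const_mul s)).inter
      (measurableSet_le (measurable_const_mul s) measurable_const)
  calc q * c * ν (cell η s k) = ∫⁻ _ in cell η s k, q * c ∂ν := by
        rw [setLIntegral_const]
    _ ≤ ∫⁻ y in cell η s k, e (y + a - 2 * b) * (stepOp e ν)^[m] (pinOp e e) (b, y) ∂ν := by
        refine setLIntegral_mono' hcm fun y hy => mul_le_mul' (he _ ?_) (hm b hb y hy)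
        obtain ⟨ha1, ha2⟩ := ha
        obtain ⟨hb1, hb2⟩ := hb
        obtain ⟨hy1, hy2⟩ := hy
        have e1 := mul_le_mul_of_nonneg_right h1 hη.le
        have e2 := mul_le_mul_of_nonneg_right h2 hη.le
        refine abs_le_of_sign hs ?_ ?_ <;> nlinarith
    _ ≤ ∫⁻ y, e (y + a - 2 * b) * (stepOp e ν)^[m] (pinOp e e) (b, y) ∂ν :=
        setLIntegral_le_lintegral _ _

theorem isGoodPair_zero (hs : s = 1 ∨ s = -1) (hη : 0 < η) (hq : 0 < q)
    (he : ∀ y, |y| ≤ 4 * η → q ≤ e y) {i : ℕ} (hi : (i : ℝ) ≤ 1) :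
    IsGoodPair e ν η s i 0 := by
  refine ⟨q * q, ENNReal.mul_pos hq.ne' hq.ne', 0, ?_⟩
  rintro a ⟨ha1, ha2⟩ b ⟨hb1, hb2⟩
  simp only [Nat.cast_zero, zero_mul, zero_add, one_mul] at hb1 hb2
  have hi0 : 0 ≤ (i : ℝ) * η := by positivity
  have hi1 : (i : ℝ) * η ≤ 1 * η := mul_le_mul_of_nonneg_right hi hη.le
  refine mul_le_mul' (he _ ?_) (he _ ?_) <;> refine abs_le_of_sign hs ?_ ?_ <;> simp only [] <;>
    nlinarith

theorem isGoodPair_zero_left (hs : s = 1 ∨ s = -1) (hη : 0 < η) (hq : 0 < q)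
    (he : ∀ y, |y| ≤ 4 * η → q ≤ e y) (hν : ∀ i, 0 < ν (cell η s i)) (p : ℕ) :
    IsGoodPair e ν η s 0 p := by
  have hdown : ∀ j : ℕ, IsGoodPair e ν η s (j + 1) j := by
    intro j
    induction j with
    | zero => exact isGoodPair_zero hs hη hq he (by simp)
    | succ j ih =>
      exact ih.step hs hη hq he hν (by push_cast; linarith) (by push_cast; linarith)
  have hdiag : ∀ j : ℕ, IsGoodPair e ν η s j j := by
    intro j
    cases j with
    | zero => exact isGoodPair_zero hs hη hq he (by simp)
    | succ j =>
      exact (hdown j).step hs hη hq he hν (by push_cast; linarith) (by push_cast; linarith)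
  have hup : ∀ v p : ℕ, IsGoodPair e ν η s p (p + v) := by
    intro v
    induction v with
    | zero => exact hdiag
    | succ v ih =>
      intro p
      exact (ih (p + (v + 1))).step hs hη hq he hν (by push_cast; linarith)
        (by push_cast; linarith)
  simpa using hup p 0

theorem exists_le_excSum_of_sign (hs : s = 1 ∨ s = -1) (hη : 0 < η) (hq : 0 < q)
    (he : ∀ y, |y| ≤ 4 * η → q ≤ e y) (hν : ∀ i, 0 < ν (cell η s i)) {x : ℝ≥0∞} (hx : 0 < x)
    (L : ℝ) : ∃ c : ℝ≥0∞, 0 < c ∧ ∀ z, 0 ≤ s * z → s * z ≤ L → c ≤ excSum e ν x e z := by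
  have key : ∀ N : ℕ, ∃ c : ℝ≥0∞, 0 < c ∧
      ∀ z, 0 ≤ s * z → s * z ≤ (N + 1) * η → c ≤ excSum e ν x e z := by
    have hcell : ∀ p : ℕ, ∃ c : ℝ≥0∞, 0 < c ∧ ∀ z ∈ cell η s p, c ≤ excSum e ν x e z := by
      intro p
      obtain ⟨c, hc, m, hm⟩ := isGoodPair_zero_left hs hη hq he hν p
      refine ⟨x ^ (m + 2) * c, ENNReal.mul_pos (pow_ne_zero _ hx.ne') hc.ne', fun z hz => ?_⟩
      have h1 : c ≤ exc e ν m e z := hm 0 (by simp [cell, hη.le]) z hz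
      exact (mul_le_mul_right h1 _).trans
        (ENNReal.le_tsum (f := fun m => x ^ (m + 2) * exc e ν m e z) m)
    intro N
    induction N with
    | zero =>
      obtain ⟨c, hc, h⟩ := hcell 0
      exact ⟨c, hc, fun z h1 h2 => h z ⟨by simpa using h1, h2⟩⟩
    | succ N ih =>
      obtain ⟨c, hc, h⟩ := hcell (N + 1)
      obtain ⟨c', hc', h'⟩ := ih
      refine ⟨min c c', lt_min hc hc', fun z h1 h2 => ?_⟩
      rcases le_total (s * z) ((N + 1) * η) with h3 | h3
      · exact (min_le_right _ _).trans (h' z h1 h3)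
      · exact (min_le_left _ _).trans (h z ⟨by push_cast; exact h3, h2⟩)
  obtain ⟨N, hN⟩ := exists_nat_ge (L / η)
  obtain ⟨c, hc, h⟩ := key N
  refine ⟨c, hc, fun z h1 h2 => h z h1 (h2.trans ?_)⟩
  rw [div_le_iff₀ hη] at hN
  nlinarith

end goodPair

theorem exists_pos_le_ofReal {E : ℝ → ℝ} (hEc : Continuous E) (hE0 : 0 < E 0) :
    ∃ η : ℝ, 0 < η ∧ ∃ q : ℝ≥0∞, 0 < q ∧ ∀ y, |y| ≤ 4 * η → q ≤ ENNReal.ofReal (E y) := by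
  have h := (hEc.tendsto 0).eventually_const_lt (show E 0 / 2 < E 0 by linarith)
  obtain ⟨r, hr, h⟩ := Metric.eventually_nhds_iff.1 h
  refine ⟨r / 8, by linarith, ENNReal.ofReal (E 0 / 2), by simpa using hE0, fun y hy => ?_⟩
  refine ENNReal.ofReal_le_ofReal (h ?_).le
  rw [Real.dist_eq, sub_zero]
  linarith

theorem cell_one (η : ℝ) (i : ℕ) : cell η 1 i = Icc (i * η) ((i + 1) * η) := by
  ext y; simp [cell]

theorem cell_neg_one (η : ℝ) (i : ℕ) : cell η (-1) i = Icc (-((i + 1) * η)) (-(i * η)) := by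
  ext y
  simp only [cell, mem_ofPred_eq, mem_Icc]
  constructor <;> rintro ⟨h1, h2⟩ <;> constructor <;> linarith

theorem exists_le_excSum_wetting {E : ℝ → ℝ} (hEc : Continuous E) (hE0 : 0 < E 0)
    {x : ℝ≥0∞} (hx : 0 < x) (L : ℝ) :
    ∃ c : ℝ≥0∞, 0 < c ∧ ∀ᵐ z ∂(volume.restrict (Ici (0 : ℝ))), z ∈ Icc (-L) L →
      c ≤ excSum (fun y => ENNReal.ofReal (E y)) (volume.restrict (Ici 0)) x
        (fun y => ENNReal.ofReal (E y)) z := by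
  obtain ⟨η, hη, q, hq, he⟩ := exists_pos_le_ofReal hEc hE0
  obtain ⟨c, hc, h⟩ := exists_le_excSum_of_sign (s := 1) (ν := volume.restrict (Ici 0))
    (Or.inl rfl) hη hq he (fun i => by
      have hsub : Icc ((i : ℝ) * η) ((i + 1) * η) ⊆ Ici 0 := fun y hy =>
        le_trans (by positivity) hy.1
      rw [cell_one, Measure.restrict_apply measurableSet_Icc, inter_eq_left.2 hsub,
        Real.volume_Icc]
      simp only [ENNReal.ofReal_pos]
      linarith) hx L
  refine ⟨c, hc, ?_⟩
  filter_upwards [ae_restrict_mem measurableSet_Ici] with z hz hzL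
  exact h z (by simpa using hz) (by simpa using hzL.2)

theorem exists_le_excSum_pinning {E : ℝ → ℝ} (hEc : Continuous E) (hE0 : 0 < E 0)
    {x : ℝ≥0∞} (hx : 0 < x) (L : ℝ) :
    ∃ c : ℝ≥0∞, 0 < c ∧ ∀ᵐ z, z ∈ Icc (-L) L →
      c ≤ excSum (fun y => ENNReal.ofReal (E y)) volume x (fun y => ENNReal.ofReal (E y)) z := by
  obtain ⟨η, hη, q, hq, he⟩ := exists_pos_le_ofReal hEc hE0
  obtain ⟨c, hc, h⟩ := exists_le_excSum_of_sign (s := 1) (ν := volume)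
    (Or.inl rfl) hη hq he (fun i => by
      rw [cell_one, Real.volume_Icc]
      simp only [ENNReal.ofReal_pos]
      linarith) hx L
  obtain ⟨c', hc', h'⟩ := exists_le_excSum_of_sign (s := -1) (ν := volume)
    (Or.inr rfl) hη hq he (fun i => by
      rw [cell_neg_one, Real.volume_Icc]
      simp only [ENNReal.ofReal_pos]
      linarith) hx L
  refine ⟨min c c', lt_min hc hc', ae_of_all _ fun z hz => ?_⟩
  rcases le_total 0 z with hz0 | hz0
  · exact (min_le_left _ _).trans (h z (by simpa using hz0) (by simpa using hz.2))
  · exact (min_le_right _ _).trans (h' z (by linarith) (by linarith [hz.1]))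

theorem ENNReal.exists_pos_mul_le {D t : ℝ≥0∞} (hD : D ≠ ∞) (ht : 0 < t) :
    ∃ w : ℝ≥0∞, 0 < w ∧ w ≠ ∞ ∧ D * w ≤ t := by
  have hD1 : D + 1 ≠ ∞ := ENNReal.add_ne_top.2 ⟨hD, ENNReal.one_ne_top⟩
  refine ⟨min 1 (t / (D + 1)), lt_min one_pos (ENNReal.div_pos ht.ne' hD1),
    ne_top_of_le_ne_top ENNReal.one_ne_top (min_le_left _ _), ?_⟩
  calc D * min 1 (t / (D + 1)) ≤ (D + 1) * (t / (D + 1)) :=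
        mul_le_mul' le_self_add (min_le_right _ _)
    _ = t := ENNReal.mul_div_cancel (by simp) hD1

namespace IsKernel

variable {e : ℝ → ℝ≥0∞} {M : ℝ≥0∞} (hK : IsKernel e M) {ν : Measure ℝ} [SFinite ν]
  (hν : ν ≤ volume)
include hK hν

/-- Continuity of `ε` and `x` in `ε • retSum e ν x`, uniformly on bounded functions. -/
theorem exists_smul_retSum_le {ε x : ℝ≥0∞} (hε : 0 < ε) (hε' : ε ≠ ∞) (hx : 0 < x) (hx1 : x ≤ 1)
    {w : ℝ≥0∞} (hw : 0 < w) :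
    ∃ ε₁ x₁ : ℝ≥0∞, ε < ε₁ ∧ ε₁ ≤ 2 * ε ∧ x ≤ x₁ ∧ x₁ ≤ 1 ∧ (x < 1 → x < x₁) ∧
      ∀ (h : ℝ → ℝ≥0∞) (s : ℝ≥0∞), (∀ y, h y ≤ s) → ∀ a,
        ε₁ * retSum e ν x₁ h a ≤ ε * retSum e ν x h a + w * s := by
  have hxt : x ≠ ∞ := ne_top_of_le_ne_top ENNReal.one_ne_top hx1
  set t : ℕ → ℝ≥0∞ := fun n => 1 + ((n : ℝ≥0∞) + 1)⁻¹ with ht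
  have htl : Tendsto t atTop (𝓝 1) := by
    have h1 : Tendsto (fun n : ℕ => ((n : ℝ≥0∞) + 1)⁻¹) atTop (𝓝 0) := by
      have := (tendsto_add_atTop_iff_nat 1).2 ENNReal.tendsto_inv_nat_nhds_zero
      simpa using this
    simpa using tendsto_const_nhds.add h1
  have ht1 : ∀ n, 1 < t n := fun n =>
    ENNReal.lt_add_right ENNReal.one_ne_top (ENNReal.inv_ne_zero.2 (by simp))
  have ht2 : ∀ n, t n ≤ 2 := fun n => by
    rw [ht, ← one_add_one_eq_two]
    exact add_le_add_right (ENNReal.inv_le_one.2 (by simp)) _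
  set εn : ℕ → ℝ≥0∞ := fun n => t n * ε with hεn
  set xn : ℕ → ℝ≥0∞ := fun n => min 1 (t n * x) with hxn
  have hεl : Tendsto εn atTop (𝓝 ε) := by
    simpa using ENNReal.Tendsto.mul_const htl (Or.inr hε')
  have hxl : Tendsto xn atTop (𝓝 x) := by
    have := (tendsto_const_nhds (x := (1 : ℝ≥0∞))).min (ENNReal.Tendsto.mul_const htl (Or.inr hxt))
    simpa [hx1] using this
  have hε2 : ∀ n, εn n ≤ 2 * ε := fun n => mul_le_mul_left (ht2 n) _
  have hd := hK.tsum_ne_top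
  have hmd : ∀ m, ⨆ u, pathDensity e m u ≠ ∞ := fun m => ENNReal.ne_top_of_tsum_ne_top hd m
  have hlim : Tendsto (fun n => ∑' m, (εn n * xn n ^ (m + 2) - ε * x ^ (m + 2)) *
      ⨆ u, pathDensity e m u) atTop (𝓝 0) := by
    have hpt : ∀ m : ℕ, Tendsto (fun n => (εn n * xn n ^ (m + 2) - ε * x ^ (m + 2)) *
        ⨆ u, pathDensity e m u) atTop (𝓝 0) := by
      intro m
      have hxm : x ^ (m + 2) ≠ ∞ := ENNReal.pow_ne_top hxt
      have h1 : Tendsto (fun n => εn n * xn n ^ (m + 2)) atTop (𝓝 (ε * x ^ (m + 2))) :=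
        ENNReal.Tendsto.mul hεl (Or.inr hxm) (ENNReal.Tendsto.pow hxl) (Or.inr hε')
      have h2 := ENNReal.Tendsto.sub h1 (tendsto_const_nhds (x := ε * x ^ (m + 2)))
        (Or.inl (ENNReal.mul_ne_top hε' hxm))
      simpa using ENNReal.Tendsto.mul_const h2 (Or.inr (hmd m))
    have := tendsto_lintegral_of_dominated_convergence (μ := (Measure.count : Measure ℕ))
      (F := fun (n : ℕ) (m : ℕ) => (εn n * xn n ^ (m + 2) - ε * x ^ (m + 2)) *
        ⨆ u, pathDensity e m u) (f := fun _ => 0)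
      (fun m => 2 * ε * ⨆ u, pathDensity e m u) (fun n => measurable_from_nat)
      (fun n => ae_of_all _ fun m => by
        refine mul_le_mul_left (tsub_le_self.trans ?_) _
        calc εn n * xn n ^ (m + 2) ≤ 2 * ε * 1 :=
              mul_le_mul' (hε2 n) (pow_le_one₀ zero_le (min_le_left _ _))
          _ = _ := mul_one _)
      (by
        rw [lintegral_count, ENNReal.tsum_mul_left]
        exact ENNReal.mul_ne_top (ENNReal.mul_ne_top (by simp) hε') hd) (ae_of_all _ hpt)
    simpa only [lintegral_count, tsum_zero] using this
  obtain ⟨n, hn⟩ := (hlim.eventually_lt_const hw).exists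
  have hlt : ∀ y : ℝ≥0∞, 0 < y → y ≠ ∞ → y < t n * y := fun y hy hy' => by
    simpa using ENNReal.mul_lt_mul_left hy.ne' hy' (ht1 n)
  refine ⟨εn n, xn n, hlt ε hε hε', hε2 n, le_min hx1 (hlt x hx hxt).le, min_le_left _ _,
    fun h => lt_min h (hlt x hx hxt), fun h s hs a => ?_⟩
  simp only [retSum, ← ENNReal.tsum_mul_left]
  calc ∑' m, εn n * (xn n ^ (m + 2) * ret e ν m h a)
      ≤ ∑' m, (ε * (x ^ (m + 2) * ret e ν m h a) +
        ((εn n * xn n ^ (m + 2) - ε * x ^ (m + 2)) * ⨆ u, pathDensity e m u) * s) := by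
        refine ENNReal.tsum_le_tsum fun m => ?_
        calc εn n * (xn n ^ (m + 2) * ret e ν m h a)
            = (εn n * xn n ^ (m + 2)) * ret e ν m h a := by ring
          _ ≤ (ε * x ^ (m + 2) + (εn n * xn n ^ (m + 2) - ε * x ^ (m + 2))) * ret e ν m h a := by
              gcongr
              exact le_add_tsub
          _ = ε * (x ^ (m + 2) * ret e ν m h a) +
              (εn n * xn n ^ (m + 2) - ε * x ^ (m + 2)) * ret e ν m h a := by ring
          _ ≤ _ := by
              rw [mul_assoc (_ - _)]
              gcongr
              exact hK.ret_le hν m hs a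
    _ = ∑' m, ε * (x ^ (m + 2) * ret e ν m h a) +
        (∑' m, (εn n * xn n ^ (m + 2) - ε * x ^ (m + 2)) * ⨆ u, pathDensity e m u) * s := by
        rw [ENNReal.tsum_add, ENNReal.tsum_mul_right]
    _ ≤ _ := by gcongr

/-- A strict supersolution of the squared operator yields finiteness of `contactFun`. -/
theorem contactFun_ne_top_of_supersolution {ε x : ℝ≥0∞} (hε : ε ≠ ∞) (hx : x ≤ 1)
    {v : ℝ → ℝ≥0∞} (hv : Measurable v) {s r : ℝ≥0∞} (hs : s ≠ ∞) (hvs : ∀ y, v y ≤ s) (hr : 0 < r)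
    (hr' : r ≠ ∞)
    (h : ∀ a, r + ε * (ε * retSum e ν x (retSum e ν x v) a) ≤ v a) :
    contactFun e ν ε x 0 ≠ ∞ := by
  have he := hK.measurable
  have hR := isPosOp_retSum he ν x
  have hA := isPosOp_smul_retSum he ν ε x
  have hRv := hR.measurable hv
  set C := M / r with hC
  have hCr : C * r = M := ENNReal.div_mul_cancel hr.ne' hr'
  set w : ℝ → ℝ≥0∞ := C • (v + ε • retSum e ν x v) with hw
  have hle : contactFun e ν ε x ≤ w := by
    refine neumann_le hA he fun a => ?_
    have h1 : (ε • retSum e ν x w) a =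
        C * (ε * retSum e ν x v a + ε * (ε * retSum e ν x (retSum e ν x v) a)) := by
      rw [hw, hR.smul C (hv.add (hRv.const_smul ε)), hR.add hv (hRv.const_smul ε),
        hR.smul ε hRv]
      simp only [Pi.smul_apply, Pi.add_apply, smul_eq_mul]
      ring
    rw [Pi.add_apply, h1]
    calc e a + C * (ε * retSum e ν x v a + ε * (ε * retSum e ν x (retSum e ν x v) a))
        ≤ C * r + C * (ε * retSum e ν x v a + ε * (ε * retSum e ν x (retSum e ν x v) a)) := by
          rw [hCr]; gcongr; exact hK.le a
      _ = C * ((r + ε * (ε * retSum e ν x (retSum e ν x v) a)) + ε * retSum e ν x v a) := by ring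
      _ ≤ C * (v a + ε * retSum e ν x v a) := by gcongr; exact h a
      _ = w a := rfl
  refine ne_top_of_le_ne_top ?_ (hle 0)
  refine ENNReal.mul_ne_top (ENNReal.div_ne_top hK.ne_top hr.ne')
    (ENNReal.add_ne_top.2 ⟨ne_top_of_le_ne_top hs (hvs 0), ENNReal.mul_ne_top hε ?_⟩)
  exact ne_top_of_le_ne_top (ENNReal.mul_ne_top hK.tsum_ne_top hs) (hK.retSum_le hν hx hvs 0)

end IsKernel

namespace IsKernel

variable {e : ℝ → ℝ≥0∞} {M : ℝ≥0∞} (hK : IsKernel e M) {ν : Measure ℝ} [SFinite ν]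
  (hν : ν ≤ volume)
include hK hν

/-- At the critical point the squared operator still has a bounded strict supersolution. -/
theorem exists_supersolution
    (hlow : ∀ x : ℝ≥0∞, 0 < x → ∀ L : ℝ, ∃ c : ℝ≥0∞, 0 < c ∧
      ∀ᵐ z ∂ν, z ∈ Icc (-L) L → c ≤ excSum e ν x e z)
    (hbox : 0 < ∫⁻ z in Icc (-1) 1, e z ∂ν) {ε x : ℝ≥0∞} (hε : 0 < ε) (hε' : ε ≠ ∞)
    (hx : 0 < x) (hx1 : x ≤ 1) (hG : genFun e ν ε x ≤ 1) :
    ∃ (v : ℝ → ℝ≥0∞) (s r : ℝ≥0∞), Measurable v ∧ s ≠ ∞ ∧ (∀ y, v y ≤ s) ∧ 0 < r ∧ r ≠ ∞ ∧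
      ∀ a, r + ε * (ε * retSum e ν x (retSum e ν x v) a) ≤ v a := by
  have he := hK.measurable
  have hxt : x ≠ ∞ := ne_top_of_le_ne_top ENNReal.one_ne_top hx1
  have hR := isPosOp_retSum he ν x
  have hd : densBound e ≠ ∞ := hK.tsum_ne_top
  obtain ⟨η, hη, -, hηle⟩ := ENNReal.exists_pos_mul_le (D := 2 * ε ^ 2 * densBound e)
    (t := 2⁻¹) (by finiteness) (by simp)
  obtain ⟨L, hL1, hL⟩ := hK.exists_excTail_le hη
  have htail : ε * (ε * (2 * excTail e M L * densBound e)) ≤ 2⁻¹ := by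
    refine le_trans ?_ hηle
    calc ε * (ε * (2 * excTail e M L * densBound e))
        = 2 * ε ^ 2 * densBound e * excTail e M L := by ring
      _ ≤ _ := by gcongr
  obtain ⟨c, hc, hcl⟩ := hlow x hx L
  obtain ⟨c₀, hc₀, hc₀t, hc₀l⟩ : ∃ c₀ : ℝ≥0∞, 0 < c₀ ∧ c₀ ≠ ∞ ∧
      ∀ᵐ z ∂ν, z ∈ Icc (-L) L → c₀ ≤ excSum e ν x e z :=
    ⟨min c 1, lt_min hc one_pos, ne_top_of_le_ne_top ENNReal.one_ne_top (min_le_right _ _),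
      hcl.mono fun z h hz => (min_le_left _ _).trans (h hz)⟩
  set B := Icc (-L) L with hB
  have hBm : MeasurableSet B := measurableSet_Icc
  have hlower : ∀ g : ℝ → ℝ≥0∞, Measurable g →
      c₀ * ∫⁻ z in B, g z ∂ν ≤ ∫⁻ z, g z * excSum e ν x e z ∂ν := by
    intro g hg
    rw [← lintegral_const_mul _ hg]
    refine le_trans (setLIntegral_mono_ae' hBm ?_) (setLIntegral_le_lintegral B _)
    filter_upwards [hc₀l] with z hz hzB
    rw [mul_comm]
    gcongr
    exact hz hzB
  set l : ℝ → ℝ≥0∞ := fun a => ∫⁻ z in B, e (a + z) ∂ν with hl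
  have hlm : Measurable l :=
    (he.comp (measurable_fst.add measurable_snd)).lintegral_prod_right'
  have hl1 : ∀ a, l a ≤ 1 := fun a =>
    (setLIntegral_le_lintegral B _).trans (hK.lintegral_shift_le hν a)
  have hRe : ∀ a, c₀ * l a ≤ retSum e ν x e a := fun a => by
    rw [retSum_eq_lintegral he ν x he]
    exact hlower _ (he.comp (measurable_const_add a))
  set u := contactFun e ν ε x with hu
  have hum : Measurable u := measurable_contactFun he ν ε x
  have hueq : u = e + ε • retSum e ν x u := contactFun_eq he ν ε x
  have hu0 : ε * x * u 0 ≤ 1 := hG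
  have hu0t : u 0 ≠ ∞ := by
    intro h
    rw [h, ENNReal.mul_top (mul_ne_zero hε.ne' hx.ne')] at hu0
    exact absurd hu0 (by simp)
  have hRu : ε * retSum e ν x u 0 ≤ u 0 := by
    conv_rhs => rw [hueq]
    exact le_add_self
  have hRut : retSum e ν x u 0 ≠ ∞ := by
    intro h
    rw [h, ENNReal.mul_top hε.ne'] at hRu
    exact hu0t (top_le_iff.1 hRu)
  have hRu0 : c₀ * ∫⁻ z in B, u z ∂ν ≤ retSum e ν x u 0 := by
    rw [retSum_eq_lintegral he ν x hum]
    simp only [zero_add]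
    rw [← lintegral_mul_excSum_comm he ν hum he]
    exact hlower u hum
  set q := ε ^ 3 * x * c₀ ^ 2 with hq
  have hqt : q ≠ ∞ := by finiteness
  have hq0 : q ≠ 0 := mul_ne_zero (mul_ne_zero (pow_ne_zero _ hε.ne') hx.ne')
    (pow_ne_zero _ hc₀.ne')
  set A : (ℝ → ℝ≥0∞) → ℝ → ℝ≥0∞ := fun h =>
    (ε * ε) • retSum e ν x (retSum e ν x h) +
      fun a => ∫⁻ c, q * l a * h c ∂(ν.restrict B) with hAdef
  have hA : IsPosOp A := ((hR.comp hR).constSMul (ε * ε)).addOp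
    (IsPosOp.lintegralMul (k := fun p : ℝ × ℝ => q * l p.1) (g := fun p => p.2)
      (by fun_prop) (by fun_prop))
  have hAap : ∀ h : ℝ → ℝ≥0∞, Measurable h → ∀ a, A h a =
      ε * (ε * retSum e ν x (retSum e ν x h) a) + q * l a * ∫⁻ z in B, h z ∂ν := by
    intro h hh a
    simp only [hAdef, Pi.add_apply, Pi.smul_apply, smul_eq_mul, lintegral_const_mul _ hh]
    rw [mul_assoc ε]
  set Y := neumann A e with hY
  have hYm : Measurable Y := measurable_neumann hA he
  have hYu : Y ≤ u := by
    refine neumann_le hA he fun a => ?_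
    have h1 : u a = e a + (ε * retSum e ν x e a + ε * (ε * retSum e ν x (retSum e ν x u) a)) := by
      have h2 : retSum e ν x u a = retSum e ν x e a + ε * retSum e ν x (retSum e ν x u) a := by
        conv_lhs => rw [hueq]
        rw [hR.add he ((hR.measurable hum).const_smul ε), hR.smul ε (hR.measurable hum)]
        rfl
      conv_lhs => rw [hueq]
      rw [Pi.add_apply, Pi.smul_apply, smul_eq_mul, h2, mul_add]
    rw [Pi.add_apply, hAap u hum, h1, add_comm (ε * retSum e ν x e a)]
    refine add_le_add_right (add_le_add_right ?_ _) _
    calc q * l a * ∫⁻ z in B, u z ∂ν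
        = ε * (ε * x * (ε * (c₀ * ∫⁻ z in B, u z ∂ν))) * (c₀ * l a) := by rw [hq]; ring
      _ ≤ ε * (ε * x * (ε * retSum e ν x u 0)) * retSum e ν x e a := by
          gcongr
          exact hRe a
      _ ≤ ε * 1 * retSum e ν x e a := by
          gcongr
          exact (mul_le_mul_right hRu _).trans hu0
      _ = ε * retSum e ν x e a := by rw [mul_one]
  set β := ∫⁻ z in B, Y z ∂ν with hβ
  have hβt : β ≠ ∞ := by
    have h1 : β ≤ ∫⁻ z in B, u z ∂ν := lintegral_mono hYu
    intro h
    rw [h, top_le_iff] at h1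
    rw [h1, ENNReal.mul_top hc₀.ne', top_le_iff] at hRu0
    exact hRut hRu0
  have hYeq : Y = e + A Y := neumann_eq hA he
  have hβ0 : 0 < β := by
    refine hbox.trans_le ((lintegral_mono_set (Icc_subset_Icc (by linarith) hL1)).trans
      (lintegral_mono ?_))
    rw [hYeq]
    exact le_self_add
  set C₀ := densBound e ^ 2 * M with hC₀
  have hC₀t : C₀ ≠ ∞ := ENNReal.mul_ne_top (ENNReal.pow_ne_top hd) hK.ne_top
  set K := 2 * (M + (ε * ε * C₀ + q) * β) with hKdef
  have hKt : K ≠ ∞ := by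
    have := hK.ne_top
    finiteness
  have hKhalf : M + (ε * ε * C₀ + q) * β + 2⁻¹ * K = K := by
    rw [hKdef, ENNReal.inv_mul_cancel_left two_ne_zero (by simp), two_mul]
  have hYK : Y ≤ fun _ => K := by
    refine neumann_le_of_bound hA he (fun g => ∀ a, g a ≤ K) (fun _ => zero_le)
      (fun g hg hgY hgK a => ?_) fun g hg => hg
    have hgβ : ∫⁻ z in B, g z ∂ν ≤ β := lintegral_mono hgY
    rw [Pi.add_apply, hAap g hg]
    have h1 := hK.retSum_retSum_le hν hx1 hg hgK L a
    calc e a + (ε * (ε * retSum e ν x (retSum e ν x g) a) + q * l a * ∫⁻ z in B, g z ∂ν)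
        ≤ M + (ε * (ε * (C₀ * β * 1 + 2 * excTail e M L * densBound e * K)) + q * 1 * β) := by
          gcongr
          · exact hK.le a
          · refine h1.trans ?_
            gcongr
            exact hl1 a
          · exact hl1 a
      _ = M + (ε * ε * C₀ + q) * β + ε * (ε * (2 * excTail e M L * densBound e)) * K := by ring
      _ ≤ M + (ε * ε * C₀ + q) * β + 2⁻¹ * K := by gcongr
      _ = K := hKhalf
  have hνB : ν B ≠ ∞ := ne_top_of_le_ne_top (by simp [hB]) (hν B)
  obtain ⟨κ, hκ, hκt, hκle⟩ := ENNReal.exists_pos_mul_le (D := ε * ε * C₀ * ν B) (t := q * β)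
    (by finiteness) (ENNReal.mul_pos hq0 hβ0.ne')
  refine ⟨Y + κ • 1, K + κ, 2⁻¹ * κ, hYm.add (measurable_one.const_smul κ), by finiteness,
    fun y => by simpa using add_le_add_left (hYK y) κ, ENNReal.mul_pos (by simp) hκ.ne',
    ENNReal.mul_ne_top (by simp) hκt, fun a => ?_⟩
  have h1 : retSum e ν x (retSum e ν x (Y + κ • 1)) a =
      retSum e ν x (retSum e ν x Y) a + κ * retSum e ν x (retSum e ν x 1) a := by
    rw [hR.add hYm (measurable_one.const_smul κ), hR.smul κ measurable_one,
      hR.add (hR.measurable hYm) ((hR.measurable measurable_one).const_smul κ),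
      hR.smul κ (hR.measurable measurable_one)]
    rfl
  have h2 := hK.retSum_retSum_le hν hx1 (g := 1) (s := 1) measurable_one (fun _ => le_rfl) L a
  simp only [Pi.one_apply, setLIntegral_one, mul_one] at h2
  have h3 : ε * (ε * (κ * retSum e ν x (retSum e ν x 1) a)) ≤ q * l a * β + 2⁻¹ * κ := by
    calc ε * (ε * (κ * retSum e ν x (retSum e ν x 1) a))
        ≤ ε * (ε * (κ * (C₀ * ν B * l a + 2 * excTail e M L * densBound e))) := by gcongr
      _ = ε * ε * C₀ * ν B * κ * l a +
          ε * (ε * (2 * excTail e M L * densBound e)) * κ := by ring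
      _ ≤ q * β * l a + 2⁻¹ * κ := by gcongr
      _ = _ := by ring
  have h4 : Y a = e a + (ε * (ε * retSum e ν x (retSum e ν x Y) a) + q * l a * β) := by
    conv_lhs => rw [hYeq]
    rw [Pi.add_apply, hAap Y hYm]
  rw [h1, mul_add, mul_add]
  calc 2⁻¹ * κ + (ε * (ε * retSum e ν x (retSum e ν x Y) a) +
        ε * (ε * (κ * retSum e ν x (retSum e ν x 1) a)))
      ≤ 2⁻¹ * κ + (ε * (ε * retSum e ν x (retSum e ν x Y) a) + (q * l a * β + 2⁻¹ * κ)) := by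
        gcongr
    _ = (ε * (ε * retSum e ν x (retSum e ν x Y) a) + q * l a * β) + (2⁻¹ + 2⁻¹) * κ := by ring
    _ ≤ Y a + κ := by
        rw [h4, ENNReal.inv_two_add_inv_two, one_mul]
        exact add_le_add_left le_add_self κ
    _ = (Y + κ • (1 : ℝ → ℝ≥0∞)) a := by simp

/-- Finiteness of the generating function persists beyond every subcritical or critical point. -/
theorem exists_contactFun_ne_top
    (hlow : ∀ x : ℝ≥0∞, 0 < x → ∀ L : ℝ, ∃ c : ℝ≥0∞, 0 < c ∧
      ∀ᵐ z ∂ν, z ∈ Icc (-L) L → c ≤ excSum e ν x e z)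
    (hbox : 0 < ∫⁻ z in Icc (-1) 1, e z ∂ν) {ε x : ℝ≥0∞} (hε : 0 < ε) (hε' : ε ≠ ∞)
    (hx : 0 < x) (hx1 : x ≤ 1) (hG : genFun e ν ε x ≤ 1) :
    ∃ ε₁ x₁ : ℝ≥0∞, ε < ε₁ ∧ ε₁ ≠ ∞ ∧ x ≤ x₁ ∧ x₁ ≤ 1 ∧ (x < 1 → x < x₁) ∧
      contactFun e ν ε₁ x₁ 0 ≠ ∞ := by
  have he := hK.measurable
  have hd : densBound e ≠ ∞ := hK.tsum_ne_top
  obtain ⟨v, s, r, hv, hs, hvs, hr, hrt, h⟩ := hK.exists_supersolution hν hlow hbox hε hε' hx hx1 hG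
  obtain ⟨w, hw, -, hwle⟩ := ENNReal.exists_pos_mul_le (D := 3 * ε * densBound e * s)
    (t := 2⁻¹ * r) (by finiteness) (ENNReal.mul_pos (by simp) hr.ne')
  obtain ⟨ε₁, x₁, hεε, hε2, hxx, hx₁, hxs, hpert⟩ :=
    hK.exists_smul_retSum_le hν hε hε' hx hx1 hw
  have hε₁t : ε₁ ≠ ∞ := ne_top_of_le_ne_top (by finiteness) hε2
  refine ⟨ε₁, x₁, hεε, hε₁t, hxx, hx₁, hxs,
    hK.contactFun_ne_top_of_supersolution hν hε₁t hx₁ hv hs hvs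
      (r := 2⁻¹ * r) (ENNReal.mul_pos (by simp) hr.ne') (by finiteness) fun a => ?_⟩
  have hR := isPosOp_retSum he ν x
  have hR₁ := isPosOp_retSum he ν x₁
  have hRv := hR.measurable hv
  set g := ε₁ • retSum e ν x₁ v with hg
  have hgs : ∀ y, g y ≤ 2 * ε * (densBound e * s) := fun y =>
    mul_le_mul' hε2 (hK.retSum_le hν hx₁ hvs y)
  have hgle : g ≤ ε • retSum e ν x v + (w * s) • 1 := fun y => by
    simpa [hg] using hpert v s hvs y
  have h1 : ε₁ * retSum e ν x₁ (retSum e ν x₁ v) a = retSum e ν x₁ g a := by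
    rw [hg, hR₁.smul ε₁ (hR₁.measurable hv)]
    rfl
  have h2 : retSum e ν x g a ≤ ε * retSum e ν x (retSum e ν x v) a + w * s * densBound e := by
    refine (hR.mono hgle a).trans ?_
    rw [hR.add (hRv.const_smul ε) (measurable_one.const_smul _), hR.smul ε hRv,
      hR.smul _ measurable_one]
    simp only [Pi.add_apply, Pi.smul_apply, smul_eq_mul]
    gcongr
    simpa using hK.retSum_le hν hx1 (h := 1) (s := 1) (fun _ => le_rfl) a
  rw [h1]
  calc 2⁻¹ * r + ε₁ * retSum e ν x₁ g a
      ≤ 2⁻¹ * r + (ε * (ε * retSum e ν x (retSum e ν x v) a + w * s * densBound e) +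
        w * (2 * ε * (densBound e * s))) := by
        gcongr
        refine (hpert g _ hgs a).trans ?_
        gcongr
    _ = 2⁻¹ * r + 3 * ε * densBound e * s * w +
        ε * (ε * retSum e ν x (retSum e ν x v) a) := by ring
    _ ≤ 2⁻¹ * r + 2⁻¹ * r + ε * (ε * retSum e ν x (retSum e ν x v) a) := by gcongr
    _ = r + ε * (ε * retSum e ν x (retSum e ν x v) a) := by
        rw [← add_mul, ENNReal.inv_two_add_inv_two, one_mul]
    _ ≤ v a := h a

end IsKernel

/-- The formal multilinear series in two real variables with Taylor coefficients `d k n`. -/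
def biSeries (d : ℕ → ℕ → ℝ≥0∞) : FormalMultilinearSeries ℝ (ℝ × ℝ) ℝ := fun m =>
  ∑ p ∈ Finset.HasAntidiagonal.antidiagonal m, (d p.1 p.2).toReal •
    (ContinuousMultilinearMap.mkPiAlgebra ℝ (Fin m) ℝ).compContinuousLinearMap
      fun i => if (i : ℕ) < p.1 then ContinuousLinearMap.fst ℝ ℝ ℝ
        else ContinuousLinearMap.snd ℝ ℝ ℝ

theorem biSeries_apply (d : ℕ → ℕ → ℝ≥0∞) (m : ℕ) (y : ℝ × ℝ) :
    (biSeries d m fun _ => y) = ∑ p ∈ Finset.HasAntidiagonal.antidiagonal m,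
      (d p.1 p.2).toReal * (y.1 ^ p.1 * y.2 ^ p.2) := by
  simp only [biSeries, sum_apply, smul_apply,
    ContinuousMultilinearMap.compContinuousLinearMap_apply,
    ContinuousMultilinearMap.mkPiAlgebra_apply, smul_eq_mul]
  refine Finset.sum_congr rfl fun p hp => ?_
  rw [Finset.HasAntidiagonal.mem_antidiagonal] at hp
  congr 1
  have h1 : ∀ i : Fin m, (if (i : ℕ) < p.1 then ContinuousLinearMap.fst ℝ ℝ ℝ
      else ContinuousLinearMap.snd ℝ ℝ ℝ) y = if (i : ℕ) < p.1 then y.1 else y.2 := by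
    intro i
    split_ifs <;> rfl
  simp only [h1]
  rw [Fin.prod_univ_eq_prod_range (fun i => if i < p.1 then y.1 else y.2) m, ← hp,
    Finset.prod_range_add]
  congr 1
  · rw [Finset.prod_congr rfl fun i hi => if_pos (Finset.mem_range.1 hi)]
    simp
  · simp

theorem norm_biSeries_le (d : ℕ → ℕ → ℝ≥0∞) (m : ℕ) :
    ‖biSeries d m‖ ≤
      ∑ p ∈ Finset.HasAntidiagonal.antidiagonal m, (d p.1 p.2).toReal := by
  refine (norm_sum_le _ _).trans (Finset.sum_le_sum fun p _ => ?_)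
  rw [norm_smul, Real.norm_of_nonneg ENNReal.toReal_nonneg]
  refine mul_le_of_le_one_right ENNReal.toReal_nonneg
    ((ContinuousMultilinearMap.norm_compContinuousLinearMap_le _ _).trans ?_)
  rw [ContinuousMultilinearMap.norm_mkPiAlgebra, one_mul]
  refine Finset.prod_le_one (fun _ _ => norm_nonneg _) fun i _ => ?_
  split_ifs
  · exact ContinuousLinearMap.norm_fst_le ..
  · exact ContinuousLinearMap.norm_snd_le ..

theorem tsum_tsum_eq_tsum_antidiagonal (f : ℕ → ℕ → ℝ≥0∞) :
    ∑' k, ∑' n, f k n = ∑' m, ∑ p ∈ Finset.HasAntidiagonal.antidiagonal m, f p.1 p.2 := by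
  rw [← ENNReal.tsum_prod, ← Finset.HasAntidiagonal.sigmaAntidiagonalEquivProd.tsum_eq,
    ENNReal.tsum_sigma']
  congr 1
  funext m
  simp only [Finset.HasAntidiagonal.sigmaAntidiagonalEquivProd_apply]
  exact Finset.tsum_subtype _ (fun p : ℕ × ℕ => f p.1 p.2)

theorem exists_analytic_tsum_tsum (d : ℕ → ℕ → ℝ≥0∞) (hd : ∑' k, ∑' n, d k n ≠ ∞) :
    ∃ Φ : ℝ × ℝ → ℝ, AnalyticOnNhd ℝ Φ (Metric.ball 0 1) ∧
      ∀ s t : ℝ, 0 ≤ s → s < 1 → 0 ≤ t → t < 1 →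
        0 ≤ Φ (s, t) ∧ ENNReal.ofReal (Φ (s, t)) =
          ∑' k, ∑' n, ENNReal.ofReal s ^ k * ENNReal.ofReal t ^ n * d k n := by
  have hdk : ∀ k n, d k n ≠ ∞ := fun k n =>
    ENNReal.ne_top_of_tsum_ne_top (ENNReal.ne_top_of_tsum_ne_top hd k) n
  rw [tsum_tsum_eq_tsum_antidiagonal] at hd
  have hrad : (1 : ℝ≥0∞) ≤ (biSeries d).radius := by
    refine (biSeries d).le_radius_of_bound (r := 1)
      (∑' m, ∑ p ∈ Finset.HasAntidiagonal.antidiagonal m, d p.1 p.2).toReal fun m => ?_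
    rw [NNReal.coe_one, one_pow, mul_one]
    refine (norm_biSeries_le d m).trans ?_
    rw [← ENNReal.toReal_sum fun p _ => hdk _ _]
    exact ENNReal.toReal_mono hd (ENNReal.le_tsum m)
  refine ⟨(biSeries d).sum, fun y hy => ?_, fun s t hs hs1 ht ht1 => ?_⟩
  · refine ((biSeries d).hasFPowerSeriesOnBall (one_pos.trans_le hrad)).analyticAt_of_mem ?_
    refine Metric.eball_subset_eball hrad ?_
    simpa [← ENNReal.ofReal_one, Metric.eball_ofReal] using hy
  · have hft : ∀ m, ∑ p ∈ Finset.HasAntidiagonal.antidiagonal m,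
        ENNReal.ofReal s ^ p.1 * ENNReal.ofReal t ^ p.2 * d p.1 p.2 ≠ ∞ := fun m =>
      ENNReal.sum_ne_top.2 fun p _ => ENNReal.mul_ne_top (by finiteness) (hdk _ _)
    have hle : ∑' m, ∑ p ∈ Finset.HasAntidiagonal.antidiagonal m,
        ENNReal.ofReal s ^ p.1 * ENNReal.ofReal t ^ p.2 * d p.1 p.2 ≠ ∞ := by
      refine ne_top_of_le_ne_top hd (ENNReal.tsum_le_tsum fun m => Finset.sum_le_sum fun p _ => ?_)
      refine mul_le_of_le_one_left zero_le (mul_le_one' (pow_le_one₀ zero_le ?_)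
        (pow_le_one₀ zero_le ?_))
      · exact ENNReal.ofReal_le_one.2 hs1.le
      · exact ENNReal.ofReal_le_one.2 ht1.le
    rw [tsum_tsum_eq_tsum_antidiagonal
      (fun k n => ENNReal.ofReal s ^ k * ENNReal.ofReal t ^ n * d k n)]
    suffices h : (biSeries d).sum (s, t) = (∑' m, ∑ p ∈ Finset.HasAntidiagonal.antidiagonal m,
        ENNReal.ofReal s ^ p.1 * ENNReal.ofReal t ^ p.2 * d p.1 p.2).toReal by
      rw [h]
      exact ⟨ENNReal.toReal_nonneg, ENNReal.ofReal_toReal hle⟩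
    rw [ENNReal.tsum_toReal_eq hft]
    refine tsum_congr fun m => ?_
    rw [biSeries_apply, ENNReal.toReal_sum fun p _ => ENNReal.mul_ne_top (by finiteness) (hdk _ _)]
    refine Finset.sum_congr rfl fun p _ => ?_
    simp only [ENNReal.toReal_mul, ENNReal.toReal_pow, ENNReal.toReal_ofReal hs,
      ENNReal.toReal_ofReal ht]
    ring

/-- The function `ε x ∑ ε ^ k x ^ (2 k + n) c k n`. -/
def biGen (c : ℕ → ℕ → ℝ≥0∞) (ε x : ℝ≥0∞) : ℝ≥0∞ :=
  ε * x * ∑' k, ∑' n, ε ^ k * x ^ (2 * k + n) * c k n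

theorem exists_analytic_biGen {c : ℕ → ℕ → ℝ≥0∞} {ε₁ x₁ : ℝ} (hε₁ : 0 < ε₁) (hx₁ : 0 < x₁)
    (h : biGen c (ENNReal.ofReal ε₁) (ENNReal.ofReal x₁) ≠ ∞) :
    ∃ g : ℝ × ℝ → ℝ, AnalyticOnNhd ℝ g (Ioo 0 ε₁ ×ˢ Ioo 0 x₁) ∧
      ∀ ε ∈ Ioo 0 ε₁, ∀ x ∈ Ioo 0 x₁, 0 ≤ g (ε, x) ∧
        biGen c (ENNReal.ofReal ε) (ENNReal.ofReal x) = ENNReal.ofReal (g (ε, x)) := by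
  have hsum : ∑' k, ∑' n, ENNReal.ofReal ε₁ ^ k * ENNReal.ofReal x₁ ^ (2 * k + n) * c k n ≠ ∞ := by
    intro hh
    rw [biGen, hh, ENNReal.mul_top] at h
    · exact h rfl
    · simp [hε₁, hx₁]
  obtain ⟨Φ, hΦ, hΦe⟩ := exists_analytic_tsum_tsum _ hsum
  have hmem : ∀ ε ∈ Ioo 0 ε₁, ∀ x ∈ Ioo 0 x₁, 0 ≤ ε * x ^ 2 / (ε₁ * x₁ ^ 2) ∧
      ε * x ^ 2 / (ε₁ * x₁ ^ 2) < 1 ∧ 0 ≤ x / x₁ ∧ x / x₁ < 1 := by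
    rintro ε ⟨h0, h1⟩ x ⟨h2, h3⟩
    refine ⟨by positivity, ?_, by positivity, (div_lt_one hx₁).2 h3⟩
    rw [div_lt_one (by positivity)]
    gcongr
  refine ⟨fun p => p.1 * p.2 * Φ (p.1 * p.2 ^ 2 / (ε₁ * x₁ ^ 2), p.2 / x₁), ?_, ?_⟩
  · rintro ⟨ε, x⟩ ⟨hε, hx⟩
    obtain ⟨h1, h2, h3, h4⟩ := hmem ε hε x hx
    have hball : (ε * x ^ 2 / (ε₁ * x₁ ^ 2), x / x₁) ∈ Metric.ball (0 : ℝ × ℝ) 1 := by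
      rw [mem_ball_zero_iff, Prod.norm_def, max_lt_iff, Real.norm_of_nonneg h1,
        Real.norm_of_nonneg h3]
      exact ⟨h2, h4⟩
    have hin : AnalyticAt ℝ
        (fun p : ℝ × ℝ => (p.1 * p.2 ^ 2 / (ε₁ * x₁ ^ 2), p.2 / x₁)) (ε, x) := by
      simp only [div_eq_mul_inv]
      exact ((analyticAt_fst.mul (analyticAt_snd.pow 2)).mul analyticAt_const).prod
        (analyticAt_snd.mul analyticAt_const)
    exact (analyticAt_fst.mul analyticAt_snd).mul
      (AnalyticAt.comp (g := Φ) (hΦ _ hball) hin)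
  · intro ε hε x hx
    obtain ⟨h1, h2, h3, h4⟩ := hmem ε hε x hx
    obtain ⟨h5, h6⟩ := hΦe _ _ h1 h2 h3 h4
    have hε0 := hε.1
    have hx0 := hx.1
    refine ⟨by positivity, ?_⟩
    rw [ENNReal.ofReal_mul (by positivity), ENNReal.ofReal_mul hε0.le, h6, biGen]
    congr 1
    refine tsum_congr fun k => tsum_congr fun n => ?_
    rw [← mul_assoc]
    congr 1
    simp only [← ENNReal.ofReal_pow hε0.le, ← ENNReal.ofReal_pow hx0.le,
      ← ENNReal.ofReal_pow hε₁.le, ← ENNReal.ofReal_pow hx₁.le,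
      ← ENNReal.ofReal_pow h1, ← ENNReal.ofReal_pow h3]
    rw [← ENNReal.ofReal_mul (by positivity), ← ENNReal.ofReal_mul (by positivity),
      ← ENNReal.ofReal_mul (by positivity), ← ENNReal.ofReal_mul (by positivity)]
    congr 1
    rw [div_pow, div_pow, mul_pow, mul_pow, ← pow_mul, ← pow_mul, pow_add, pow_add]
    field_simp

theorem biGen_mono {c c' : ℕ → ℕ → ℝ≥0∞} (hc : ∀ k n, c k n ≤ c' k n) {ε ε' x x' : ℝ≥0∞}
    (hε : ε ≤ ε') (hx : x ≤ x') : biGen c ε x ≤ biGen c' ε' x' := by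
  unfold biGen
  gcongr with k n
  exact hc k n

theorem biGen_mul_right_le (c : ℕ → ℕ → ℝ≥0∞) (ε x : ℝ≥0∞) {t : ℝ≥0∞} (ht : t ≤ 1) :
    biGen c ε (t * x) ≤ t * biGen c ε x := by
  have h : t * x ≤ x := mul_le_of_le_one_left zero_le ht
  calc biGen c ε (t * x)
      ≤ ε * (t * x) * ∑' k, ∑' n, ε ^ k * x ^ (2 * k + n) * c k n := by
        unfold biGen
        gcongr
    _ = t * biGen c ε x := by rw [biGen]; ring

theorem biGen_mul_left_le (c : ℕ → ℕ → ℝ≥0∞) (ε x : ℝ≥0∞) {t : ℝ≥0∞} (ht : t ≤ 1) :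
    biGen c (t * ε) x ≤ t * biGen c ε x := by
  have h : t * ε ≤ ε := mul_le_of_le_one_left zero_le ht
  calc biGen c (t * ε) x
      ≤ t * ε * x * ∑' k, ∑' n, ε ^ k * x ^ (2 * k + n) * c k n := by
        unfold biGen
        gcongr
    _ = t * biGen c ε x := by rw [biGen]; ring

theorem mul_le_biGen (c : ℕ → ℕ → ℝ≥0∞) (ε x : ℝ≥0∞) : ε * x * c 0 0 ≤ biGen c ε x := by
  unfold biGen
  gcongr
  have h1 := ENNReal.le_tsum (f := fun k => ∑' n, ε ^ k * x ^ (2 * k + n) * c k n) 0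
  have h2 := ENNReal.le_tsum (f := fun n => ε ^ (0 : ℕ) * x ^ (2 * 0 + n) * c 0 n) 0
  refine le_trans ?_ (h2.trans h1)
  simp

theorem biGen_eq_tsum (c : ℕ → ℕ → ℝ≥0∞) (ε x : ℝ≥0∞) :
    biGen c ε x = ∑' k, ∑' n, ε ^ (k + 1) * x ^ (2 * k + n + 1) * c k n := by
  simp only [biGen, ← ENNReal.tsum_mul_left]
  refine tsum_congr fun k => tsum_congr fun n => ?_
  ring

theorem lowerSemicontinuous_biGen {c : ℕ → ℕ → ℝ≥0∞} (hc : ∀ k n, c k n ≠ ∞) :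
    LowerSemicontinuous fun p : ℝ × ℝ => biGen c (ENNReal.ofReal p.1) (ENNReal.ofReal p.2) := by
  simp only [biGen_eq_tsum]
  refine lowerSemicontinuous_tsum fun k => lowerSemicontinuous_tsum fun n =>
    Continuous.lowerSemicontinuous ?_
  refine (ENNReal.continuous_mul_const (hc k n)).comp ?_
  rw [continuous_iff_continuousAt]
  intro p
  refine ENNReal.Tendsto.mul ?_ (Or.inr (by finiteness)) ?_ (Or.inr (by finiteness))
  · exact ENNReal.Tendsto.pow (ENNReal.continuous_ofReal.comp continuous_fst).continuousAt
  · exact ENNReal.Tendsto.pow (ENNReal.continuous_ofReal.comp continuous_snd).continuousAt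

theorem ofReal_div_le_biGen {c : ℕ → ℕ → ℝ≥0∞} {ε : ℝ≥0∞} {x y : ℝ} (hx : 0 < x) (hxy : x < y)
    (h : 1 ≤ biGen c ε (ENNReal.ofReal x)) :
    ENNReal.ofReal (y / x) ≤ biGen c ε (ENNReal.ofReal y) := by
  have hy : 0 < y := hx.trans hxy
  have h1 := biGen_mul_right_le c ε (ENNReal.ofReal y) (t := ENNReal.ofReal (x / y))
    (ENNReal.ofReal_le_one.2 ((div_le_one hy).2 hxy.le))
  rw [← ENNReal.ofReal_mul (by positivity), div_mul_cancel₀ _ hy.ne'] at h1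
  calc ENNReal.ofReal (y / x) = ENNReal.ofReal (y / x) * 1 := (mul_one _).symm
    _ ≤ ENNReal.ofReal (y / x) * (ENNReal.ofReal (x / y) * biGen c ε (ENNReal.ofReal y)) := by
        gcongr
        exact h.trans h1
    _ = biGen c ε (ENNReal.ofReal y) := by
        rw [← mul_assoc, ← ENNReal.ofReal_mul (by positivity),
          show y / x * (x / y) = 1 by field_simp, ENNReal.ofReal_one, one_mul]

theorem analyticAt_of_biGen {c : ℕ → ℕ → ℝ≥0∞} {f : ℝ → ℝ} (hf0 : ∀ ε, 0 < ε → 0 ≤ f ε)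
    (hf : ∀ ε, 0 < ε → ∀ x, 0 < x → x ≤ 1 →
      (biGen c (ENNReal.ofReal ε) (ENNReal.ofReal x) ≤ 1 ↔ x ≤ Real.exp (-f ε)))
    (hA : ∀ ε x : ℝ, 0 < ε → 0 < x → x < 1 →
      biGen c (ENNReal.ofReal ε) (ENNReal.ofReal x) ≤ 1 → ∃ ε₁ x₁ : ℝ, ε < ε₁ ∧ x < x₁ ∧
        biGen c (ENNReal.ofReal ε₁) (ENNReal.ofReal x₁) ≠ ∞)
    {ε : ℝ} (hε : 0 < ε) (hfε : 0 < f ε) : AnalyticAt ℝ f ε := by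
  set x := Real.exp (-f ε) with hx
  have hx0 : 0 < x := Real.exp_pos _
  have hx1 : x < 1 := Real.exp_lt_one_iff.2 (by linarith)
  have hG : biGen c (ENNReal.ofReal ε) (ENNReal.ofReal x) ≤ 1 := (hf ε hε x hx0 hx1.le).2 le_rfl
  obtain ⟨ε₁, x₁, hεε, hxx, hfin⟩ := hA ε x hε hx0 hx1 hG
  obtain ⟨g, hg, hgG⟩ := exists_analytic_biGen (hε.trans hεε) (hx0.trans hxx) hfin
  have hεI : ε ∈ Ioo 0 ε₁ := ⟨hε, hεε⟩
  have hxI : x ∈ Ioo 0 x₁ := ⟨hx0, hxx⟩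
  have hgx : AnalyticAt ℝ g (ε, x) := hg _ ⟨hεI, hxI⟩
  have hcont : ContinuousAt (fun y => g (ε, y)) x :=
    ContinuousAt.comp (f := fun y => (ε, y)) hgx.continuousAt (by fun_prop)
  have hg1 : g (ε, x) = 1 := by
    refine le_antisymm ?_ ?_
    · rw [(hgG ε hεI x hxI).2] at hG
      exact ENNReal.ofReal_le_one.1 hG
    · by_contra! hlt
      have h1 : ∀ᶠ y in 𝓝[>] x, g (ε, y) < 1 :=
        (hcont.eventually_lt_const hlt).filter_mono nhdsWithin_le_nhds
      have h2 : ∀ᶠ y in 𝓝[>] x, y ∈ Ioo x (min x₁ 1) := Ioo_mem_nhdsGT (lt_min hxx hx1)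
      obtain ⟨y, hy1, hy2, hy3⟩ := (h1.and h2).exists
      have hy0 : 0 < y := hx0.trans hy2
      have h3 := (hf ε hε y hy0 (hy3.trans_le (min_le_right _ _)).le).1 (by
        rw [(hgG ε hεI y ⟨hy0, hy3.trans_le (min_le_left _ _)⟩).2]
        exact ENNReal.ofReal_le_one.2 hy1.le)
      exact absurd h3 (not_le.2 hy2)
  have hfd := hgx.differentiableAt.hasFDerivAt
  set D := fderiv ℝ g (ε, x) with hD
  have hline : HasDerivAt (fun y => g (ε, y)) (D (0, 1)) x :=
    HasFDerivAt.comp_hasDerivAt (f := fun y => (ε, y)) x hfd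
      ((hasDerivAt_const x ε).prodMk (hasDerivAt_id x))
  have hDpos : 0 < D (0, 1) := by
    have h1 := hline.tendsto_slope
    refine (inv_pos.2 hx0).trans_le
      (ge_of_tendsto (h1.mono_left (nhdsWithin_mono x (s := Ioi x) fun y hy => ne_of_gt hy)) ?_)
    filter_upwards [Ioo_mem_nhdsGT hxx] with y hy
    have hy0 : 0 < y := hx0.trans hy.1
    obtain ⟨h2, h3⟩ := hgG ε hεI y ⟨hy0, hy.2⟩
    have h4 := ofReal_div_le_biGen (c := c) (ε := ENNReal.ofReal ε) hx0 hy.1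
      (by rw [(hgG ε hεI x hxI).2, hg1, ENNReal.ofReal_one])
    rw [h3, ENNReal.ofReal_le_ofReal_iff h2] at h4
    rw [slope_def_field, hg1, le_div_iff₀ (sub_pos.2 hy.1)]
    calc x⁻¹ * (y - x) = y / x - 1 := by field_simp
      _ ≤ _ := by linarith
  have hinv : (D ∘L ContinuousLinearMap.inr ℝ ℝ ℝ).IsInvertible := by
    refine ⟨ContinuousLinearEquiv.unitsEquivAut ℝ (Units.mk0 (D (0, 1)) hDpos.ne'), ?_⟩
    ext
    simp
  have hcd : ContDiffAt ℝ ⊤ g (ε, x) := hgx.contDiffAt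
  set ψ := hcd.implicitFunction (by simp) hinv with hψ
  have hψx : ψ ε = x := hcd.implicitFunction_apply_self (by simp) hinv
  have hψa : AnalyticAt ℝ ψ ε :=
    (hcd.contDiffAt_implicitFunction (by simp) hinv).analyticAt
  have hψ1 : ∀ᶠ y in 𝓝 ε, g (y, ψ y) = g (ε, x) :=
    hcd.eventually_apply_implicitFunction (by simp) hinv
  have hψI : ∀ᶠ y in 𝓝 ε, ψ y ∈ Ioo 0 (min x₁ 1) := by
    refine hψa.continuousAt.eventually_mem (Ioo_mem_nhds ?_ ?_)
    · rwa [hψx]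
    · rw [hψx]
      exact lt_min hxx hx1
  have heq : (fun y => -Real.log (ψ y)) =ᶠ[𝓝 ε] f := by
    filter_upwards [hψ1, hψI, Ioo_mem_nhds hε hεε] with y hy hyI hyε
    have hψ0 : 0 < ψ y := hyI.1
    have hψ1 : ψ y < 1 := hyI.2.trans_le (min_le_right _ _)
    have hGy : biGen c (ENNReal.ofReal y) (ENNReal.ofReal (ψ y)) = 1 := by
      rw [(hgG y hyε _ ⟨hψ0, hyI.2.trans_le (min_le_left _ _)⟩).2, hy, hg1, ENNReal.ofReal_one]
    have hle := (hf y hyε.1 _ hψ0 hψ1.le).1 hGy.le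
    have hge : Real.exp (-f y) ≤ ψ y := by
      by_contra! hlt
      have h1 := ofReal_div_le_biGen hψ0 hlt hGy.ge
      have h2 := (hf y hyε.1 (Real.exp (-f y)) (Real.exp_pos _)
        (Real.exp_le_one_iff.2 (by linarith [hf0 y hyε.1]))).2 le_rfl
      have h3 := ENNReal.ofReal_le_one.1 (h1.trans h2)
      rw [div_le_one hψ0] at h3
      linarith
    rw [le_antisymm hle hge, Real.log_exp, neg_neg]
  refine AnalyticAt.congr ?_ heq
  exact (hψa.log (by rw [hψx]; exact hx0)).neg

theorem tendsto_div_log_of_bounds {f : ℝ → ℝ} {a M : ℝ} (ha : 0 < a) (hM : 0 < M)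
    (h1 : ∀ ε, 0 < ε → Real.log (ε * a) ≤ f ε) (h2 : ∀ ε, 0 < ε → f ε ≤ Real.log (1 + ε * M)) :
    Tendsto (fun ε => f ε / Real.log ε) atTop (𝓝 1) := by
  have hlim : ∀ b : ℝ, Tendsto (fun ε => 1 + b / Real.log ε) atTop (𝓝 1) := fun b => by
    simpa using (Real.tendsto_log_atTop.const_div_atTop b).const_add 1
  refine tendsto_of_tendsto_of_tendsto_of_le_of_le' (hlim (Real.log a)) (hlim (Real.log (1 + M)))
    ?_ ?_
  · filter_upwards [eventually_gt_atTop 1] with ε hε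
    have hl := Real.log_pos hε
    have hε0 : 0 < ε := by linarith
    rw [le_div_iff₀ hl, add_mul, one_mul, div_mul_cancel₀ _ hl.ne',
      ← Real.log_mul hε0.ne' ha.ne']
    exact h1 ε hε0
  · filter_upwards [eventually_gt_atTop 1] with ε hε
    have hl := Real.log_pos hε
    have hε0 : 0 < ε := by linarith
    rw [div_le_iff₀ hl, add_mul, one_mul, div_mul_cancel₀ _ hl.ne',
      ← Real.log_mul hε0.ne' (by positivity)]
    refine (h2 ε hε0).trans (Real.log_le_log (by positivity) ?_)
    nlinarith

/-- A free energy `F` determined by the generating function with coefficients `c`. -/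
structure IsRate (c : ℕ → ℕ → ℝ≥0∞) (a M : ℝ) (F : ℝ → EReal) : Prop where
  coeff_zero : c 0 0 = ENNReal.ofReal a
  pos : 0 < a
  bound_pos : 0 < M
  nonneg : ∀ ε, 0 ≤ ε → 0 ≤ F ε
  le_log : ∀ ε, 0 ≤ ε → F ε ≤ (Real.log (1 + ε * M) : ℝ)
  lt_one : ∀ ε, 0 < ε → ∀ f : ℝ, F ε = f → ∀ x, 0 < x → x < Real.exp (-f) →
    biGen c (ENNReal.ofReal ε) (ENNReal.ofReal x) < 1
  le_neg_log : ∀ ε, 0 < ε → ∀ x, 0 < x → x ≤ 1 →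
    biGen c (ENNReal.ofReal ε) (ENNReal.ofReal x) < 1 → F ε ≤ (-Real.log x : ℝ)
  ne_top : ∃ ε, 0 < ε ∧ biGen c (ENNReal.ofReal ε) 1 ≠ ∞

namespace IsRate

variable {c : ℕ → ℕ → ℝ≥0∞} {a M : ℝ} {F : ℝ → EReal} (h : IsRate c a M F)
include h

theorem coe_toReal {ε : ℝ} (hε : 0 ≤ ε) : ((F ε).toReal : EReal) = F ε :=
  EReal.coe_toReal (ne_top_of_le_ne_top (EReal.coe_ne_top _) (h.le_log ε hε))
    (ne_of_gt (lt_of_lt_of_le (by simp) (h.nonneg ε hε)))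

theorem toReal_nonneg {ε : ℝ} (hε : 0 ≤ ε) : 0 ≤ (F ε).toReal :=
  EReal.toReal_nonneg (h.nonneg ε hε)

theorem coeff_ne_top (k n : ℕ) : c k n ≠ ∞ := by
  obtain ⟨ε, hε, hfin⟩ := h.ne_top
  rw [biGen_eq_tsum] at hfin
  have h1 := ENNReal.ne_top_of_tsum_ne_top (ENNReal.ne_top_of_tsum_ne_top hfin k) n
  intro hc
  rw [hc, one_pow, mul_one, ENNReal.mul_top (by simpa using hε)] at h1
  exact h1 rfl

theorem biGen_le_one_iff {ε : ℝ} (hε : 0 < ε) {x : ℝ} (hx : 0 < x) (hx1 : x ≤ 1) :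
    biGen c (ENNReal.ofReal ε) (ENNReal.ofReal x) ≤ 1 ↔ x ≤ Real.exp (-(F ε).toReal) := by
  constructor
  · intro hG
    refine le_of_forall_lt_imp_le_of_dense fun y hy => ?_
    rcases le_or_gt y 0 with hy0 | hy0
    · exact hy0.trans (Real.exp_pos _).le
    have h1 : biGen c (ENNReal.ofReal ε) (ENNReal.ofReal y) < 1 := by
      by_contra! hge
      have h2 := ENNReal.ofReal_le_one.1 ((ofReal_div_le_biGen hy0 hy hge).trans hG)
      rw [div_le_one hy0] at h2
      linarith
    have h3 := h.le_neg_log ε hε y hy0 (hy.le.trans hx1) h1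
    rw [← h.coe_toReal hε.le, EReal.coe_le_coe_iff] at h3
    rw [← Real.log_le_iff_le_exp hy0]
    linarith
  · intro hxF
    by_contra! hgt
    have hlsc := ((lowerSemicontinuous_biGen h.coeff_ne_top).comp
      (g := fun y : ℝ => (ε, y)) (by fun_prop)) x 1 hgt
    have h1 : ∀ᶠ y in 𝓝[<] x, 1 < biGen c (ENNReal.ofReal ε) (ENNReal.ofReal y) :=
      hlsc.filter_mono nhdsWithin_le_nhds
    obtain ⟨y, hy, hy0, hyx⟩ := (h1.and (Ioo_mem_nhdsLT hx)).exists
    exact lt_asymm hy (h.lt_one ε hε _ (h.coe_toReal hε.le).symm y hy0 (hyx.trans_le hxF))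

theorem eq_zero_iff {ε : ℝ} (hε : 0 < ε) : F ε = 0 ↔ biGen c (ENNReal.ofReal ε) 1 ≤ 1 := by
  have h1 := h.biGen_le_one_iff hε one_pos le_rfl
  rw [ENNReal.ofReal_one] at h1
  rw [h1, Real.one_le_exp_iff, ← h.coe_toReal hε.le, EReal.coe_eq_zero, EReal.toReal_coe]
  constructor
  · intro h2
    rw [h2, neg_zero]
  · intro h2
    linarith [h.toReal_nonneg hε.le]

theorem log_le {ε : ℝ} (hε : 0 < ε) : Real.log (ε * a) ≤ (F ε).toReal := by
  have ha := h.pos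
  have h1 := (h.biGen_le_one_iff hε (Real.exp_pos (-(F ε).toReal))
    (Real.exp_le_one_iff.2 (by linarith [h.toReal_nonneg hε.le]))).2 le_rfl
  have h2 := (mul_le_biGen c _ _).trans h1
  rw [h.coeff_zero, ← ENNReal.ofReal_mul hε.le, ← ENNReal.ofReal_mul (by positivity),
    ENNReal.ofReal_le_one, Real.exp_neg] at h2
  rw [Real.log_le_iff_le_exp (by positivity)]
  field_simp at h2
  linarith

theorem tendsto_div_log : Tendsto (fun ε => (F ε).toReal / Real.log ε) atTop (𝓝 1) := by
  refine tendsto_div_log_of_bounds h.pos h.bound_pos (fun ε hε => h.log_le hε) fun ε hε => ?_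
  have := h.le_log ε hε.le
  rwa [← h.coe_toReal hε.le, EReal.coe_le_coe_iff] at this

theorem bddAbove : BddAbove {ε : ℝ | 0 < ε ∧ F ε = 0} := by
  refine ⟨a⁻¹, fun ε hε => ?_⟩
  have ha := h.pos
  have h1 := (mul_le_biGen c _ _).trans ((h.eq_zero_iff hε.1).1 hε.2)
  rw [h.coeff_zero, mul_one, ← ENNReal.ofReal_mul hε.1.le, ENNReal.ofReal_le_one] at h1
  rwa [← one_div, le_div_iff₀ ha]

theorem eq_zero_of_le {ε ε' : ℝ} (hε : 0 < ε) (hle : ε ≤ ε') (h0 : F ε' = 0) : F ε = 0 := by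
  rw [h.eq_zero_iff hε]
  rw [h.eq_zero_iff (hε.trans_le hle)] at h0
  exact (biGen_mono (fun _ _ => le_rfl) (ENNReal.ofReal_le_ofReal hle) le_rfl).trans h0

theorem sSup_pos : 0 < sSup {ε : ℝ | 0 < ε ∧ F ε = 0} := by
  obtain ⟨ε, hε, hfin⟩ := h.ne_top
  obtain ⟨w, hw, hwt, hwle⟩ := ENNReal.exists_pos_mul_le hfin one_pos
  set t := min w 1 with ht
  have ht0 : 0 < t := lt_min hw one_pos
  have ht1 : t ≤ 1 := min_le_right _ _
  have htt : t ≠ ∞ := ne_top_of_le_ne_top ENNReal.one_ne_top ht1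
  have hpos : 0 < t.toReal * ε := mul_pos (ENNReal.toReal_pos ht0.ne' htt) hε
  refine hpos.trans_le (le_csSup h.bddAbove ⟨hpos, (h.eq_zero_iff hpos).2 ?_⟩)
  rw [ENNReal.ofReal_mul ENNReal.toReal_nonneg, ENNReal.ofReal_toReal htt]
  refine (biGen_mul_left_le c _ _ ht1).trans (le_trans ?_ hwle)
  rw [mul_comm]
  gcongr
  exact min_le_left _ _

theorem eq_zero_of_lt_sSup {ε : ℝ} (hε : 0 < ε) (hlt : ε < sSup {ε : ℝ | 0 < ε ∧ F ε = 0}) :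
    F ε = 0 := by
  obtain ⟨ε', hε', hlt'⟩ := exists_lt_of_lt_csSup (Set.nonempty_iff_ne_empty.2 fun he => by
    rw [he, Real.sSup_empty] at hlt
    linarith) hlt
  exact h.eq_zero_of_le hε hlt'.le hε'.2

theorem eq_zero_sSup : F (sSup {ε : ℝ | 0 < ε ∧ F ε = 0}) = 0 := by
  set εc := sSup {ε : ℝ | 0 < ε ∧ F ε = 0} with hεc
  have hpos : 0 < εc := h.sSup_pos
  rw [h.eq_zero_iff hpos]
  by_contra! hgt
  have hlsc := ((lowerSemicontinuous_biGen h.coeff_ne_top).comp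
    (g := fun y : ℝ => (y, (1 : ℝ))) (by fun_prop)) εc 1 (by simpa using hgt)
  have h1 : ∀ᶠ y in 𝓝[<] εc, 1 < biGen c (ENNReal.ofReal y) 1 := by
    simpa using hlsc.filter_mono nhdsWithin_le_nhds
  obtain ⟨y, hy, hy0, hyx⟩ := (h1.and (Ioo_mem_nhdsLT hpos)).exists
  exact absurd ((h.eq_zero_iff hy0).1 (h.eq_zero_of_lt_sSup hy0 hyx)) (not_le.2 hy)

theorem eq_zero_of_le_sSup {ε : ℝ} (hε : 0 ≤ ε) (hle : ε ≤ sSup {ε : ℝ | 0 < ε ∧ F ε = 0}) :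
    F ε = 0 := by
  rcases hε.eq_or_lt with rfl | hε
  · refine le_antisymm ?_ (h.nonneg 0 le_rfl)
    simpa using h.le_log 0 le_rfl
  · exact h.eq_zero_of_le hε hle h.eq_zero_sSup

theorem pos_of_sSup_lt {ε : ℝ} (hlt : sSup {ε : ℝ | 0 < ε ∧ F ε = 0} < ε) : 0 < F ε := by
  have hε : 0 < ε := h.sSup_pos.trans hlt
  refine lt_of_le_of_ne (h.nonneg ε hε.le) fun h0 => ?_
  exact absurd (le_csSup h.bddAbove ⟨hε, h0.symm⟩) (not_le.2 hlt)

theorem lt_top {ε : ℝ} (hε : 0 ≤ ε) : F ε < ⊤ :=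
  (h.le_log ε hε).trans_lt (EReal.coe_lt_top _)

theorem analyticOnNhd
    (hA : ∀ ε x : ℝ, 0 < ε → 0 < x → x < 1 →
      biGen c (ENNReal.ofReal ε) (ENNReal.ofReal x) ≤ 1 → ∃ ε₁ x₁ : ℝ, ε < ε₁ ∧ x < x₁ ∧
        biGen c (ENNReal.ofReal ε₁) (ENNReal.ofReal x₁) ≠ ∞) :
    AnalyticOnNhd ℝ (fun ε => (F ε).toReal) (Ioi (sSup {ε : ℝ | 0 < ε ∧ F ε = 0})) := by
  intro ε hlt
  have hε : 0 < ε := h.sSup_pos.trans hlt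
  refine analyticAt_of_biGen (fun ε hε => h.toReal_nonneg hε.le)
    (fun ε hε x hx hx1 => h.biGen_le_one_iff hε hx hx1) hA hε ?_
  have := h.pos_of_sSup_lt hlt
  rwa [← h.coe_toReal hε.le, EReal.coe_pos] at this

/-- The critical point is strictly above any point at which the generating function is below one
and beyond which it stays finite. -/
theorem lt_sSup {ε ε₁ : ℝ} (hε : 0 < ε) (hlt : biGen c (ENNReal.ofReal ε) 1 < 1) (hεε : ε < ε₁)
    (hfin : biGen c (ENNReal.ofReal ε₁) 1 ≠ ∞) : ε < sSup {ε : ℝ | 0 < ε ∧ F ε = 0} := by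
  obtain ⟨A, hA⟩ : ∃ A : ℕ → ℝ≥0∞, ∀ k, ∑' n, c k n = A k := ⟨_, fun _ => rfl⟩
  have hform : ∀ y : ℝ, biGen c (ENNReal.ofReal y) 1 =
      ∑' k, ENNReal.ofReal y ^ (k + 1) * A k := fun y => by
    simp only [biGen_eq_tsum, one_pow, mul_one, ENNReal.tsum_mul_left, hA]
  have hAt : ∀ k, A k ≠ ∞ := fun k hk => by
    have h1 := ENNReal.ne_top_of_tsum_ne_top (hform ε₁ ▸ hfin) k
    rw [hk, ENNReal.mul_top (by simpa using hε.trans hεε)] at h1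
    exact h1 rfl
  have hlim : Tendsto (fun y : ℝ => biGen c (ENNReal.ofReal y) 1) (𝓝[>] ε)
      (𝓝 (biGen c (ENNReal.ofReal ε) 1)) := by
    simp only [hform, ← lintegral_count]
    refine tendsto_lintegral_filter_of_dominated_convergence
      (fun k => ENNReal.ofReal ε₁ ^ (k + 1) * A k)
      (Eventually.of_forall fun y => measurable_from_nat) ?_ ?_ (ae_of_all _ fun k => ?_)
    · filter_upwards [Ioo_mem_nhdsGT hεε] with y hy
      refine ae_of_all _ fun k => ?_
      gcongr
      exact hy.2.le
    · rwa [lintegral_count, ← hform]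
    · refine ENNReal.Tendsto.mul_const ?_ (Or.inr (hAt k))
      exact ENNReal.Tendsto.pow
        ((ENNReal.continuous_ofReal.tendsto ε).mono_left nhdsWithin_le_nhds)
  obtain ⟨y, hy1, hy⟩ := ((hlim.eventually_lt_const hlt).and self_mem_nhdsWithin).exists
  have hy0 : 0 < y := hε.trans hy
  exact lt_of_lt_of_le hy (le_csSup h.bddAbove ⟨hy0, (h.eq_zero_iff hy0).2 hy1.le⟩)

end IsRate

theorem genFun_eq_biGen {e : ℝ → ℝ≥0∞} (he : Measurable e) (ν : Measure ℝ) [SFinite ν]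
    (ε x : ℝ≥0∞) : genFun e ν ε x = biGen (fun k n => contactCoeff e ν k n 0) ε x := by
  rw [genFun, contactFun_eq_tsum he, biGen]

theorem contactCoeff_mono_measure (e : ℝ → ℝ≥0∞) {ν μ : Measure ℝ} (h : ν ≤ μ) (k n : ℕ) :
    contactCoeff e ν k n ≤ contactCoeff e μ k n := by
  have hstep : ∀ (m : ℕ) {f g : ℝ × ℝ → ℝ≥0∞}, f ≤ g →
      (stepOp e ν)^[m] f ≤ (stepOp e μ)^[m] g := by
    intro m f g hfg
    induction m with
    | zero => exact hfg
    | succ m ih =>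
      rw [Function.iterate_succ_apply', Function.iterate_succ_apply']
      exact fun p => lintegral_mono' h fun c => mul_le_mul_right (ih _) _
  induction k generalizing n with
  | zero => exact le_rfl
  | succ k ih =>
    refine fun a => Finset.sum_le_sum fun p _ => hstep _ (fun q => ?_) _
    exact mul_le_mul_right (ih _ _) _

theorem contactCoeff_one_zero (e : ℝ → ℝ≥0∞) (ν : Measure ℝ) :
    contactCoeff e ν 1 0 0 = ∫⁻ z, e z * (e (-2 * z) * e z) ∂ν := by
  simp [contactCoeff, ret_eq_lintegral, exc, pinOp]

theorem isKernel_ofReal {E : ℝ → ℝ} {M : ℝ} (hE0 : ∀ x, 0 ≤ E x) (hEc : Continuous E)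
    (hEM : ∀ x, E x ≤ M) (hEpos : 0 < E 0) (hEi : Integrable E) (hE1 : ∫ x, E x = 1)
    (hE2 : Integrable fun x => x ^ 2 * E x) :
    IsKernel (fun y => ENNReal.ofReal (E y)) (ENNReal.ofReal M) := by
  have he : Measurable fun y => ENNReal.ofReal (E y) := hEc.measurable.ennreal_ofReal
  have heM : ∀ y, ENNReal.ofReal (E y) ≤ ENNReal.ofReal M := fun y =>
    ENNReal.ofReal_le_ofReal (hEM y)
  have he1 : ∫⁻ y, ENNReal.ofReal (E y) = 1 := by
    rw [← ofReal_integral_eq_lintegral_ofReal hEi (ae_of_all _ hE0), hE1, ENNReal.ofReal_one]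
  obtain ⟨κ, hκ, hchar⟩ := exists_norm_charFun_le hE0 hEc hEpos hEi hE1
  refine ⟨he, ENNReal.ofReal_ne_top, heM, he1,
    tsum_iSup_pathDensity_ne_top he ENNReal.ofReal_ne_top heM he1 ?_ hκ hchar⟩
  simp only [← ENNReal.ofReal_mul (sq_nonneg _)]
  exact hE2.lintegral_lt_top.ne

theorem IsKernel.contactFun_ne_top {e : ℝ → ℝ≥0∞} {M : ℝ≥0∞} (hK : IsKernel e M) {ν : Measure ℝ}
    [SFinite ν] (hν : ν ≤ volume) {ε : ℝ≥0∞} (hε : densBound e * ε ≤ 2⁻¹) :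
    contactFun e ν ε 1 0 ≠ ∞ := by
  have hle : contactFun e ν ε 1 ≤ fun _ => 2 * M := by
    refine neumann_le (isPosOp_smul_retSum hK.measurable ν ε 1) hK.measurable fun a => ?_
    have h1 := hK.retSum_le hν (x := 1) le_rfl (h := fun _ => 2 * M) (fun _ => le_rfl) a
    calc e a + ε * retSum e ν 1 (fun _ => 2 * M) a
        ≤ M + ε * (densBound e * (2 * M)) := add_le_add (hK.le a) (mul_le_mul_right h1 _)
      _ = M + densBound e * ε * (2 * M) := by ring
      _ ≤ M + 2⁻¹ * (2 * M) := by gcongr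
      _ = 2 * M := by
        rw [← mul_assoc, ENNReal.inv_mul_cancel (by simp) (by simp), one_mul, two_mul]
  exact ne_top_of_le_ne_top (ENNReal.mul_ne_top (by simp) hK.ne_top) (hle 0)

section model

variable {E : ℝ → ℝ} {M : ℝ} (hE0 : ∀ x, 0 ≤ E x) (hEc : Continuous E) (hEM : ∀ x, E x ≤ M)
  (hEpos : 0 < E 0) (hK : IsKernel (fun y => ENNReal.ofReal (E y)) (ENNReal.ofReal M))
  {ν : Measure ℝ} [SigmaFinite ν] [NullSingletonClass ν] (hν : ν ≤ volume)
include hE0 hEc hEM hEpos hK hν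

theorem isRate_of_partition {Z : ℝ → ℕ → ℝ}
    (hZ : ∀ ε N, Z ε N = ∫ φ : Fin (N - 1) → ℝ, hamWeight E N φ
      ∂(Measure.pi fun _ => ENNReal.ofReal ε • Measure.dirac 0 + ν))
    {F : ℝ → EReal} (hF0 : ∀ ε, 0 ≤ ε → 0 ≤ F ε)
    (hF : ∀ ε, 0 ≤ ε → Tendsto
      (fun N : ℕ => (((N : ℝ)⁻¹ * Real.log (Z ε N) : ℝ) : EReal)) atTop (𝓝 (F ε))) :
    IsRate (fun k n => contactCoeff (fun y => ENNReal.ofReal (E y)) ν k n 0) (E 0) M F where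
  coeff_zero := by simp [contactCoeff]
  pos := hEpos
  bound_pos := hEpos.trans_le (hEM 0)
  nonneg := hF0
  le_log ε hε := rate_le_log_one_add hE0 hEc.measurable hEM hK.lintegral_eq_one hν (hZ ε) hε
    (hF ε hε)
  lt_one ε hε f hf x hx hxf := by
    rw [← genFun_eq_biGen hK.measurable]
    exact genFun_lt_one_of_lt hE0 hEc.measurable hEM hK.lintegral_eq_one hν (hZ ε) hε
      (hf ▸ hF ε hε.le) hx hxf
  le_neg_log ε hε x hx hx1 hG := by
    rw [← genFun_eq_biGen hK.measurable] at hG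
    exact rate_le_of_genFun_lt_one hE0 hEc.measurable (hZ ε) hε (hF ε hε.le) hx hx1 hG
  ne_top := by
    obtain ⟨w, hw, hwt, hwle⟩ := ENNReal.exists_pos_mul_le
      (show densBound (fun y => ENNReal.ofReal (E y)) ≠ ∞ from hK.tsum_ne_top)
      (show (0 : ℝ≥0∞) < 2⁻¹ by simp)
    refine ⟨w.toReal, ENNReal.toReal_pos hw.ne' hwt, ?_⟩
    rw [ENNReal.ofReal_toReal hwt, ← genFun_eq_biGen hK.measurable, genFun, mul_one]
    exact ENNReal.mul_ne_top hwt (hK.contactFun_ne_top hν hwle)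

end model

section perturbation

variable {e : ℝ → ℝ≥0∞} {M : ℝ≥0∞} (hK : IsKernel e M) {ν : Measure ℝ} [SFinite ν]
  (hν : ν ≤ volume)
  (hlow : ∀ x : ℝ≥0∞, 0 < x → ∀ L : ℝ, ∃ c : ℝ≥0∞, 0 < c ∧
    ∀ᵐ z ∂ν, z ∈ Icc (-L) L → c ≤ excSum e ν x e z)
  (hbox : 0 < ∫⁻ z in Icc (-1) 1, e z ∂ν)
include hK hν hlow hbox

theorem exists_biGen_ne_top {ε x : ℝ} (hε : 0 < ε) (hx : 0 < x) (hx1 : x ≤ 1)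
    (hG : biGen (fun k n => contactCoeff e ν k n 0) (ENNReal.ofReal ε) (ENNReal.ofReal x) ≤ 1) :
    ∃ ε₁ x₁ : ℝ, ε < ε₁ ∧ x ≤ x₁ ∧ (x < 1 → x < x₁) ∧
      biGen (fun k n => contactCoeff e ν k n 0) (ENNReal.ofReal ε₁) (ENNReal.ofReal x₁) ≠ ∞ := by
  rw [← genFun_eq_biGen hK.measurable] at hG
  obtain ⟨ε₁, x₁, hεε, hε₁, hxx, hx₁, hxs, hfin⟩ := hK.exists_contactFun_ne_top hν hlow hbox
    (ENNReal.ofReal_pos.2 hε) ENNReal.ofReal_ne_top (ENNReal.ofReal_pos.2 hx)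
    (ENNReal.ofReal_le_one.2 hx1) hG
  have hx₁t : x₁ ≠ ∞ := ne_top_of_le_ne_top ENNReal.one_ne_top hx₁
  refine ⟨ε₁.toReal, x₁.toReal, (ENNReal.ofReal_lt_iff_lt_toReal hε.le hε₁).1 hεε,
    (ENNReal.ofReal_le_iff_le_toReal hx₁t).1 hxx, fun h => ?_, ?_⟩
  · exact (ENNReal.ofReal_lt_iff_lt_toReal hx.le hx₁t).1 (hxs (ENNReal.ofReal_lt_one.2 h))
  · rw [ENNReal.ofReal_toReal hε₁, ENNReal.ofReal_toReal hx₁t, ← genFun_eq_biGen hK.measurable,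
      genFun]
    exact ENNReal.mul_ne_top (ENNReal.mul_ne_top hε₁ hx₁t) hfin

end perturbation

theorem setLIntegral_pos_of_le {f : ℝ → ℝ≥0∞} {a b : ℝ} (hab : a < b) {q : ℝ≥0∞} (hq : 0 < q)
    {s : Set ℝ} (hs : Ioo a b ⊆ s) (hf : ∀ y ∈ Ioo a b, q ≤ f y) : 0 < ∫⁻ y in s, f y := by
  calc 0 < q * volume (Ioo a b) :=
        ENNReal.mul_pos hq.ne' (by simpa [Real.volume_Ioo] using hab)
    _ = ∫⁻ y in Ioo a b, q := by rw [setLIntegral_const]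
    _ ≤ ∫⁻ y in Ioo a b, f y := setLIntegral_mono' measurableSet_Ioo hf
    _ ≤ ∫⁻ y in s, f y := lintegral_mono_set hs

/-- Restricting the heights to the half-line strictly decreases the generating function. -/
theorem biGen_wetting_lt {E : ℝ → ℝ} (hEc : Continuous E) (hEpos : 0 < E 0) {ε : ℝ≥0∞}
    (hε : 0 < ε) (hε' : ε ≠ ∞)
    (hfin : biGen (fun k n => contactCoeff (fun y => ENNReal.ofReal (E y)) volume k n 0) ε 1 ≠ ∞) :
    biGen (fun k n => contactCoeff (fun y => ENNReal.ofReal (E y))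
        (volume.restrict (Ici 0)) k n 0) ε 1 <
      biGen (fun k n => contactCoeff (fun y => ENNReal.ofReal (E y)) volume k n 0) ε 1 := by
  obtain ⟨η, hη, q, hq, hqe⟩ := exists_pos_le_ofReal hEc hEpos
  have hmeas := (hEc.measurable.ennreal_ofReal)
  set e : ℝ → ℝ≥0∞ := fun y => ENNReal.ofReal (E y) with he
  have hmono := contactCoeff_mono_measure e
    (Measure.restrict_le_self (μ := (volume : Measure ℝ)) (s := Ici 0))
  have htop : ∀ k n, contactCoeff e volume k n 0 ≠ ∞ := fun k n hc => by
    rw [biGen_eq_tsum] at hfin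
    have h1 := ENNReal.ne_top_of_tsum_ne_top (ENNReal.ne_top_of_tsum_ne_top hfin k) n
    rw [hc, one_pow, mul_one, ENNReal.mul_top (pow_ne_zero _ hε.ne')] at h1
    exact h1 rfl
  have hstrict : contactCoeff e (volume.restrict (Ici 0)) 1 0 0 < contactCoeff e volume 1 0 0 := by
    have hpos : 0 < ∫⁻ z in (Ici (0 : ℝ))ᶜ, e z * (e (-2 * z) * e z) := by
      refine setLIntegral_pos_of_le (a := -η) (b := 0) (by linarith) (q := q * (q * q))
        (ENNReal.mul_pos hq.ne' (ENNReal.mul_pos hq.ne' hq.ne').ne')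
        (fun y hy => by simpa using hy.2) fun y hy => ?_
      have h1 : q ≤ e y := hqe y (by rw [abs_le]; constructor <;> linarith [hy.1, hy.2])
      have h2 : q ≤ e (-2 * y) :=
        hqe _ (by rw [abs_le]; constructor <;> linarith [hy.1, hy.2])
      gcongr
    have hsum := lintegral_add_compl (μ := volume) (fun z => e z * (e (-2 * z) * e z))
      (measurableSet_Ici (a := (0 : ℝ)))
    rw [contactCoeff_one_zero, contactCoeff_one_zero, ← hsum]
    refine ENNReal.lt_add_right ?_ hpos.ne'
    rw [← contactCoeff_one_zero]
    exact ne_top_of_le_ne_top (htop 1 0) (hmono 1 0 0)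
  rw [biGen_eq_tsum] at hfin
  rw [biGen_eq_tsum, biGen_eq_tsum]
  have hle : ∀ k n, ε ^ (k + 1) * 1 ^ (2 * k + n + 1) *
      contactCoeff e (volume.restrict (Ici 0)) k n 0 ≤
      ε ^ (k + 1) * 1 ^ (2 * k + n + 1) * contactCoeff e volume k n 0 := fun k n =>
    mul_le_mul_right (hmono k n 0) _
  have hle' := fun k => ENNReal.tsum_le_tsum (hle k)
  have hfin1 := ENNReal.ne_top_of_tsum_ne_top hfin 1
  refine ENNReal.tsum_lt_tsum (i := 1) (ne_top_of_le_ne_top hfin (ENNReal.tsum_le_tsum hle')) hle'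
    (ENNReal.tsum_lt_tsum (i := 0) (ne_top_of_le_ne_top hfin1 (hle' 1)) (hle 1) ?_)
  simp only [one_pow, mul_one]
  exact ENNReal.mul_lt_mul_right (pow_ne_zero _ hε.ne') (ENNReal.pow_ne_top hε') hstrict

/-- **Theorem 1.2** (Localization transition).  With
`ε_c^a := sup {ε > 0 : F^a(ε) = 0}`, one has `0 < ε_c^p < ε_c^w < ∞`;
`F^a(ε) = 0` on `[0, ε_c^a]`, `0 < F^a(ε) < ∞` for `ε > ε_c^a`,
`F^a(ε) = log ε (1 + o(1))` as `ε → ∞`, and `F^a` is real analytic on `(ε_c^a, ∞)`. -/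
theorem localization_transition
    (E : ℝ → ℝ) (σ : ℝ)
    (hE_nonneg : ∀ x, 0 ≤ E x) (hE_cont : Continuous E)
    (hE_bdd : ∃ M, ∀ x, E x ≤ M) (hE_pos : 0 < E 0)
    (hE_int : Integrable E) (hE_mass : ∫ x, E x = 1)
    (hE_mom1 : Integrable fun x => x * E x) (hE_mean : ∫ x, x * E x = 0)
    (hE_mom2 : Integrable fun x => x ^ 2 * E x) (hE_var : ∫ x, x ^ 2 * E x = σ ^ 2)
    (hσ : 0 < σ)
    (Fp Fw : ℝ → EReal)
    (hFp_nonneg : ∀ ε : ℝ, 0 ≤ ε → 0 ≤ Fp ε) (hFw_nonneg : ∀ ε : ℝ, 0 ≤ ε → 0 ≤ Fw ε)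
    (hFp : ∀ ε : ℝ, 0 ≤ ε → Tendsto
      (fun N : ℕ => (((N : ℝ)⁻¹ * Real.log (Zpin E ε N) : ℝ) : EReal)) atTop (𝓝 (Fp ε)))
    (hFw : ∀ ε : ℝ, 0 ≤ ε → Tendsto
      (fun N : ℕ => (((N : ℝ)⁻¹ * Real.log (Zwet E ε N) : ℝ) : EReal)) atTop (𝓝 (Fw ε))) :
    0 < sSup {ε : ℝ | 0 < ε ∧ Fp ε = 0} ∧
    sSup {ε : ℝ | 0 < ε ∧ Fp ε = 0} < sSup {ε : ℝ | 0 < ε ∧ Fw ε = 0} ∧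
    (∀ ε : ℝ, 0 ≤ ε → ε ≤ sSup {ε : ℝ | 0 < ε ∧ Fp ε = 0} → Fp ε = 0) ∧
    (∀ ε : ℝ, 0 ≤ ε → ε ≤ sSup {ε : ℝ | 0 < ε ∧ Fw ε = 0} → Fw ε = 0) ∧
    (∀ ε : ℝ, sSup {ε : ℝ | 0 < ε ∧ Fp ε = 0} < ε → 0 < Fp ε ∧ Fp ε < ⊤) ∧
    (∀ ε : ℝ, sSup {ε : ℝ | 0 < ε ∧ Fw ε = 0} < ε → 0 < Fw ε ∧ Fw ε < ⊤) ∧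
    Tendsto (fun ε : ℝ => (Fp ε).toReal / Real.log ε) atTop (𝓝 1) ∧
    Tendsto (fun ε : ℝ => (Fw ε).toReal / Real.log ε) atTop (𝓝 1) ∧
    AnalyticOnNhd ℝ (fun ε : ℝ => (Fp ε).toReal) (Ioi (sSup {ε : ℝ | 0 < ε ∧ Fp ε = 0})) ∧
    AnalyticOnNhd ℝ (fun ε : ℝ => (Fw ε).toReal) (Ioi (sSup {ε : ℝ | 0 < ε ∧ Fw ε = 0})) := by
  obtain ⟨M, hEM⟩ := hE_bdd
  have hK := isKernel_ofReal hE_nonneg hE_cont hEM hE_pos hE_int hE_mass hE_mom2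
  have hνw : volume.restrict (Ici (0 : ℝ)) ≤ volume := Measure.restrict_le_self
  have hp := isRate_of_partition hE_nonneg hE_cont hEM hE_pos hK le_rfl (Z := Zpin E)
    (fun _ _ => rfl) hFp_nonneg hFp
  have hw := isRate_of_partition hE_nonneg hE_cont hEM hE_pos hK hνw (Z := Zwet E)
    (fun _ _ => rfl) hFw_nonneg hFw
  obtain ⟨η, hη, q, hq, hqe⟩ := exists_pos_le_ofReal hE_cont hE_pos
  have hq' : ∀ y ∈ Ioo 0 (min η 1), q ≤ ENNReal.ofReal (E y) := fun y hy =>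
    hqe y (by rw [abs_of_pos hy.1]; linarith [hy.2.trans_le (min_le_left _ _)])
  have hη1 : 0 < min η 1 := lt_min hη one_pos
  have hsub : Ioo 0 (min η 1) ⊆ Icc (-1) 1 := fun y hy =>
    ⟨by linarith [hy.1], (hy.2.trans_le (min_le_right _ _)).le⟩
  have hboxp : 0 < ∫⁻ z in Icc (-1) 1, ENNReal.ofReal (E z) :=
    setLIntegral_pos_of_le hη1 hq hsub hq'
  have hboxw : 0 < ∫⁻ z in Icc (-1) 1, ENNReal.ofReal (E z) ∂(volume.restrict (Ici 0)) := by
    rw [Measure.restrict_restrict measurableSet_Icc]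
    exact setLIntegral_pos_of_le hη1 hq (subset_inter hsub fun y hy => hy.1.le) hq'
  have hAp := fun {ε x : ℝ} => exists_biGen_ne_top (ε := ε) (x := x) hK le_rfl
    (fun _ hx L => exists_le_excSum_pinning hE_cont hE_pos hx L) hboxp
  have hAw := fun {ε x : ℝ} => exists_biGen_ne_top (ε := ε) (x := x) hK hνw
    (fun _ hx L => exists_le_excSum_wetting hE_cont hE_pos hx L) hboxw
  refine ⟨hp.sSup_pos, ?_, fun ε => hp.eq_zero_of_le_sSup, fun ε => hw.eq_zero_of_le_sSup,
    fun ε hε => ⟨hp.pos_of_sSup_lt hε, hp.lt_top (hp.sSup_pos.trans hε).le⟩,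
    fun ε hε => ⟨hw.pos_of_sSup_lt hε, hw.lt_top (hw.sSup_pos.trans hε).le⟩,
    hp.tendsto_div_log, hw.tendsto_div_log, hp.analyticOnNhd ?_, hw.analyticOnNhd ?_⟩
  · have hpos := hp.sSup_pos
    have hle := (hp.eq_zero_iff hpos).1 hp.eq_zero_sSup
    have hlt := (biGen_wetting_lt hE_cont hE_pos (ENNReal.ofReal_pos.2 hpos) ENNReal.ofReal_ne_top
      (ne_top_of_le_ne_top ENNReal.one_ne_top hle)).trans_le hle
    obtain ⟨ε₁, x₁, hεε, hx₁, -, hfin⟩ := hAw hpos one_pos le_rfl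
      (by rw [ENNReal.ofReal_one]; exact hlt.le)
    refine hw.lt_sSup hpos hlt hεε (ne_top_of_le_ne_top hfin ?_)
    exact biGen_mono (fun _ _ => le_rfl) le_rfl (ENNReal.one_le_ofReal.2 hx₁)
  · intro ε x hε hx hx1 hG
    obtain ⟨ε₁, x₁, hεε, -, hxx, hfin⟩ := hAp hε hx hx1.le hG
    exact ⟨ε₁, x₁, hεε, hxx hx1, hfin⟩
  · intro ε x hε hx hx1 hG
    obtain ⟨ε₁, x₁, hεε, -, hxx, hfin⟩ := hAw hε hx hx1.le hG
    exact ⟨ε₁, x₁, hεε, hxx hx1, hfin⟩
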